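/- arXiv:1512.05686 — 3 statements merged into one kernel-verified Lean document; each statement's English description precedes it below -/
import Mathlib

section
/- Let A be a commutative Noetherian ring, I ⊆ A an ideal, i a natural number, and p ∈ A. If p is a nonzerodivisor on H^i_I(A), then p (viewed in A[X]) is a nonzerodivisor on H^i_{IA[X]}(A[X]), the i-th local cohomology of the polynomial ring A[X] with support in the extended ideal IA[X]. -/
open CategoryTheory Polynomial Limits

lemma s8_fg_epi {A : Type} [CommRing A] [IsNoetherianRing A] {X Y : FGModuleCat.{0} A}
    (f : X ⟶ Y) [Epi f] : Function.Surjective f.hom.hom := by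
  have : Epi ((forget₂ (FGModuleCat.{0} A) (ModuleCat.{0} A)).map f) := inferInstance
  exact (ModuleCat.epi_iff_surjective _).1 this

lemma s8_fg_presentation {A : Type} [CommRing A] [IsNoetherianRing A] (X : FGModuleCat.{0} A) :
    ∃ (n : ℕ) (f : FGModuleCat.of A (Fin n → A) ⟶ X), Epi f := by
  obtain ⟨n, f, hf⟩ := Module.Finite.exists_fin' A X
  refine ⟨n, FGModuleCat.ofHom f, ?_⟩
  have : Epi ((forget₂ (FGModuleCat.{0} A) (ModuleCat.{0} A)).map (FGModuleCat.ofHom f)) :=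
    (ModuleCat.epi_iff_surjective _).2 hf
  exact (forget₂ (FGModuleCat.{0} A) (ModuleCat.{0} A)).epi_of_epi_map this

instance s8_fg_free {A : Type} [CommRing A] [IsNoetherianRing A] (n : ℕ) :
    Projective (FGModuleCat.of A (Fin n → A)) where
  factors {E X} f e _ := by
    obtain ⟨h, hh⟩ := Module.projective_lifting_property e.hom.hom f.hom.hom (s8_fg_epi e)
    exact ⟨FGModuleCat.ofHom h, by ext1; exact hh⟩

instance s8_fg_enough {A : Type} [CommRing A] [IsNoetherianRing A] :
    EnoughProjectives (FGModuleCat.{0} A) where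
  presentation X := by
    obtain ⟨n, f, hf⟩ := s8_fg_presentation X
    exact ⟨{ p := _, f := f }⟩

instance s8_fg_pres {A : Type} [CommRing A] [IsNoetherianRing A] :
    (forget₂ (FGModuleCat.{0} A) (ModuleCat.{0} A)).PreservesProjectiveObjects where
  projective_obj {X} hX := by
    obtain ⟨n, f, hf⟩ := s8_fg_presentation X
    let r : Retract X (FGModuleCat.of A (Fin n → A)) :=
      ⟨Projective.factorThru (𝟙 X) f, f, by simp⟩
    have : Projective ((forget₂ (FGModuleCat.{0} A) (ModuleCat.{0} A)).obj
       (FGModuleCat.of A (Fin n → A))) :=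
      (IsProjective.iff_projective (Fin n → A)).1 inferInstance
    exact (r.map (forget₂ (FGModuleCat.{0} A) (ModuleCat.{0} A))).projective

lemma s8_fg_res {A : Type} [CommRing A] [IsNoetherianRing A] (M : Type) [AddCommGroup M]
    [Module A M] [Module.Finite A M] :
    ∃ P : ProjectiveResolution (ModuleCat.of A M), ∀ i, Module.Finite A (P.complex.X i) := by
  let P := projectiveResolution (FGModuleCat.of A M)
  exact ⟨(forget₂ (FGModuleCat.{0} A) (ModuleCat.{0} A)).mapProjectiveResolution P,
    fun i => (P.complex.X i).property⟩

section
variable {R : Type} [CommRing R]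

/-- The map on Hom complexes induced by a chain map. -/
noncomputable def s8yo {K L : ChainComplex (ModuleCat.{0} R) ℕ} (φ : K ⟶ L) (N : ModuleCat.{0} R) :
    L.linearYonedaObj R N ⟶ K.linearYonedaObj R N where
  f j := ModuleCat.ofHom (Linear.leftComp R N (φ.f j))
  comm' j k _ := by
    ext (f : L.X j ⟶ N)
    change K.d k j ≫ φ.f j ≫ f = φ.f k ≫ L.d k j ≫ f
    simp

lemma s8_isoExt_nat {X Y : ModuleCat.{0} R} (u : X ⟶ Y) (P : ProjectiveResolution X)
    (Q : ProjectiveResolution Y) (φ : P.complex ⟶ Q.complex)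
    (comm : φ.f 0 ≫ Q.π.f 0 = P.π.f 0 ≫ u) (i : ℕ) (N : ModuleCat.{0} R) :
    (Q.isoExt (R := R) i N).inv ≫ ((Ext R (ModuleCat.{0} R) i).map u.op).app N =
      HomologicalComplex.homologyMap (s8yo φ N) i ≫ (P.isoExt (R := R) i N).inv := by
  have h1 := congrArg Quiver.Hom.unop (ProjectiveResolution.isoLeftDerivedObj_hom_naturality u P Q φ comm
    ((linearYoneda R (ModuleCat.{0} R)).obj N).rightOp i)
  have h2 := congrArg Quiver.Hom.unop (HomologicalComplex.homologyOp_hom_naturality (s8yo φ N) i)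
  change (HomologicalComplex.homologyUnop _ _).hom ≫ (Q.isoLeftDerivedObj _ i).hom.unop ≫
    ((((linearYoneda R (ModuleCat.{0} R)).obj N).rightOp.leftDerived i).map u).unop = 
    _ ≫ (HomologicalComplex.homologyUnop _ _).hom ≫ (P.isoLeftDerivedObj _ i).hom.unop
  refine (congrArg (fun t => (HomologicalComplex.homologyUnop _ _).hom ≫ t) h1).trans ?_
  refine Eq.trans ?_ (congrArg (fun t => t ≫ (P.isoLeftDerivedObj
    ((linearYoneda R (ModuleCat.{0} R)).obj N).rightOp i).hom.unop) h2)
  rfl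

/-- `x` is represented by the cocycle `f`. -/
def s8Rep {X : ModuleCat.{0} R} (P : ProjectiveResolution X) (i : ℕ) (N : ModuleCat.{0} R)
    (x : ((Ext R (ModuleCat.{0} R) i).obj (Opposite.op X)).obj N) (f : P.complex.X i ⟶ N) : Prop :=
  ∃ z : (P.complex.linearYonedaObj R N).cycles i,
    (P.complex.linearYonedaObj R N).iCycles i z = f ∧
    (P.isoExt (R := R) i N).inv ((P.complex.linearYonedaObj R N).homologyπ i z) = x

variable {X : ModuleCat.{0} R} (P : ProjectiveResolution X) (i : ℕ) (N : ModuleCat.{0} R)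

lemma s8Rep_exists (x : ((Ext R (ModuleCat.{0} R) i).obj (Opposite.op X)).obj N) :
    ∃ f, s8Rep P i N x f := by
  obtain ⟨z, hz⟩ := (ModuleCat.epi_iff_surjective
    ((P.complex.linearYonedaObj R N).homologyπ i ≫ (P.isoExt (R := R) i N).inv)).1 inferInstance x
  exact ⟨_, z, rfl, hz⟩

lemma s8Rep_cocycle {x : ((Ext R (ModuleCat.{0} R) i).obj (Opposite.op X)).obj N}
    {f : P.complex.X i ⟶ N} (h : s8Rep P i N x f) : P.complex.d (i + 1) i ≫ f = 0 := by
  obtain ⟨z, rfl, -⟩ := h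
  exact congrArg (fun g => g.hom z) ((P.complex.linearYonedaObj R N).iCycles_d i (i + 1))

lemma s8Rep_of_cocycle (f : P.complex.X i ⟶ N) (hf : P.complex.d (i + 1) i ≫ f = 0) :
    ∃ x, s8Rep P i N x f := by
  have hn : (ComplexShape.up ℕ).next i = i + 1 := by simp
  exact ⟨_, (P.complex.linearYonedaObj R N).cyclesMk (C := ModuleCat R) f (i+1) hn hf, 
    (P.complex.linearYonedaObj R N).i_cyclesMk (C := ModuleCat R) f (i+1) hn hf, rfl⟩

lemma s8Rep_smul {x : ((Ext R (ModuleCat.{0} R) i).obj (Opposite.op X)).obj N}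
    {f : P.complex.X i ⟶ N} (r : R) (h : s8Rep P i N x f) : s8Rep P i N (r • x) (r • f) := by
  obtain ⟨z, rfl, rfl⟩ := h
  refine ⟨r • z, ?_, ?_⟩
  · exact map_smul ((P.complex.linearYonedaObj R N).iCycles i).hom r z
  · rw [map_smul, map_smul]

lemma s8Rep_zero_iff {x : ((Ext R (ModuleCat.{0} R) i).obj (Opposite.op X)).obj N}
    {f : P.complex.X i ⟶ N} (h : s8Rep P i N x f) :
    x = 0 ↔ ∃ g : P.complex.X ((ComplexShape.up ℕ).prev i) ⟶ N,
      f = P.complex.d i ((ComplexShape.up ℕ).prev i) ≫ g := by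
  obtain ⟨z, rfl, rfl⟩ := h
  let K := P.complex.linearYonedaObj R N
  have hinj : Function.Injective (P.isoExt (R := R) i N).inv :=
    (ModuleCat.mono_iff_injective _).1 inferInstance
  rw [← map_zero (P.isoExt (R := R) i N).inv.hom]
  rw [hinj.eq_iff]
  have hex : Function.Exact (K.toCycles ((ComplexShape.up ℕ).prev i) i) (K.homologyπ i) := by
    have : (ShortComplex.mk (K.toCycles ((ComplexShape.up ℕ).prev i) i) (K.homologyπ i) (by simp)).Exact :=
      ShortComplex.exact_of_g_is_cokernel _ (K.homologyIsCokernel _ i rfl)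
    exact (ShortComplex.ShortExact.moduleCat_exact_iff_function_exact _).1 this
  have hi : Function.Injective (K.iCycles i) := (ModuleCat.mono_iff_injective _).1 inferInstance
  refine (hex z).trans ⟨?_, ?_⟩
  · rintro ⟨g, rfl⟩
    exact ⟨g, congrArg (fun t => t.hom g) (K.toCycles_i ((ComplexShape.up ℕ).prev i) i)⟩
  · rintro ⟨g, hg⟩
    refine ⟨g, hi (Eq.trans ?_ hg.symm)⟩
    exact congrArg (fun t => t.hom g) (K.toCycles_i ((ComplexShape.up ℕ).prev i) i)

lemma s8Rep_map {Y : ModuleCat.{0} R} (u : X ⟶ Y) 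
    (Q : ProjectiveResolution Y) (φ : P.complex ⟶ Q.complex)
    (comm : φ.f 0 ≫ Q.π.f 0 = P.π.f 0 ≫ u)
    {x : ((Ext R (ModuleCat.{0} R) i).obj (Opposite.op Y)).obj N}
    {f : Q.complex.X i ⟶ N} (h : s8Rep Q i N x f) : 
    s8Rep P i N (((Ext R (ModuleCat.{0} R) i).map u.op).app N x) (φ.f i ≫ f) := by
  obtain ⟨z, rfl, rfl⟩ := h
  refine ⟨HomologicalComplex.cyclesMap (s8yo φ N) i z, ?_, ?_⟩
  · exact congrArg (fun t => t.hom z) (HomologicalComplex.cyclesMap_i (s8yo φ N) i)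
  · have h1 := congrArg (fun t => t.hom z) (HomologicalComplex.homologyπ_naturality (s8yo φ N) i)
    have h2 := congrArg (fun t => t.hom ((Q.complex.linearYonedaObj R N).homologyπ i z)) 
      (s8_isoExt_nat u P Q φ comm i N)
    refine Eq.trans ?_ h2.symm
    exact congrArg (P.isoExt (R := R) i N).inv h1.symm
end

section
variable {R : Type} [CommRing R]

/-- The Ext module `Ext^i(R/J^n, N)`. -/
noncomputable abbrev s8E (J : Ideal R) (i : ℕ) (N : ModuleCat.{0} R) (n : ℕ) : ModuleCat.{0} R :=
  ((Ext R (ModuleCat.{0} R) i).obj (Opposite.op (ModuleCat.of R (R ⧸ J ^ n)))).obj N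

/-- Transition map of quotients. -/
noncomputable abbrev s8q (J : Ideal R) {n m : ℕ} (h : n ≤ m) :
    ModuleCat.of R (R ⧸ J ^ m) ⟶ ModuleCat.of R (R ⧸ J ^ n) :=
  ModuleCat.ofHom (Submodule.mapQ _ _ LinearMap.id (Ideal.pow_le_pow_right h))

noncomputable abbrev s8t (J : Ideal R) (i : ℕ) (N : ModuleCat.{0} R) {n m : ℕ} (h : n ≤ m) :
    s8E J i N n ⟶ s8E J i N m :=
  ((Ext R (ModuleCat.{0} R) i).map (s8q J h).op).app N

lemma s8_regular_iff (J : Ideal R) (i : ℕ) (N : ModuleCat.{0} R) (r : R) :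
    IsSMulRegular ((localCohomology J i).obj N) r ↔
    ∀ (n : ℕ) (x : s8E J i N n), (∃ (m : ℕ) (h : n ≤ m), (s8t J i N h) (r • x) = 0) →
      ∃ (m : ℕ) (h : n ≤ m), (s8t J i N h) x = 0 := by
  let D := localCohomology.diagram (localCohomology.idealPowersDiagram J) i
  have hD : HasColimit D := localCohomology.hasColimitDiagram.{0,0} _ i
  let c : Cocone (D ⋙ (evaluation _ _).obj N) := ((evaluation _ _).obj N).mapCocone (colimit.cocone D)
  let hc : IsColimit c := isColimitOfPreserves ((evaluation _ _).obj N) (colimit.isColimit D)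
  let u (n : ℕ) : s8E J i N n ⟶ (localCohomology J i).obj N := c.ι.app (Opposite.op (Opposite.op n))
  have hsurj : ∀ y : (localCohomology J i).obj N, ∃ n x, u n x = y := by
    intro y
    obtain ⟨j, x, hx⟩ := Concrete.isColimit_exists_rep _ hc y
    exact ⟨j.unop.unop, x, hx⟩
  have hker : ∀ n (x : s8E J i N n), u n x = 0 ↔ ∃ (m : ℕ) (h : n ≤ m), (s8t J i N h) x = 0 := by
    intro n x
    rw [← map_zero (u n).hom]
    constructor
    · intro h
      obtain ⟨k, f, g, hh⟩ := (Concrete.isColimit_rep_eq_iff_exists _ hc (i := Opposite.op (Opposite.op n)) (j := Opposite.op (Opposite.op n)) x 0).1 h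
      refine ⟨k.unop.unop, f.unop.unop.le, ?_⟩
      refine Eq.trans ?_ (hh.trans ?_)
      · rfl
      · exact map_zero _
    · rintro ⟨m, h, hh⟩
      refine (Concrete.isColimit_rep_eq_iff_exists _ hc (i := Opposite.op (Opposite.op n)) (j := Opposite.op (Opposite.op n)) x 0).2
        ⟨Opposite.op (Opposite.op m), (homOfLE h).op.op, (homOfLE h).op.op, ?_⟩
      refine Eq.trans ?_ (hh.trans ?_)
      · rfl
      · exact (map_zero _).symm
  rw [isSMulRegular_iff_right_eq_zero_of_smul]
  constructor
  · intro H n x hx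
    rw [← hker] at hx ⊢
    apply H
    rw [← hx]
    exact ((u n).hom.map_smul r x).symm
  · intro H y hy
    obtain ⟨n, x, rfl⟩ := hsurj y
    rw [hker]
    apply H
    rw [← hker, ← hy]
    exact ((u n).hom.map_smul r x)
end

open TensorProduct ChangeOfRings in
/-- Base change of a quotient. -/
lemma s8_quot_iso {A B : Type} [CommRing A] [CommRing B] (f : A →+* B) (I : Ideal A) (J : Ideal B)
    (hJ : J = I.map f) :
    ∃ e : (ModuleCat.extendScalars.{0,0,0} f).obj (ModuleCat.of A (A ⧸ I)) ≅ ModuleCat.of B (B ⧸ J),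
      ∀ a : A, e.hom.hom ((1 : B) ⊗ₜ[A,f] (Ideal.Quotient.mk I a)) = Ideal.Quotient.mk J (f a) := by
  subst hJ
  let _ := f.toAlgebra
  let e := (Algebra.TensorProduct.quotIdealMapEquivTensorQuot B I).toLinearEquiv
  let e' : ModuleCat.of B (B ⊗[A] (A ⧸ I)) ≅ ModuleCat.of B (B ⧸ I.map f) := e.symm.toModuleIso
  refine ⟨e', fun a => ?_⟩
  change e.symm ((1 : B) ⊗ₜ[A] (Ideal.Quotient.mk I a)) = Ideal.Quotient.mk (I.map f) (f a)
  rw [LinearEquiv.symm_apply_eq]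
  change _ = (Algebra.TensorProduct.quotIdealMapEquivTensorQuot B I)
    (Ideal.Quotient.mk (I.map (algebraMap A B)) (f a))
  rw [Algebra.TensorProduct.quotIdealMapEquivTensorQuot_mk]
  have : f a = a • (1 : B) := by simp [Algebra.smul_def]; rfl
  rw [this, TensorProduct.smul_tmul, ← map_one (Ideal.Quotient.mk I)]
  congr 1
  change _ = Ideal.Quotient.mk I (a * 1)
  rw [mul_one]

open ChangeOfRings in
lemma s8_quot_nat {A B : Type} [CommRing A] [CommRing B] (f : A →+* B) (I : Ideal A) (J : Ideal B)
    {n m : ℕ} (h : n ≤ m)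
    (en : (ModuleCat.extendScalars.{0,0,0} f).obj (ModuleCat.of A (A ⧸ I ^ n)) ≅ ModuleCat.of B (B ⧸ J ^ n))
    (hen : ∀ a : A, en.hom.hom ((1 : B) ⊗ₜ[A,f] (Ideal.Quotient.mk (I ^ n) a)) = Ideal.Quotient.mk (J ^ n) (f a))
    (em : (ModuleCat.extendScalars.{0,0,0} f).obj (ModuleCat.of A (A ⧸ I ^ m)) ≅ ModuleCat.of B (B ⧸ J ^ m))
    (hem : ∀ a : A, em.hom.hom ((1 : B) ⊗ₜ[A,f] (Ideal.Quotient.mk (I ^ m) a)) = Ideal.Quotient.mk (J ^ m) (f a)) :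
    (ModuleCat.extendScalars.{0,0,0} f).map (s8q I h) ≫ en.hom = em.hom ≫ s8q J h := by
  apply ModuleCat.ExtendScalars.hom_ext
  intro a
  obtain ⟨a, rfl⟩ := Ideal.Quotient.mk_surjective a
  refine (hen a).trans ?_
  exact (congrArg (s8q J h).hom (hem a)).symm

instance s8_ext_add {A B : Type} [CommRing A] [CommRing B] (f : A →+* B) :
    (ModuleCat.extendScalars.{0,0,0} f).Additive :=
  (ModuleCat.extendRestrictScalarsAdj.{0,0,0} f).left_adjoint_additive

/-- Transport of a resolution along an isomorphism. -/
noncomputable def s8_res_of_iso {B : Type} [CommRing B] {M M' : ModuleCat.{0} B}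
    (Q : ProjectiveResolution M) (e : M ≅ M') : ProjectiveResolution M' where
  complex := Q.complex
  projective := Q.projective
  π := Q.π ≫ (ChainComplex.single₀ _).map e.hom
  quasiIso := by
    have : IsIso ((ChainComplex.single₀ _).map e.hom) := inferInstance
    have h1 : QuasiIso Q.π := Q.quasiIso
    exact quasiIso_comp _ _

/-- The base-changed resolution. -/
noncomputable def s8Q {A B : Type} [CommRing A] [CommRing B] (f : A →+* B) (hf : f.Flat)
    {M : ModuleCat.{0} A} {M' : ModuleCat.{0} B} (e : (ModuleCat.extendScalars.{0,0,0} f).obj M ≅ M')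
    (P : ProjectiveResolution M) : ProjectiveResolution M' :=
  have := ModuleCat.preservesFiniteLimits_extendScalars_of_flat hf
  have : (ModuleCat.extendScalars.{0,0,0} f).PreservesProjectiveObjects :=
    Functor.preservesProjectiveObjects_of_adjunction_of_preservesEpimorphisms
      (ModuleCat.extendRestrictScalarsAdj.{0,0,0} f)
  have : (ModuleCat.extendScalars.{0,0,0} f).PreservesHomology := inferInstance
  s8_res_of_iso ((ModuleCat.extendScalars.{0,0,0} f).mapProjectiveResolution P) e

lemma s8Q_comm {A B : Type} [CommRing A] [CommRing B] (f : A →+* B) (hf : f.Flat)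
    {M N : ModuleCat.{0} A} {M' N' : ModuleCat.{0} B}
    (e : (ModuleCat.extendScalars.{0,0,0} f).obj M ≅ M')
    (e' : (ModuleCat.extendScalars.{0,0,0} f).obj N ≅ N')
    (P : ProjectiveResolution M) (P' : ProjectiveResolution N)
    (u : M ⟶ N) (v : M' ⟶ N') (hu : (ModuleCat.extendScalars.{0,0,0} f).map u ≫ e'.hom = e.hom ≫ v)
    (φ : P.complex ⟶ P'.complex) (comm : φ.f 0 ≫ P'.π.f 0 = P.π.f 0 ≫ u) :
    (((ModuleCat.extendScalars.{0,0,0} f).mapHomologicalComplex _).map φ).f 0 ≫ (s8Q f hf e' P').π.f 0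
      = (s8Q f hf e P).π.f 0 ≫ v := by
  have h (M : ModuleCat.{0} A) (M' : ModuleCat.{0} B) (e : (ModuleCat.extendScalars.{0,0,0} f).obj M ≅ M')
     (P : ProjectiveResolution M) : (s8Q f hf e P).π.f 0 =
      (ModuleCat.extendScalars.{0,0,0} f).map (P.π.f 0) ≫ e.hom := by
    simp [s8Q, s8_res_of_iso, HomologicalComplex.singleMapHomologicalComplex]
    rfl
  rw [h, h]
  have h1 : (ModuleCat.extendScalars.{0,0,0} f).map (φ.f 0) ≫
      (ModuleCat.extendScalars.{0,0,0} f).map (P'.π.f 0) =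
      (ModuleCat.extendScalars.{0,0,0} f).map (P.π.f 0) ≫
      (ModuleCat.extendScalars.{0,0,0} f).map u := by
    rw [← Functor.map_comp, comm]
    exact Functor.map_comp _ _ _
  exact (congrArg (fun t => t ≫ e'.hom) h1).trans
    (congrArg (fun t => (ModuleCat.extendScalars.{0,0,0} f).map (P.π.f 0) ≫ t) hu)

/-- coefficient -/
noncomputable def s8π {A : Type} [CommRing A] (k : ℕ) :
    (ModuleCat.restrictScalars.{0,0,0} (C : A →+* A[X])).obj (ModuleCat.of A[X] A[X]) ⟶
      ModuleCat.of A A :=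
  ModuleCat.ofHom (X := (ModuleCat.restrictScalars.{0,0,0} (C : A →+* A[X])).obj (ModuleCat.of A[X] A[X]))
  { toFun := fun (b : A[X]) => b.coeff k
    map_add' := fun (b c : A[X]) => coeff_add b c k
    map_smul' := fun _ (b : A[X]) => coeff_C_mul b }

/-- monomial -/
noncomputable def s8ι {A : Type} [CommRing A] (k : ℕ) :
    ModuleCat.of A A ⟶
    (ModuleCat.restrictScalars.{0,0,0} (C : A →+* A[X])).obj (ModuleCat.of A[X] A[X]) :=
  ModuleCat.ofHom (Y := (ModuleCat.restrictScalars.{0,0,0} (C : A →+* A[X])).obj (ModuleCat.of A[X] A[X]))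
  { toFun := fun (b : A) => (monomial k b : A[X])
    map_add' := fun b c => map_add _ b c
    map_smul' := fun a b => (C_mul_monomial (a := a) (b := b) (n := k)).symm }

lemma s8_sum {A : Type} [CommRing A] (M : ModuleCat.{0} A) [Module.Finite A M] (f : M ⟶ 
    (ModuleCat.restrictScalars.{0,0,0} (C : A →+* A[X])).obj (ModuleCat.of A[X] A[X])) :
    ∃ N : ℕ, f = ∑ k ∈ Finset.range N, f ≫ s8π k ≫ s8ι k := by
  obtain ⟨s, hs⟩ := (Module.Finite.fg_top : (⊤ : Submodule A M).FG)
  let g (m : M) : A[X] := f.hom m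
  have key : ∃ N : ℕ, ∀ m : M, ∀ k ≥ N, (g m).coeff k = 0 := by
    refine ⟨s.sup (fun m => (g m).natDegree) + 1, fun m k hk => ?_⟩
    have hm : m ∈ Submodule.span A (s : Set M) := by rw [hs]; trivial
    have hle : Submodule.span A (s : Set M) ≤ LinearMap.ker (f ≫ s8π k).hom := by
      rw [Submodule.span_le]
      intro m hm
      change (g m).coeff k = 0
      apply coeff_eq_zero_of_natDegree_lt
      have := Finset.le_sup (f := fun m => (g m).natDegree) hm
      omega
    exact hle hm
  obtain ⟨N, hN⟩ := key
  refine ⟨N, ?_⟩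
  ext m
  rw [ModuleCat.hom_sum, LinearMap.sum_apply]
  change g m = ∑ k ∈ Finset.range N, (monomial k ((g m).coeff k) : A[X])
  ext j
  rw [finsetSum_coeff]
  simp only [coeff_monomial]
  rw [Finset.sum_ite_eq' ]
  split_ifs with hj
  · rfl
  · exact hN m j (by simpa using hj)

lemma s8t_zero {R : Type} [CommRing R] (J : Ideal R) (i : ℕ) (N : ModuleCat.{0} R) {n m l : ℕ}
    (h : n ≤ m) (h' : m ≤ l) (x : s8E J i N n) (hx : s8t J i N h x = 0) :
    s8t J i N (h.trans h') x = 0 := by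
  have h1 : s8q J (h.trans h') = s8q J h' ≫ s8q J h := by
    ext; rfl
  have h2 : s8t J i N (h.trans h') = s8t J i N h ≫ s8t J i N h' := by
    unfold s8t
    rw [h1, op_comp, Functor.map_comp, NatTrans.comp_app]
  rw [h2]
  change s8t J i N h' (s8t J i N h x) = 0
  rw [hx, map_zero]

open CategoryTheory Polynomial

/-- Let `A` be a commutative Noetherian ring, `I ⊆ A` an ideal, `i` a
natural number, and `p ∈ A`. If `p` is a nonzerodivisor on `H^i_I(A)`, then `p` (viewed in
`A[X]`) is a nonzerodivisor on `H^i_{IA[X]}(A[X])`, the `i`-th local cohomology of the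
polynomial ring `A[X]` with support in the extended ideal `IA[X]`. -/
theorem stmt_8 (A : Type) [CommRing A] [IsNoetherianRing A] (I : Ideal A) (i : ℕ) (p : A)
    (h : IsSMulRegular ((localCohomology I i).obj (ModuleCat.of A A)) p) :
    IsSMulRegular
      ((localCohomology (I.map (Polynomial.C : A →+* A[X])) i).obj
        (ModuleCat.of A[X] A[X]))
      (Polynomial.C p) := by
  rw [s8_regular_iff] at h ⊢
  have hflat : (C : A →+* A[X]).Flat := by
    have : Module.Flat A A[X] := inferInstance
    have h2 : (algebraMap A A[X]).Flat := (RingHom.flat_algebraMap_iff).2 this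
    exact h2
  set J := I.map (C : A →+* A[X]) with hJ
  have hP : ∀ n : ℕ, ∃ P : ProjectiveResolution (ModuleCat.of A (A ⧸ I ^ n)),
      ∀ i, Module.Finite A (P.complex.X i) := fun n => s8_fg_res _
  choose P hPf using hP
  have hE := fun n : ℕ => s8_quot_iso (C : A →+* A[X]) (I ^ n) (J ^ n) (by rw [hJ, Ideal.map_pow])
  choose e he using hE
  let Q (n : ℕ) := s8Q C hflat (e n) (P n)
  let φ {n m : ℕ} (h : n ≤ m) : (P m).complex ⟶ (P n).complex :=
    ProjectiveResolution.lift (s8q I h) (P m) (P n)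
  have hφ {n m : ℕ} (h : n ≤ m) : (φ h).f 0 ≫ (P n).π.f 0 = (P m).π.f 0 ≫ s8q I h :=
    ProjectiveResolution.lift_commutes_zero _ _ _
  let F := ModuleCat.extendScalars.{0,0,0} (C : A →+* A[X])
  let ψ {n m : ℕ} (h : n ≤ m) : (Q m).complex ⟶ (Q n).complex :=
    (F.mapHomologicalComplex _).map (φ h)
  have hψ {n m : ℕ} (h : n ≤ m) : (ψ h).f 0 ≫ (Q n).π.f 0 = (Q m).π.f 0 ≫ s8q J h :=
    s8Q_comm C hflat (e m) (e n) (P m) (P n) _ _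
      (s8_quot_nat C I J h (e n) (he n) (e m) (he m)) (φ h) (hφ h)
  let adj := ModuleCat.extendRestrictScalarsAdj.{0,0,0} (C : A →+* A[X])
  let N := ModuleCat.of A[X] A[X]
  let G := ModuleCat.restrictScalars.{0,0,0} (C : A →+* A[X])
  have hadj {M M' : ModuleCat.{0} A} (u : M ⟶ M') (v : F.obj M' ⟶ N) :
      adj.homEquiv M N (F.map u ≫ v) = u ≫ adj.homEquiv M' N v := adj.homEquiv_naturality_left u v
  have hadj0 {M : ModuleCat.{0} A} : adj.homEquiv M N 0 = 0 := rfl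
  have hadjs {M : ModuleCat.{0} A} (v : F.obj M ⟶ N) :
      adj.homEquiv M N (C p • v) = p • adj.homEquiv M N v := rfl
  intro n x ⟨m, hm, hx⟩
  obtain ⟨f, hf⟩ := s8Rep_exists (Q n) i N x
  have hfc : F.map ((P n).complex.d (i + 1) i) ≫ f = 0 := s8Rep_cocycle _ _ _ hf
  have h1 := s8Rep_map (Q m) i N (s8q J hm) (Q n) (ψ hm) (hψ hm) (s8Rep_smul _ _ _ (C p) hf)
  let j := (ComplexShape.up ℕ).prev i
  obtain ⟨g, hg⟩ : ∃ g : (Q m).complex.X j ⟶ N, _ = (Q m).complex.d i j ≫ g :=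
    (s8Rep_zero_iff _ _ _ h1).1 hx
  let f' : (P n).complex.X i ⟶ G.obj N := adj.homEquiv _ _ f
  let g' : (P m).complex.X j ⟶ G.obj N := adj.homEquiv _ _ g
  have hf'c : (P n).complex.d (i + 1) i ≫ f' = 0 := by
    exact (hadj _ f).symm.trans (congrArg (adj.homEquiv _ N) hfc)
  have hg' : (φ hm).f i ≫ (p • f') = (P m).complex.d i j ≫ g' := by
    refine (hadj ((φ hm).f i) (C p • f)).symm.trans ?_
    exact (congrArg (adj.homEquiv _ N) hg).trans (hadj ((P m).complex.d i j) g)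
  have hk : ∀ k : ℕ, ∃ (y : s8E I i (ModuleCat.of A A) n) (m' : ℕ) (h' : n ≤ m'),
      s8Rep (P n) i _ y (f' ≫ s8π k) ∧ s8t I i _ h' y = 0 := by
    intro k
    obtain ⟨y, hy⟩ := s8Rep_of_cocycle (P n) i (ModuleCat.of A A) (f' ≫ s8π k)
      (by rw [← Category.assoc, hf'c, Limits.zero_comp])
    have h2 := s8Rep_map (P m) i _ (s8q I hm) (P n) (φ hm) (hφ hm) (s8Rep_smul _ _ _ p hy)
    obtain ⟨m', h', hh⟩ := h n y ⟨m, hm, (s8Rep_zero_iff _ _ _ h2).2 ⟨g' ≫ s8π k, by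
      rw [← Category.assoc, ← hg', Category.assoc, Linear.smul_comp]⟩⟩
    exact ⟨y, m', h', hy, hh⟩
  choose y m' hm' hy hy0 using hk
  have := hPf n i
  obtain ⟨K, hK⟩ := s8_sum ((P n).complex.X i) f'
  let M := n + ∑ k ∈ Finset.range K, m' k
  have hM : n ≤ M := Nat.le_add_right _ _
  refine ⟨M, hM, ?_⟩
  have h3 := s8Rep_map (Q M) i N (s8q J hM) (Q n) (ψ hM) (hψ hM) hf
  have h4 : ∀ k ∈ Finset.range K, ∃ g : (P M).complex.X j ⟶ ModuleCat.of A A,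
      (φ hM).f i ≫ f' ≫ s8π k = (P M).complex.d i j ≫ g := by
    intro k hk
    have hkM : m' k ≤ M := (Finset.single_le_sum (f := m') (fun _ _ => Nat.zero_le _) hk).trans
      (Nat.le_add_left _ _)
    have h5 := s8t_zero I i _ (hm' k) hkM (y k) (hy0 k)
    have h6 := s8Rep_map (P M) i _ (s8q I hM) (P n) (φ hM) (hφ hM) (hy k)
    exact (s8Rep_zero_iff _ _ _ h6).1 h5
  choose! gk hgk using h4
  have h7 : (φ hM).f i ≫ f' = (P M).complex.d i j ≫ ∑ k ∈ Finset.range K, gk k ≫ s8ι k := by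
    rw [hK, Preadditive.comp_sum, Preadditive.comp_sum]
    refine Finset.sum_congr rfl fun k hk => ?_
    rw [← Category.assoc ((P M).complex.d i j), ← hgk k hk]
    simp only [Category.assoc]
  refine (s8Rep_zero_iff _ _ _ h3).2 ⟨(adj.homEquiv _ N).symm (∑ k ∈ Finset.range K, gk k ≫ s8ι k), ?_⟩
  apply (adj.homEquiv _ N).injective
  refine (hadj ((φ hM).f i) f).trans (h7.trans ?_)
  refine Eq.trans ?_ (hadj ((P M).complex.d i j) _).symm
  rw [Equiv.apply_symm_apply]
end

section
/- Let p be a prime number and let S be either the polynomial ring ℤ[X₁,…,Xₙ] or its localization at the prime ideal (p, X₁,…,Xₙ). Let f₁,…,f_k ∈ S be such that f₁,…,f_k, p is a regular sequence in S, and set J = (f₁,…,f_k)S. Then for every i ≥ 0, p is a nonzerodivisor on H^i_J(S). -/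
open CategoryTheory

/-- The polynomial ring `ℤ[X₁,…,Xₙ]`. -/
noncomputable abbrev Rn (n : ℕ) : Type := MvPolynomial (Fin n) ℤ

universe u
namespace LCAux
open CategoryTheory RingTheory.Sequence
open scoped Pointwise
section reg
variable {R : Type u} [CommRing R]

lemma wr_of_subsingleton (M : Type u) [AddCommGroup M] [Module R M] [Subsingleton M]
    (rs : List R) : IsWeaklyRegular M rs := by
  refine ⟨fun i h => ?_⟩
  intro a b _
  exact Subsingleton.elim _ _

lemma wr_ext (rs : List R) : ∀ (M M₂ M₃ : Type u) [AddCommGroup M] [Module R M]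
    [AddCommGroup M₂] [Module R M₂] [AddCommGroup M₃] [Module R M₃]
    (f : M →ₗ[R] M₂) (g : M₂ →ₗ[R] M₃), Function.Injective f → Function.Exact f g →
    Function.Surjective g → IsWeaklyRegular M rs → IsWeaklyRegular M₃ rs →
    IsWeaklyRegular M₂ rs := by
  induction rs with
  | nil => intros; exact IsWeaklyRegular.nil _ _
  | cons r rs ih =>
    intro M M₂ M₃ _ _ _ _ _ _ f g hf hfg hg h h₃
    rw [isWeaklyRegular_cons_iff] at h h₃ ⊢
    refine ⟨isSMulRegular_of_range_eq_ker hf hfg.linearMap_ker_eq.symm h.1 h₃.1, ?_⟩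
    refine ih _ _ _ (QuotSMulTop.map r f) (QuotSMulTop.map r g) ?_
      (QuotSMulTop.map_exact r hfg hg) (QuotSMulTop.map_surjective r hg) h.2 h₃.2
    have h0 : Function.Exact (0 : PUnit.{u+1} →ₗ[R] M) f := by
      intro y
      constructor
      · intro hy; exact ⟨0, by simpa using (hf (hy.trans (map_zero f).symm)).symm⟩
      · rintro ⟨_, rfl⟩; simp
    have := QuotSMulTop.map_first_exact_on_four_term_exact_of_isSMulRegular_last h0 hfg h₃.1
    rw [← LinearMap.ker_eq_bot, this.linearMap_ker_eq, eq_bot_iff]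
    rintro _ ⟨y, rfl⟩
    simp

lemma wr_pow_head (M : Type u) [AddCommGroup M] [Module R M] (r : R) (rs : List R)
    (h : IsWeaklyRegular M (r :: rs)) (e : ℕ) : IsWeaklyRegular M (r ^ e :: rs) := by
  rw [isWeaklyRegular_cons_iff] at h ⊢
  refine ⟨h.1.pow e, ?_⟩
  induction e with
  | zero =>
    have : Subsingleton (QuotSMulTop (r ^ 0) M) := by
      refine Submodule.Quotient.subsingleton_iff.2 ?_
      simp
    exact wr_of_subsingleton _ _
  | succ e ih =>
    have h1 : (r ^ e • (⊤ : Submodule R M)) ≤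
        (r ^ (e+1) • (⊤ : Submodule R M)).comap (LinearMap.lsmul R M r) := by
      rintro _ ⟨y, -, rfl⟩
      exact ⟨y, trivial, by simp [smul_smul, pow_succ, mul_comm]⟩
    have h2 : (r ^ (e+1) • (⊤ : Submodule R M)) ≤
        (r • (⊤ : Submodule R M)).comap LinearMap.id := by
      rintro _ ⟨y, -, rfl⟩
      exact ⟨r ^ e • y, trivial, by simp [smul_smul, pow_succ, mul_comm]⟩
    refine wr_ext rs _ _ _ (Submodule.mapQ _ _ _ h1) (Submodule.mapQ _ _ _ h2) ?_ ?_ ?_ ih h.2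
    · rw [← LinearMap.ker_eq_bot, eq_bot_iff]
      intro x hx
      obtain ⟨x, rfl⟩ := Submodule.Quotient.mk_surjective _ x
      rw [LinearMap.mem_ker, Submodule.mapQ_apply, Submodule.Quotient.mk_eq_zero] at hx
      obtain ⟨y, -, hy⟩ := hx
      rw [Submodule.mem_bot, Submodule.Quotient.mk_eq_zero]
      refine ⟨y, trivial, h.1 ?_⟩
      simpa [pow_succ', mul_smul] using hy
    · intro x
      obtain ⟨x, rfl⟩ := Submodule.Quotient.mk_surjective _ x
      rw [Submodule.mapQ_apply, Submodule.Quotient.mk_eq_zero]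
      constructor
      · rintro ⟨y, -, hy⟩
        refine ⟨Submodule.Quotient.mk y, ?_⟩
        rw [Submodule.mapQ_apply]
        congr 1
      · rintro ⟨y, hy⟩
        obtain ⟨y, rfl⟩ := Submodule.Quotient.mk_surjective _ y
        rw [Submodule.mapQ_apply, Submodule.Quotient.eq] at hy
        have := h2 hy
        have h3 : r • y ∈ (r • (⊤ : Submodule R M)) := ⟨y, trivial, rfl⟩
        have := (r • (⊤ : Submodule R M)).sub_mem h3 this
        simpa using this
    · intro x
      obtain ⟨x, rfl⟩ := Submodule.Quotient.mk_surjective _ x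
      exact ⟨Submodule.Quotient.mk x, rfl⟩

lemma wr_pow (e : ℕ) (q : R) (rs : List R) : ∀ (M : Type u) [AddCommGroup M] [Module R M],
    IsWeaklyRegular M (rs ++ [q]) → IsWeaklyRegular M (rs.map (· ^ e) ++ [q]) := by
  induction rs with
  | nil => intro M _ _ h; simpa using h
  | cons r rs ih =>
    intro M _ _ h
    have := wr_pow_head M r _ h e
    rw [List.map_cons, List.cons_append]
    rw [isWeaklyRegular_cons_iff] at this ⊢
    exact ⟨this.1, ih _ this.2⟩
end reg

section ext
variable (A : Type u) [CommRing A]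
open Abelian

def EP (N : Type u) [AddCommGroup N] [Module A N] (d : ℕ) : Prop :=
  (∀ i ≠ d, Subsingleton (Ext.{u} (ModuleCat.of A N) (ModuleCat.of A A) i)) ∧
  Nonempty (Ext.{u} (ModuleCat.of A N) (ModuleCat.of A A) d ≃ₗ[A] N)

variable {A}

noncomputable def extCongr {X X' : ModuleCat.{u} A} (e : X ≅ X') (Y : ModuleCat.{u} A) (i : ℕ) :
    Ext.{u} X Y i ≃ₗ[A] Ext.{u} X' Y i where
  toFun z := (Ext.mk₀ e.inv).comp z (zero_add _)
  invFun z := (Ext.mk₀ e.hom).comp z (zero_add _)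
  map_add' := by simp
  map_smul' := by simp
  left_inv z := by simp
  right_inv z := by simp

lemma EP.congr {N N' : Type u} [AddCommGroup N] [Module A N] [AddCommGroup N'] [Module A N']
    {d : ℕ} (h : EP A N d) (e : N ≃ₗ[A] N') : EP A N' d := by
  refine ⟨fun i hi => ?_, ?_⟩
  · have := h.1 i hi
    exact (extCongr e.toModuleIso (ModuleCat.of A A) i).symm.toEquiv.subsingleton
  · obtain ⟨φ⟩ := h.2
    exact ⟨(extCongr e.toModuleIso (ModuleCat.of A A) d).symm.trans (φ.trans e)⟩

lemma ext_step {X Q Y : ModuleCat.{u} A} (x : A) (g : X ⟶ Q) (w : (x • 𝟙 X) ≫ g = 0)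
    (hS : (ShortComplex.mk (x • 𝟙 X) g w).ShortExact) (d : ℕ)
    (h0 : ∀ i ≠ d, Subsingleton (Ext.{u} X Y i)) (hreg : IsSMulRegular (Ext.{u} X Y d) x) :
    (∀ i ≠ d + 1, Subsingleton (Ext.{u} Q Y i)) ∧
    Nonempty (QuotSMulTop x (Ext.{u} X Y d) ≃ₗ[A] Ext.{u} Q Y (d + 1)) := by
  have hf : ∀ (i : ℕ) (z : Ext.{u} X Y i),
      (Ext.mk₀ (x • 𝟙 X)).comp z (zero_add _) = x • z := by
    intro i z
    rw [Ext.mk₀_smul, Ext.smul_comp, Ext.mk₀_id_comp]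
  have hw : ∀ (i : ℕ) (z : Ext.{u} Q Y i), (Ext.mk₀ g).comp z (zero_add _) = 0 := by
    intro i z
    by_cases hi : i = d
    · subst hi
      apply hreg
      change x • _ = x • _
      rw [← hf, smul_zero, Ext.mk₀_comp_mk₀_assoc, w, Ext.mk₀_zero, Ext.zero_comp]
    · have := h0 i hi
      exact Subsingleton.elim _ _
  refine ⟨fun i hi => ?_, ?_⟩
  · refine ⟨fun z z' => ?_⟩
    suffices ∀ z : Ext.{u} Q Y i, z = 0 from (this z).trans (this z').symm
    intro z
    cases i with
    | zero =>
      have : Epi g := hS.epi_g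
      exact Ext.precomp_mk₀_injective_of_epi Y g ((hw 0 z).trans (by simp))
    | succ i =>
      obtain ⟨y, rfl⟩ := Ext.contravariant_sequence_exact₃ hS Y z (hw _ z) (add_comm 1 i)
      have := h0 i (by omega)
      have hy : y = 0 := Subsingleton.elim (α := Ext.{u} X Y i) y 0
      rw [hy]
      exact Ext.comp_zero ..
  · let ψ : Ext.{u} X Y d →ₗ[A] Ext.{u} Q Y (d+1) :=
      { toFun := fun y => hS.extClass.comp y (add_comm 1 d)
        map_add' := by intros; exact Ext.comp_add ..
        map_smul' := by intros; exact Ext.comp_smul .. }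
    have hψ : Function.Surjective ψ := fun z =>
      Ext.contravariant_sequence_exact₃ hS Y z (hw _ z) (add_comm 1 d)
    have hker : LinearMap.ker ψ = x • ⊤ := by
      ext y
      constructor
      · intro hy
        obtain ⟨w, hw⟩ := Ext.contravariant_sequence_exact₁ hS Y y (add_comm 1 d) hy
        exact ⟨w, trivial, (hf _ w).symm.trans hw⟩
      · rintro ⟨w, -, rfl⟩
        change hS.extClass.comp (x • w) (add_comm 1 d) = 0
        rw [← hf]
        exact hS.extClass_comp_assoc ..
    exact ⟨((Submodule.quotEquivOfEq _ _ hker).symm.trans (ψ.quotKerEquivOfSurjective hψ))⟩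

lemma EP.step {N : Type u} [AddCommGroup N] [Module A N] {d : ℕ} (h : EP A N d) {x : A}
    (hx : IsSMulRegular N x) : EP A (QuotSMulTop x N) (d + 1) := by
  obtain ⟨h0, ⟨φ⟩⟩ := h
  have hS := IsSMulRegular.smulShortComplex_shortExact (M := ModuleCat.of A N) hx
  obtain ⟨h1, ⟨ψ⟩⟩ := ext_step (X := ModuleCat.of A N) (Q := ModuleCat.of A (QuotSMulTop x N))
    (Y := ModuleCat.of A A) x ((ModuleCat.of A N).smulShortComplex x).g
    ((ModuleCat.of A N).smulShortComplex x).zero hS d h0 ((φ.isSMulRegular_congr x).2 hx)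
  exact ⟨h1, ⟨ψ.symm.trans (QuotSMulTop.congr x φ)⟩⟩

lemma EP.list (rs : List A) : ∀ (N : Type u) [AddCommGroup N] [Module A N] (d : ℕ),
    EP A N d → IsWeaklyRegular N rs → 
    EP A (N ⧸ (Ideal.ofList rs • ⊤ : Submodule A N)) (d + rs.length) := by
  induction rs with
  | nil => 
    intro N _ _ d h _
    exact h.congr (Submodule.quotEquivOfEqBot _ (by simp)).symm
  | cons r rs ih =>
    intro N _ _ d h hr
    rw [isWeaklyRegular_cons_iff] at hr
    have := (ih _ _ (h.step hr.1) hr.2).congr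
      (Submodule.quotOfListConsSMulTopEquivQuotSMulTopInner N r rs).symm
    rw [List.length_cons, show d + (rs.length + 1) = d + 1 + rs.length by omega]
    exact this

lemma EP.self : EP A A 0 := by
  refine ⟨fun i hi => ?_, ⟨?_⟩⟩
  · obtain ⟨j, rfl⟩ := Nat.exists_eq_succ_of_ne_zero hi
    exact Ext.subsingleton_of_projective _ _ j
  · exact (Ext.linearEquiv₀ (R := A)).trans ((ModuleCat.homLinearEquiv (S := A)).trans (LinearMap.ringLmapEquivSelf A A A))

lemma ext_regular (rs : List A) (q : A) (h : IsWeaklyRegular A (rs ++ [q])) (i : ℕ) :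
    IsSMulRegular (Ext.{u} (ModuleCat.of A (A ⧸ Ideal.ofList rs)) (ModuleCat.of A A) i) q := by
  rw [isWeaklyRegular_append_iff] at h
  obtain ⟨h1, h2⟩ := h
  have e : (Ideal.ofList rs • ⊤ : Submodule A A) = Ideal.ofList rs := by simp
  rw [isWeaklyRegular_singleton_iff, e] at h2
  have := (EP.self.list rs A 0 h1)
  rw [e] at this
  by_cases hi : i = 0 + rs.length
  · subst hi
    obtain ⟨φ⟩ := this.2
    exact (φ.isSMulRegular_congr q).2 h2
  · have := this.1 i hi
    intro a b _
    exact Subsingleton.elim _ _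
end ext
section bridge
variable {A : Type u} [CommRing A]

lemma homology_aux (S : ShortComplex (ModuleCat.{u} A)) (p : ℕ)
    (h : ∀ g : S.X₂, S.g g = 0 → (∃ y, S.f y = p • g) → ∃ y, S.f y = g) :
    IsSMulRegular S.homology (p : A) := by
  apply IsSMulRegular.of_right_eq_zero_of_smul
  intro z hz
  have hex : (ShortComplex.mk S.toCycles S.homologyπ (by simp)).Exact :=
    ShortComplex.exact_of_g_is_cokernel _ S.homologyIsCokernel
  rw [ShortComplex.moduleCat_exact_iff] at hex
  obtain ⟨c, rfl⟩ := (ModuleCat.epi_iff_surjective S.homologyπ).1 inferInstance z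
  have hi := (ModuleCat.mono_iff_injective S.iCycles).1 inferInstance
  obtain ⟨y, hy⟩ := hex ((p : A) • c) ((map_smul S.homologyπ.hom (p : A) c).trans hz)
  have hti : ∀ y, S.iCycles (S.toCycles y) = S.f y := fun y => by
    rw [← ConcreteCategory.comp_apply, S.toCycles_i]
  obtain ⟨y', hy'⟩ := h (S.iCycles c) (by
    rw [← ConcreteCategory.comp_apply]; simp) ⟨y, by
      have := congrArg S.iCycles hy
      rw [map_smul, Nat.cast_smul_eq_nsmul] at this
      exact (hti y).symm.trans this⟩
  have : S.toCycles y' = c := hi ((hti y').trans hy')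
  rw [← this, ← ConcreteCategory.comp_apply]
  simp

lemma extMk_nsmul {X Y : ModuleCat.{u} A} (P : ProjectiveResolution X) {n m : ℕ} (hm : n + 1 = m)
    (g : P.complex.X n ⟶ Y) (hg : P.complex.d m n ≫ g = 0) (p : ℕ) :
    P.extMk (p • g) m hm (by simp [hg]) = p • P.extMk g m hm hg := by
  induction p with
  | zero => simp
  | succ p ih =>
    simp only [succ_nsmul]
    rw [← ih, ProjectiveResolution.add_extMk]

lemma extMk_zero_inj {X Y : ModuleCat.{u} A} (P : ProjectiveResolution X)
    (g : P.complex.X 0 ⟶ Y) (m : ℕ) (hm : 0 + 1 = m) (hg : P.complex.d m 0 ≫ g = 0)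
    (h : P.extMk g m hm hg = 0) : g = 0 := by
  rw [← P.extEquivCohomologyClass.apply_eq_iff_eq,
    ProjectiveResolution.extEquivCohomologyClass_extMk,
    ProjectiveResolution.extEquivCohomologyClass_zero,
    CochainComplex.HomComplex.CohomologyClass.mk_eq_zero_iff,
    CochainComplex.HomComplex.Cocycle.toSingleMk_mem_coboundaries_iff _ _ _ _ _ 1 (by simp)] at h
  obtain ⟨y, hy⟩ := h
  have h0 : Limits.IsZero (P.cochainComplex.X 1) := P.cochainComplex.isZero_of_isStrictlyLE 0 1
  rw [h0.eq_of_src y 0, Limits.comp_zero] at hy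
  rw [← cancel_epi (P.cochainComplexXIso (-(0 : ℕ)) 0 rfl).hom, ← hy, Limits.comp_zero]

lemma ext_bridge (X Y : ModuleCat.{u} A) (n p : ℕ)
    (h : IsSMulRegular (Abelian.Ext.{u} X Y n) (p : A)) :
    IsSMulRegular (((Ext A (ModuleCat.{u} A) n).obj (Opposite.op X)).obj Y) (p : A) := by
  let P := projectiveResolution X
  refine ((P.isoExt (R := A) n Y).toLinearEquiv.isSMulRegular_congr (p : A)).2 ?_
  apply homology_aux
  intro (g : P.complex.X n ⟶ Y) hg
  replace hg : P.complex.d ((ComplexShape.up ℕ).next n) n ≫ g = 0 := hg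
  rintro ⟨(y : P.complex.X ((ComplexShape.up ℕ).prev n) ⟶ Y), hy⟩
  replace hy : P.complex.d n ((ComplexShape.up ℕ).prev n) ≫ y = p • g := hy
  suffices ∃ y, P.complex.d n ((ComplexShape.up ℕ).prev n) ≫ y = g from this
  have hn : n + 1 = (ComplexShape.up ℕ).next n := (CochainComplex.next ℕ n).symm
  have h1 : P.extMk (p • g) _ hn (by simp [hg]) = 0 → P.extMk g _ hn hg = 0 := by
    intro h2
    rw [extMk_nsmul P hn g hg, ← Nat.cast_smul_eq_nsmul A] at h2
    exact h.right_eq_zero_of_smul h2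
  cases n with
  | zero =>
    have hd : P.complex.d 0 ((ComplexShape.up ℕ).prev 0) = 0 := by
      apply P.complex.shape
      simp
    refine ⟨0, ?_⟩
    rw [hd, Limits.zero_comp] at hy
    rw [Limits.comp_zero]
    refine (extMk_zero_inj P g _ hn hg (h1 ?_)).symm
    simp [← hy]
  | succ n =>
    have hp : (ComplexShape.up ℕ).prev (n+1) + 1 = n + 1 := by
      rw [CochainComplex.prev_nat_succ]
    rw [ProjectiveResolution.extMk_eq_zero_iff _ _ _ _ _ _ hp,
      ProjectiveResolution.extMk_eq_zero_iff _ _ _ _ _ _ hp] at h1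
    exact h1 ⟨y, hy⟩

end bridge

section col
variable {A : Type} [CommRing A]
open Limits Opposite localCohomology

lemma colim_regular {D : Type} [SmallCategory D] [IsFiltered D] (F : D ⥤ ModuleCat.{0} A)
    (c : Cocone F) (hc : IsColimit c) (a : A) (h : ∀ t, IsSMulRegular (F.obj t) a) :
    IsSMulRegular c.pt a := by
  apply IsSMulRegular.of_right_eq_zero_of_smul
  intro z hz
  obtain ⟨j, y, rfl⟩ := Concrete.isColimit_exists_rep F hc z
  obtain ⟨k, f, g, hfg⟩ := Concrete.isColimit_exists_of_rep_eq F hc (a • y) (0 : F.obj j)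
    ((map_smul (c.ι.app j).hom a y).trans (hz.trans (map_zero (c.ι.app j).hom).symm))
  rw [map_zero] at hfg
  have h0 : F.map f y = 0 :=
    (h k).right_eq_zero_of_smul ((map_smul (F.map f).hom a y).symm.trans hfg)
  rw [← c.w f, ConcreteCategory.comp_apply, h0]
  exact map_zero (c.ι.app k).hom

lemma ofDiagram_regular {D : Type} [SmallCategory D] [IsFiltered Dᵒᵖ] (I : D ⥤ Ideal A) (i : ℕ)
    (M : ModuleCat.{0} A) (a : A)
    (h : ∀ t, IsSMulRegular (((Ext A (ModuleCat.{0} A) i).obj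
      (op (ModuleCat.of A (A ⧸ I.obj t)))).obj M) a) :
    IsSMulRegular ((ofDiagram.{0, 0} I i).obj M) a := by
  have := hasColimitDiagram.{0, 0} I i
  exact colim_regular (diagram I i ⋙ (evaluation _ _).obj M) _
    (isColimitOfPreserves ((evaluation _ _).obj M) (colimit.isColimit (diagram I i))) a
    (fun t => h (unop t))

noncomputable def powFun {k : ℕ} (f : Fin k → A) :
    ℕᵒᵖ ⥤ SelfLERadical (Ideal.span (Set.range f)) :=
  ObjectProperty.lift _
    { obj := fun t => Ideal.ofList ((List.ofFn f).map (· ^ unop t))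
      map := fun {s t} w => homOfLE (by
        refine Ideal.span_le.2 ?_
        intro x hx
        simp only [Set.mem_ofPred_eq, List.mem_map] at hx
        obtain ⟨y, hy, rfl⟩ := hx
        refine Ideal.mem_of_dvd _ (pow_dvd_pow y w.unop.le) (Ideal.subset_span ?_)
        exact List.mem_map.2 ⟨y, hy, rfl⟩) } (fun t => by
    refine Ideal.span_le.2 ?_
    rintro _ ⟨j, rfl⟩
    refine ⟨unop t, Ideal.subset_span ?_⟩
    exact List.mem_map.2 ⟨f j, by simp, rfl⟩)

instance powFun_initial [IsNoetherianRing A] {k : ℕ} (f : Fin k → A) :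
    Functor.Initial (powFun f) where
  out J' := by
    apply +allowSynthFailures zigzag_isConnected
    · obtain ⟨m, hm⟩ := Ideal.exists_pow_le_of_le_radical_of_fg J'.2
        (IsNoetherian.noetherian (R := A) (M := A) (Ideal.span (Set.range f)))
      have : Ideal.ofList ((List.ofFn f).map (· ^ m)) ≤ J'.1 := by
        refine Ideal.span_le.2 ?_
        intro x hx
        simp only [Set.mem_ofPred_eq, List.mem_map] at hx
        obtain ⟨y, hy, rfl⟩ := hx
        replace hy : y ∈ Set.range f := (List.mem_ofFn).1 hy
        exact hm (Ideal.pow_mem_pow (Ideal.subset_span hy) m)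
      exact ⟨CostructuredArrow.mk (⟨⟨⟨this⟩⟩⟩ : (powFun f).obj (op m) ⟶ J')⟩
    · intro j1 j2
      apply Relation.ReflTransGen.single
      rcases le_total (unop j1.left) (unop j2.left) with h | h
      · right; exact ⟨CostructuredArrow.homMk (homOfLE h).op rfl⟩
      · left; exact ⟨CostructuredArrow.homMk (homOfLE h).op rfl⟩

lemma lc_regular [IsNoetherianRing A] {k : ℕ} (f : Fin k → A) (i : ℕ) (a : A) (M : ModuleCat.{0} A)
    (h : ∀ t : ℕ, IsSMulRegular (((Ext A (ModuleCat.{0} A) i).obj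
      (op (ModuleCat.of A (A ⧸ Ideal.ofList ((List.ofFn f).map (· ^ t)))))).obj M) a) :
    IsSMulRegular ((localCohomology (Ideal.span (Set.range f)) i).obj M) a := by
  let e := (isoOfFinal.{0, 0, 0} (powFun f) (selfLERadicalDiagram.{0} _) i) ≪≫
    isoSelfLERadical (Ideal.span (Set.range f)) i
  refine ((e.app M).toLinearEquiv.isSMulRegular_congr a).1 ?_
  exact ofDiagram_regular (powFun f ⋙ selfLERadicalDiagram.{0} _) i M a (fun t => h (unop t))
end col

lemma main_lemma {A : Type} [CommRing A] [IsNoetherianRing A] (p k : ℕ) (f : Fin k → A)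
    (h : IsRegular A (List.ofFn f ++ [(p : A)])) (i : ℕ) :
    IsSMulRegular ((localCohomology (Ideal.span (Set.range f)) i).obj (ModuleCat.of A A))
      (p : A) := by
  refine lc_regular f i _ _ (fun t => ext_bridge _ _ _ _ ?_)
  exact ext_regular _ _ (wr_pow t _ _ A h.toIsWeaklyRegular) i
end LCAux

/-- Let `p` be a prime number and let `S` be either the polynomial ring
`ℤ[X₁,…,Xₙ]` or its localization at the prime ideal `(p, X₁,…,Xₙ)`. Let `f₁,…,f_k ∈ S` be
such that `f₁,…,f_k, p` is a regular sequence in `S`, and set `J = (f₁,…,f_k)S`. Then for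
every `i ≥ 0`, `p` is a nonzerodivisor on `H^i_J(S)`. The two cases are stated as the two
conjuncts. -/
theorem stmt_14 (n p : ℕ) (hp : p.Prime)
    (P : Ideal (Rn n)) (hP : P = Ideal.span (insert (p : Rn n) (Set.range MvPolynomial.X)))
    [P.IsPrime] :
    (∀ (k : ℕ) (f : Fin k → Rn n),
      RingTheory.Sequence.IsRegular (Rn n) (List.ofFn f ++ [(p : Rn n)]) →
      ∀ i : ℕ, IsSMulRegular
        ((localCohomology (Ideal.span (Set.range f)) i).obj (ModuleCat.of (Rn n) (Rn n)))
        (p : Rn n)) ∧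
      (∀ (k : ℕ) (f : Fin k → Localization.AtPrime P),
        RingTheory.Sequence.IsRegular (Localization.AtPrime P)
          (List.ofFn f ++ [(p : Localization.AtPrime P)]) →
        ∀ i : ℕ, IsSMulRegular
          ((localCohomology (Ideal.span (Set.range f)) i).obj
            (ModuleCat.of (Localization.AtPrime P) (Localization.AtPrime P)))
          (p : Localization.AtPrime P)) := by
  exact ⟨fun k f h i => LCAux.main_lemma p k f h i,
    haveI : IsNoetherianRing (Localization.AtPrime P) :=
      IsLocalization.isNoetherianRing P.primeCompl _ inferInstance
    fun k f h i => LCAux.main_lemma p k f h i⟩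
end

section
/- Let R = ℤ[X₁,…,Xₙ] be a polynomial ring over ℤ, let I be an ideal of R, and fix an integer i ≥ 0. Then there exists a prime number p such that p is a nonzerodivisor on H^i_I(R) and on H^{i+1}_I(R); moreover, for such p, p is a nonzerodivisor on H^i_{IR_m}(R_m) and on H^{i+1}_{IR_m}(R_m), where R_m is the localization of R at the maximal ideal m = (p, X₁,…,Xₙ). -/
open CategoryTheory

/-- The ideal `m = (p, X₁,…,Xₙ)` of `ℤ[X₁,…,Xₙ]`. -/
noncomputable def mIdeal (n p : ℕ) : Ideal (Rn n) :=
  Ideal.span (insert (p : Rn n) (Set.range MvPolynomial.X))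

/-- The localization `R_m` of `ℤ[X₁,…,Xₙ]` at the (maximal) ideal `m = (p, X₁,…,Xₙ)`,
given a proof that `m` is prime. -/
noncomputable abbrev RmLoc (n p : ℕ) (hm : (mIdeal n p).IsPrime) : Type :=
  Localization (@Ideal.primeCompl _ _ (mIdeal n p) hm)

section part1
open CategoryTheory Opposite
section basics
universe u
variable {A : Type u} [CommRing A]

noncomputable def linMap {P Q : ChainComplex (ModuleCat.{u} A) ℕ} (φ : P ⟶ Q) (Y : ModuleCat.{u} A) :
   Q.linearYonedaObj A Y ⟶ P.linearYonedaObj A Y where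
  f i := ((linearYoneda A (ModuleCat.{u} A)).obj Y).map (φ.f i).op
  comm' i j _ := by
    have := congrArg (fun g => ((linearYoneda A (ModuleCat.{u} A)).obj Y).map (Quiver.Hom.op g)) (φ.comm j i)
    simp only [op_comp, Functor.map_comp] at this
    exact this.symm

lemma iso_aux {C : Type*} [Category C] {X Y Z W : C} (α : X ≅ Y) (β : Z ≅ W) (m : X ⟶ Z)
    (y : Y ⟶ W) (h : m ≫ β.hom = α.hom ≫ y) : α.inv ≫ m = y ≫ β.inv := by
  rw [Iso.inv_comp_eq, ← Category.assoc, Iso.eq_comp_inv, h]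

lemma comp_aux {C : Type*} [Category C] {X Y Z W U V : C} (a : X ⟶ Y) (iP : Y ⟶ Z) (iQ : X ⟶ W)
    (m : W ⟶ Z) (oP : Z ⟶ U) (oQ : W ⟶ V) (h : V ⟶ U) (e1 : a ≫ iP = iQ ≫ m)
    (e2 : m ≫ oP = oQ ≫ h) : a ≫ (iP ≫ oP) = (iQ ≫ oQ) ≫ h := by
  rw [← Category.assoc, e1, Category.assoc, e2, Category.assoc]

lemma isoExt_naturality {X X' : ModuleCat.{u} A} (f : X ⟶ X') (P : ProjectiveResolution X)
    (Q : ProjectiveResolution X') (φ : P.complex ⟶ Q.complex)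
    (comm : φ.f 0 ≫ Q.π.f 0 = P.π.f 0 ≫ f) (Y : ModuleCat.{u} A) (n : ℕ) :
    ((Ext A (ModuleCat.{u} A) n).map f.op).app Y ≫ (P.isoExt (R := A) n Y).hom =
      (Q.isoExt (R := A) n Y).hom ≫ HomologicalComplex.homologyMap (linMap φ Y) n := by
  have h1 := P.isoLeftDerivedObj_inv_naturality f Q φ comm ((linearYoneda A (ModuleCat.{u} A)).obj Y).rightOp n
  have h2 := HomologicalComplex.homologyOp_hom_naturality (linMap φ Y) n
  replace h2 := iso_aux _ _ _ _ h2
  have h1' := congrArg Quiver.Hom.unop h1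
  have h2' := congrArg Quiver.Hom.unop h2
  simp only [unop_comp] at h1' h2'
  let a := ((Ext A (ModuleCat.{u} A) n).map f.op).app Y
  let iP := (P.isoLeftDerivedObj ((linearYoneda A (ModuleCat.{u} A)).obj Y).rightOp n).inv.unop
  let iQ := (Q.isoLeftDerivedObj ((linearYoneda A (ModuleCat.{u} A)).obj Y).rightOp n).inv.unop
  let m := (((((linearYoneda A (ModuleCat.{u} A)).obj Y).rightOp.mapHomologicalComplex (ComplexShape.down ℕ) ⋙
              HomologicalComplex.homologyFunctor (ModuleCat A)ᵒᵖ (ComplexShape.down ℕ) n).map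
          φ)).unop
  let oP := ((P.complex.linearYonedaObj A Y).homologyOp n).inv.unop
  let oQ := ((Q.complex.linearYonedaObj A Y).homologyOp n).inv.unop
  have e1 : a ≫ iP = iQ ≫ m := h1'
  have e2 : m ≫ oP = oQ ≫ HomologicalComplex.homologyMap (linMap φ Y) n := h2'
  exact comp_aux a iP iQ m oP oQ _ e1 e2

/-- `x` is the class of the cocycle `z`. -/
def IsCl (K : CochainComplex (ModuleCat.{u} A) ℕ) (n : ℕ) (z : K.X n) (x : K.homology n) : Prop :=
  ∃ c : K.cycles n, K.iCycles n c = z ∧ K.homologyπ n c = x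

lemma IsCl.exists_of_cocycle (K : CochainComplex (ModuleCat.{u} A) ℕ) (n : ℕ) (z : K.X n)
    (hz : K.d n (n+1) z = 0) : ∃ x, IsCl K n z x := by
  let g : ModuleCat.of A A ⟶ K.X n := ModuleCat.ofHom (LinearMap.toSpanSingleton A _ z)
  have hg : g ≫ K.d n (n+1) = 0 := by
    ext
    simp [g, hz]
  refine ⟨K.homologyπ n (K.liftCycles g (n+1) (by simp) hg (1:A)), K.liftCycles g (n+1) (by simp) hg (1:A), ?_, rfl⟩
  rw [← ConcreteCategory.comp_apply, HomologicalComplex.liftCycles_i]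
  simp [g]

lemma IsCl.exists_rep (K : CochainComplex (ModuleCat.{u} A) ℕ) (n : ℕ) (x : K.homology n) :
    ∃ z, K.d n (n+1) z = 0 ∧ IsCl K n z x := by
  obtain ⟨c, hc⟩ := (ModuleCat.epi_iff_surjective (K.homologyπ n)).1 inferInstance x
  refine ⟨K.iCycles n c, ?_, c, rfl, hc⟩
  rw [← ConcreteCategory.comp_apply, HomologicalComplex.iCycles_d]
  rfl

lemma IsCl.smul {K : CochainComplex (ModuleCat.{u} A) ℕ} {n : ℕ} {z : K.X n} {x : K.homology n}
    (h : IsCl K n z x) (a : A) : IsCl K n (a • z) (a • x) := by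
  obtain ⟨c, rfl, rfl⟩ := h
  exact ⟨a • c, by simp, by simp⟩

lemma IsCl.map {K L : CochainComplex (ModuleCat.{u} A) ℕ} {n : ℕ} {z : K.X n} {x : K.homology n}
    (h : IsCl K n z x) (f : K ⟶ L) : IsCl L n (f.f n z) (HomologicalComplex.homologyMap f n x) := by
  obtain ⟨c, rfl, rfl⟩ := h
  refine ⟨HomologicalComplex.cyclesMap f n c, ?_, ?_⟩
  · rw [← ConcreteCategory.comp_apply, HomologicalComplex.cyclesMap_i]; rfl
  · rw [← ConcreteCategory.comp_apply, ← HomologicalComplex.homologyπ_naturality]; rfl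

lemma IsCl.eq_zero_iff_zero {K : CochainComplex (ModuleCat.{u} A) ℕ} {z : K.X 0} {x : K.homology 0}
    (h : IsCl K 0 z x) : x = 0 ↔ z = 0 := by
  obtain ⟨c, rfl, rfl⟩ := h
  have i1 := (ModuleCat.mono_iff_injective (K.iCycles 0)).1 inferInstance
  have : IsIso (K.homologyπ 0) := K.isIso_homologyπ _ 0 rfl (by simp)
  have i2 := (ModuleCat.mono_iff_injective (K.homologyπ 0)).1 inferInstance
  rw [map_eq_zero_iff _ i1, map_eq_zero_iff _ i2]

lemma IsCl.eq_zero_iff_succ {K : CochainComplex (ModuleCat.{u} A) ℕ} {n : ℕ} {z : K.X (n+1)}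
    {x : K.homology (n+1)}
    (h : IsCl K (n+1) z x) : x = 0 ↔ ∃ y, K.d n (n+1) y = z := by
  obtain ⟨c, rfl, rfl⟩ := h
  have i1 := (ModuleCat.mono_iff_injective (K.iCycles (n+1))).1 inferInstance
  have ex := (ShortComplex.exact_of_g_is_cokernel (ShortComplex.mk (K.toCycles n (n+1)) (K.homologyπ (n+1)) (by simp))
    (K.homologyIsCokernel n (n+1) (by simp)))
  rw [ShortComplex.moduleCat_exact_iff] at ex
  constructor
  · intro hx
    obtain ⟨y, hy⟩ := ex c hx
    refine ⟨y, ?_⟩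
    rw [← hy, ← K.toCycles_i n (n+1)]; rfl
  · rintro ⟨y, hy⟩
    rw [← K.toCycles_i n (n+1)] at hy
    have := i1 hy
    rw [← this]
    exact ConcreteCategory.congr_hom (K.toCycles_comp_homologyπ n (n+1)) y
end basics
end part1

section part2
open CategoryTheory Opposite
/-- A system (indexed by `ℕᵒᵖ`) of complexes of projective modules. -/
structure PSys (A : Type) [CommRing A] where
  P : ℕ → ℕ → ModuleCat.{0} A
  d : ∀ t n, P t (n + 1) →ₗ[A] P t n
  T : ∀ {t s : ℕ} (n : ℕ), t ≤ s → (P s n →ₗ[A] P t n)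
  proj : ∀ t n, Module.Projective A (P t n)
  dd : ∀ t n, d t n ∘ₗ d t (n + 1) = 0
  Td : ∀ {t s : ℕ} (n : ℕ) (h : t ≤ s), T n h ∘ₗ d s n = d t n ∘ₗ T (n + 1) h
  T_refl : ∀ t n, T n (le_refl t) = LinearMap.id
  T_trans : ∀ {t s r : ℕ} (n : ℕ) (h : t ≤ s) (h' : s ≤ r), T n h ∘ₗ T n h' = T n (h.trans h')

namespace PSys
variable {A : Type} [CommRing A] (S : PSys A) {M : Type} [AddCommGroup M] [Module A M]

def Coc {t n : ℕ} (ψ : S.P t n →ₗ[A] M) : Prop := ψ ∘ₗ S.d t n = 0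

def Cob {t : ℕ} : ∀ {n : ℕ} (_ : S.P t n →ₗ[A] M), Prop
  | 0, ψ => ψ = 0
  | n + 1, ψ => ∃ χ : S.P t n →ₗ[A] M, ψ = χ ∘ₗ S.d t n

def Dead {t n : ℕ} (ψ : S.P t n →ₗ[A] M) : Prop := ∃ (s : ℕ) (h : t ≤ s), S.Cob (ψ ∘ₗ S.T n h)

variable (M) in
def NZD (a : A) (n : ℕ) : Prop :=
  ∀ (t : ℕ) (ψ : S.P t n →ₗ[A] M), S.Coc ψ → S.Dead (a • ψ) → S.Dead ψ
end PSys

section ext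
variable {A : Type} [CommRing A] (I : Ideal A)

noncomputable abbrev qF : ℕᵒᵖ ⥤ ModuleCat.{0} A :=
  localCohomology.ringModIdeals (localCohomology.idealPowersDiagram I)

noncomputable abbrev qRes (t : ℕ) : ProjectiveResolution ((qF I).obj (op t)) := ProjectiveResolution.of _

noncomputable def resF : ℕᵒᵖ ⥤ ChainComplex (ModuleCat.{0} A) ℕ :=
  Functor.ofOpSequence (X := fun t => (qRes I t).complex)
    (fun t => ProjectiveResolution.lift ((qF I).map (homOfLE (Nat.le_add_right t 1)).op) (qRes I (t+1)) (qRes I t))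

noncomputable def resπ : resF I ⟶ qF I ⋙ ChainComplex.single₀ (ModuleCat.{0} A) :=
  NatTrans.ofOpSequence (F := resF I) (fun t => (qRes I t).π) (fun t => by
    have h : (resF I).map (homOfLE (Nat.le_add_right t 1)).op =
      ProjectiveResolution.lift ((qF I).map (homOfLE (Nat.le_add_right t 1)).op) (qRes I (t+1)) (qRes I t) :=
      Functor.ofOpSequence_map_homOfLE_succ _ t
    rw [h]
    exact ProjectiveResolution.lift_commutes _ _ _)

lemma resF_comm {t s : ℕ} (h : t ≤ s) :
    ((resF I).map (homOfLE h).op).f 0 ≫ (qRes I t).π.f 0 = (qRes I s).π.f 0 ≫ (qF I).map (homOfLE h).op := by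
  have := (resπ I).naturality (homOfLE h).op
  have := congrArg (fun g => HomologicalComplex.Hom.f g 0) this
  exact this

noncomputable def extSys : PSys A where
  P t n := ((resF I).obj (op t)).X n
  d t n := (((resF I).obj (op t)).d (n+1) n).hom
  T n h := (((resF I).map (homOfLE h).op).f n).hom
  proj t n := (IsProjective.iff_projective _).2 ((qRes I t).projective n)
  dd t n := by
    rw [← ModuleCat.hom_comp, HomologicalComplex.d_comp_d]; rfl
  Td n h := by
    rw [← ModuleCat.hom_comp, ← ModuleCat.hom_comp]
    exact congrArg ModuleCat.Hom.hom (((resF I).map (homOfLE h).op).comm (n+1) n).symm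
  T_refl t n := by
    have : (homOfLE (le_refl t)).op = 𝟙 (op t) := rfl
    rw [this, CategoryTheory.Functor.map_id]; rfl
  T_trans n h h' := by
    rw [← ModuleCat.hom_comp]
    have : (homOfLE (h.trans h')).op = (homOfLE h').op ≫ (homOfLE h).op := rfl
    rw [this, CategoryTheory.Functor.map_comp]; rfl

lemma isSMulRegular_iff_ext (a : A) (n : ℕ) (M : ModuleCat.{0} A) :
    IsSMulRegular ((localCohomology I n).obj M) a ↔ (extSys I).NZD M a n := by
  let F := localCohomology.diagram (localCohomology.idealPowersDiagram I) n ⋙ (evaluation _ _).obj M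
  let c : Limits.Cocone F := ((evaluation _ _).obj M).mapCocone
    (Limits.colimit.cocone (localCohomology.diagram (localCohomology.idealPowersDiagram I) n))
  have hc : Limits.IsColimit c := Limits.isColimitOfPreserves _ (Limits.colimit.isColimit _)
  let iso (t : ℕ) := (qRes I t).isoExt (R := A) n M
  -- class at level t
  let cl (t : ℕ) (ψ : (extSys I).P t n →ₗ[A] M) (y : F.obj (op (op t))) : Prop :=
    IsCl ((qRes I t).complex.linearYonedaObj A M) n (ModuleCat.ofHom ψ) ((iso t).hom y)
  have clex (t) (ψ : (extSys I).P t n →ₗ[A] M) (h : (extSys I).Coc ψ) : ∃ y, cl t ψ y := by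
    obtain ⟨x, hx⟩ := IsCl.exists_of_cocycle ((qRes I t).complex.linearYonedaObj A M) n (ModuleCat.ofHom ψ)
      (by
        apply ModuleCat.hom_ext
        exact h)
    refine ⟨(iso t).inv x, ?_⟩
    simpa [cl] using hx
  have clrep (t) (y : F.obj (op (op t))) : ∃ ψ : (extSys I).P t n →ₗ[A] M, (extSys I).Coc ψ ∧ cl t ψ y := by
    obtain ⟨ψ, h1, h2⟩ := IsCl.exists_rep ((qRes I t).complex.linearYonedaObj A M) n ((iso t).hom y)
    exact ⟨ModuleCat.Hom.hom ψ, congrArg ModuleCat.Hom.hom h1, h2⟩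
  have cl0 (t) (ψ : (extSys I).P t n →ₗ[A] M) (y) (h : cl t ψ y) : y = 0 ↔ (extSys I).Cob ψ := by
    have : y = 0 ↔ (iso t).hom y = 0 :=
      (map_eq_zero_iff ((iso t).hom.hom) ((ModuleCat.mono_iff_injective (iso t).hom).1 inferInstance)).symm
    rw [this]
    cases n with
    | zero =>
      rw [h.eq_zero_iff_zero]
      exact ⟨fun h => congrArg ModuleCat.Hom.hom h, fun h => ModuleCat.hom_ext h⟩
    | succ n =>
      rw [h.eq_zero_iff_succ]
      exact ⟨fun ⟨y, h⟩ => ⟨ModuleCat.Hom.hom y, (congrArg ModuleCat.Hom.hom h).symm⟩,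
        fun ⟨y, h⟩ => ⟨ModuleCat.ofHom y, ModuleCat.hom_ext h.symm⟩⟩
  have clmap {t s} (h : t ≤ s) (ψ : (extSys I).P t n →ₗ[A] M) (y) (hy : cl t ψ y) :
      cl s (ψ ∘ₗ (extSys I).T n h) (F.map (homOfLE h).op.op y) := by
    have nat := isoExt_naturality _ _ _ _ (resF_comm I h) M n
    have := hy.map (linMap ((resF I).map (homOfLE h).op) M)
    have e : (iso s).hom (F.map (homOfLE h).op.op y) = HomologicalComplex.homologyMap (linMap ((resF I).map (homOfLE h).op) M) n ((iso t).hom y) :=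
      ConcreteCategory.congr_hom nat y
    show IsCl _ _ _ _
    rw [e]
    exact this
  have clsmul (t) (ψ : (extSys I).P t n →ₗ[A] M) (y) (h : cl t ψ y) : cl t (a • ψ) (a • y) := by
    have := h.smul a
    have e : (iso t).hom (a • y) = a • (iso t).hom y := map_smul (iso t).hom.hom a y
    show IsCl _ _ _ _
    rw [e]
    exact this
  have dead (t) (ψ : (extSys I).P t n →ₗ[A] M) (y) (h : cl t ψ y) :
      c.ι.app (op (op t)) y = 0 ↔ (extSys I).Dead ψ := by
    have h0 : c.ι.app (op (op t)) y = 0 ↔ c.ι.app (op (op t)) y = c.ι.app (op (op t)) (0 : F.obj (op (op t))) := by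
      rw [map_zero]
    rw [h0, Limits.Concrete.isColimit_rep_eq_iff_exists F hc]
    constructor
    · rintro ⟨k, f, g, e⟩
      have hle : t ≤ k.unop.unop := leOfHom f.unop.unop
      refine ⟨k.unop.unop, hle, ?_⟩
      rw [← cl0 _ _ _ (clmap hle ψ y h)]
      rw [map_zero] at e
      exact e
    · rintro ⟨s, hle, hcob⟩
      rw [← cl0 _ _ _ (clmap hle ψ y h)] at hcob
      refine ⟨op (op s), (homOfLE hle).op.op, (homOfLE hle).op.op, ?_⟩
      rw [map_zero, hcob]
  have key : IsSMulRegular c.pt a ↔ (extSys I).NZD M a n := by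
    rw [isSMulRegular_iff_right_eq_zero_of_smul]
    constructor
    · intro H t ψ hψ hd
      obtain ⟨y, hy⟩ := clex t ψ hψ
      rw [← dead _ _ _ hy]
      apply H
      rw [← map_smul]
      rwa [dead _ _ _ (clsmul _ _ _ hy)]
    · intro H x hx
      obtain ⟨t, y, rfl⟩ := Limits.Concrete.isColimit_exists_rep F hc x
      obtain ⟨ψ, h1, h2⟩ := clrep t.unop.unop y
      have := dead _ _ _ h2
      refine this.2 (H _ _ h1 ?_)
      rw [← dead _ _ _ (clsmul _ _ _ h2), map_smul]
      exact hx
  exact key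
end ext
end part2

section part3
open CategoryTheory Opposite
/-- The `I`-power torsion elements. -/
def Gam {A : Type} [CommRing A] (I : Ideal A) (M : Type) [AddCommGroup M] [Module A M] (m : M) : Prop :=
  ∃ N : ℕ, ∀ a ∈ I ^ N, a • m = 0

lemma Gam.smul {A : Type} [CommRing A] {I : Ideal A} {M : Type} [AddCommGroup M] [Module A M] {m : M}
    (h : Gam I M m) (a : A) : Gam I M (a • m) := by
  obtain ⟨N, h⟩ := h
  exact ⟨N, fun b hb => by rw [smul_comm, h b hb, smul_zero]⟩

lemma inj_ext {A : Type} [CommRing A] {E X Y : Type} [AddCommGroup E] [Module A E]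
    [AddCommGroup X] [Module A X] [AddCommGroup Y] [Module A Y] (hE : Module.Injective A E)
    (g : X →ₗ[A] Y) (l : X →ₗ[A] E) (h : ∀ x, g x = 0 → l x = 0) : ∃ k : Y →ₗ[A] E, k ∘ₗ g = l := by
  have hle : LinearMap.ker g ≤ LinearMap.ker l := fun x hx => h x hx
  obtain ⟨k, hk⟩ := hE.out ((LinearMap.ker g).liftQ g le_rfl)
    (LinearMap.ker_eq_bot.1 (Submodule.ker_liftQ_eq_bot _ _ _ le_rfl)) ((LinearMap.ker g).liftQ l hle)
  refine ⟨k, LinearMap.ext fun x => ?_⟩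
  have := hk ((LinearMap.ker g).mkQ x)
  simpa using this

namespace PSys
variable {A : Type} [CommRing A] (S : PSys A)

structure Good (I : Ideal A) where
  b : ∀ (E : Type) [AddCommGroup E] [Module A E], Module.Injective A E →
    ∀ (t n : ℕ) (ψ : S.P t (n + 1) →ₗ[A] E), S.Coc ψ → S.Dead ψ
  e : ∀ t, S.P t 0
  ce : ∀ (M : Type) [AddCommGroup M] [Module A M] {t s : ℕ} (h : t ≤ s) (ψ : S.P t 0 →ₗ[A] M),
    S.Coc ψ → ψ (S.T 0 h (e s)) = ψ (e t)
  cg : ∀ (M : Type) [AddCommGroup M] [Module A M] {t : ℕ} (ψ : S.P t 0 →ₗ[A] M),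
    S.Coc ψ → Gam I M (ψ (e t))
  cs : ∀ (M : Type) [AddCommGroup M] [Module A M] (m : M), Gam I M m →
    ∃ (t : ℕ) (ψ : S.P t 0 →ₗ[A] M), S.Coc ψ ∧ ψ (e t) = m
  cd : ∀ (M : Type) [AddCommGroup M] [Module A M] {t : ℕ} (ψ : S.P t 0 →ₗ[A] M),
    S.Coc ψ → ψ (e t) = 0 → S.Dead ψ

variable {S} {M : Type} [AddCommGroup M] [Module A M] {E : Type} [AddCommGroup E] [Module A E]
  {C : Type} [AddCommGroup C] [Module A C]

lemma Td' {t s : ℕ} {n : ℕ} (h : t ≤ s) (φ : S.P t n →ₗ[A] M) :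
    (φ ∘ₗ S.T n h) ∘ₗ S.d s n = (φ ∘ₗ S.d t n) ∘ₗ S.T (n + 1) h := by
  rw [LinearMap.comp_assoc, S.Td, LinearMap.comp_assoc]

lemma TT' {t s r : ℕ} {n : ℕ} (h : t ≤ s) (h' : s ≤ r) (φ : S.P t n →ₗ[A] M) :
    (φ ∘ₗ S.T n h) ∘ₗ S.T n h' = φ ∘ₗ S.T n (h.trans h') := by
  rw [LinearMap.comp_assoc, S.T_trans]

lemma Coc.T {t s : ℕ} {n : ℕ} (h : t ≤ s) {φ : S.P t n →ₗ[A] M} (hφ : S.Coc φ) :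
    S.Coc (φ ∘ₗ S.T n h) := by
  unfold Coc at *
  rw [Td', hφ, LinearMap.zero_comp]

lemma Coc.smul {t : ℕ} {n : ℕ} {φ : S.P t n →ₗ[A] M} (hφ : S.Coc φ) (a : A) :
    S.Coc (a • φ) := by
  unfold Coc at *
  rw [LinearMap.smul_comp, hφ, smul_zero]

lemma Coc.sub {t : ℕ} {n : ℕ} {φ ψ : S.P t n →ₗ[A] M} (hφ : S.Coc φ) (hψ : S.Coc ψ) :
    S.Coc (φ - ψ) := by
  unfold Coc at *
  rw [LinearMap.sub_comp, hφ, hψ, sub_zero]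

lemma Coc.left {t : ℕ} {n : ℕ} {φ : S.P t n →ₗ[A] M} (hφ : S.Coc φ) (f : M →ₗ[A] E) :
    S.Coc (f ∘ₗ φ) := by
  unfold Coc at *
  rw [LinearMap.comp_assoc, hφ, LinearMap.comp_zero]

lemma Cob.T {t s : ℕ} : ∀ {n : ℕ} (h : t ≤ s) {φ : S.P t n →ₗ[A] M}, S.Cob φ → S.Cob (φ ∘ₗ S.T n h)
  | 0, h, φ, hφ => by
    change φ = 0 at hφ
    subst hφ
    exact LinearMap.zero_comp _
  | n + 1, h, φ, ⟨χ, hχ⟩ => ⟨χ ∘ₗ S.T n h, by rw [Td', hχ]⟩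

lemma dead_T_iff {t s : ℕ} {n : ℕ} (h : t ≤ s) (φ : S.P t n →ₗ[A] M) :
    S.Dead (φ ∘ₗ S.T n h) ↔ S.Dead φ := by
  constructor
  · rintro ⟨r, hr, hc⟩
    rw [TT'] at hc
    exact ⟨r, _, hc⟩
  · rintro ⟨r, hr, hc⟩
    refine ⟨max s r, le_max_left _ _, ?_⟩
    have := hc.T (le_max_right s r)
    rw [TT'] at this ⊢
    exact this

structure SES (ι : M →ₗ[A] E) (π : E →ₗ[A] C) : Prop where
  inj : Function.Injective ι
  surj : Function.Surjective π
  ex : Function.Exact ι π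
  hE : Module.Injective A E

lemma SES.lift {ι : M →ₗ[A] E} {π : E →ₗ[A] C} (h : SES ι π) {P : Type} [AddCommGroup P] [Module A P]
    (f : P →ₗ[A] E) (hf : π ∘ₗ f = 0) : ∃ g : P →ₗ[A] M, ι ∘ₗ g = f := by
  let e := LinearEquiv.ofInjective ι h.inj
  have hr : ∀ x, f x ∈ LinearMap.range ι := fun x => (h.ex (f x)).1 (LinearMap.congr_fun hf x)
  refine ⟨e.symm.toLinearMap ∘ₗ f.codRestrict _ hr, LinearMap.ext fun x => ?_⟩
  have := LinearEquiv.apply_symm_apply e (f.codRestrict _ hr x)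
  exact congrArg Subtype.val this

lemma SES.comp {ι : M →ₗ[A] E} {π : E →ₗ[A] C} (h : SES ι π) : π ∘ₗ ι = 0 :=
  h.ex.linearMap_comp_eq_zero

lemma SES.canc {ι : M →ₗ[A] E} {π : E →ₗ[A] C} (h : SES ι π) {P : Type} [AddCommGroup P] [Module A P]
    {f g : P →ₗ[A] M} (hf : ι ∘ₗ f = ι ∘ₗ g) : f = g :=
  LinearMap.ext fun x => h.inj (LinearMap.congr_fun hf x)

variable (S) in
def Rel (ι : M →ₗ[A] E) (π : E →ₗ[A] C) {t n : ℕ} (ψ : S.P t (n + 1) →ₗ[A] M) (φ : S.P t n →ₗ[A] C) : Prop :=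
  ∃ φ' : S.P t n →ₗ[A] E, ι ∘ₗ ψ = φ' ∘ₗ S.d t n ∧ φ = π ∘ₗ φ'

section rel
variable {ι : M →ₗ[A] E} {π : E →ₗ[A] C} (h : SES ι π)
include h

lemma Rel.coc_left {t n : ℕ} {ψ : S.P t (n + 1) →ₗ[A] M} {φ : S.P t n →ₗ[A] C} (r : S.Rel ι π ψ φ) : S.Coc ψ := by
  obtain ⟨φ', h1, h2⟩ := r
  apply h.canc
  rw [← LinearMap.comp_assoc, h1, LinearMap.comp_assoc, S.dd, LinearMap.comp_zero, LinearMap.comp_zero]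

lemma Rel.coc_right {t n : ℕ} {ψ : S.P t (n + 1) →ₗ[A] M} {φ : S.P t n →ₗ[A] C} (r : S.Rel ι π ψ φ) : S.Coc φ := by
  obtain ⟨φ', h1, h2⟩ := r
  unfold Coc
  rw [h2, LinearMap.comp_assoc, ← h1, ← LinearMap.comp_assoc, h.comp, LinearMap.zero_comp]

omit h in
lemma Rel.smul {t n : ℕ} {ψ : S.P t (n + 1) →ₗ[A] M} {φ : S.P t n →ₗ[A] C} (r : S.Rel ι π ψ φ) (a : A) :
    S.Rel ι π (a • ψ) (a • φ) := by
  obtain ⟨φ', h1, h2⟩ := r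
  exact ⟨a • φ', by rw [LinearMap.comp_smul, h1, LinearMap.smul_comp], by rw [LinearMap.comp_smul, h2]⟩

lemma exists_rel_right {I : Ideal A} (G : S.Good I) {t n : ℕ} (ψ : S.P t (n + 1) →ₗ[A] M) (hψ : S.Coc ψ) :
    ∃ (s : ℕ) (hs : t ≤ s) (φ : S.P s n →ₗ[A] C), S.Rel ι π (ψ ∘ₗ S.T _ hs) φ := by
  obtain ⟨s, hs, χ, hχ⟩ := G.b E h.hE t n (ι ∘ₗ ψ) (hψ.left ι)
  exact ⟨s, hs, π ∘ₗ χ, χ, hχ, rfl⟩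

lemma exists_rel_left {t n : ℕ} (φ : S.P t n →ₗ[A] C) (hφ : S.Coc φ) :
    ∃ (ψ : S.P t (n + 1) →ₗ[A] M), S.Rel ι π ψ φ := by
  have := S.proj t n
  obtain ⟨φ', h'⟩ := Module.projective_lifting_property π φ h.surj
  obtain ⟨ψ, hψ⟩ := h.lift (φ' ∘ₗ S.d t n) (by rw [← LinearMap.comp_assoc, h']; exact hφ)
  exact ⟨ψ, φ', hψ, h'.symm⟩

lemma Rel.dead_iff {I : Ideal A} (G : S.Good I) {t n : ℕ} {ψ : S.P t (n + 2) →ₗ[A] M} {φ : S.P t (n + 1) →ₗ[A] C}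
    (r : S.Rel ι π ψ φ) : S.Dead ψ ↔ S.Dead φ := by
  obtain ⟨φ', h1, h2⟩ := r
  constructor
  · rintro ⟨s, hs, χ, hχ⟩
    have hc : S.Coc (φ' ∘ₗ S.T _ hs - ι ∘ₗ χ) := by
      unfold Coc
      rw [LinearMap.sub_comp, Td', ← h1, LinearMap.comp_assoc, hχ, LinearMap.comp_assoc, sub_self]
    obtain ⟨r, hr, χ', hχ'⟩ := G.b E h.hE _ _ _ hc
    refine ⟨r, hs.trans hr, π ∘ₗ χ', ?_⟩
    rw [LinearMap.comp_assoc, ← hχ', LinearMap.sub_comp, LinearMap.comp_sub, LinearMap.comp_assoc _ χ ι,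
      ← LinearMap.comp_assoc _ ι π, h.comp, LinearMap.zero_comp, sub_zero, h2, TT', LinearMap.comp_assoc]
  · rintro ⟨s, hs, χ, hχ⟩
    have := S.proj s n
    obtain ⟨χ', h'⟩ := Module.projective_lifting_property π χ h.surj
    obtain ⟨χ'', hχ''⟩ := h.lift (φ' ∘ₗ S.T _ hs - χ' ∘ₗ S.d s n) (by
      rw [LinearMap.comp_sub, ← LinearMap.comp_assoc _ χ' π, h', ← hχ, h2, LinearMap.comp_assoc, sub_self])
    refine ⟨s, hs, χ'', h.canc ?_⟩
    rw [← LinearMap.comp_assoc _ χ'' ι, hχ'', LinearMap.sub_comp, Td', LinearMap.comp_assoc _ _ χ', S.dd,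
      LinearMap.comp_zero, sub_zero, ← h1, LinearMap.comp_assoc]

lemma Rel.dead_iff_zero {I : Ideal A} (G : S.Good I) {t : ℕ} {ψ : S.P t 1 →ₗ[A] M} {φ : S.P t 0 →ₗ[A] C}
    (r : S.Rel ι π ψ φ) : S.Dead ψ ↔ ∃ g, Gam I E g ∧ π g = φ (G.e t) := by
  have hφ := r.coc_right h
  obtain ⟨φ', h1, h2⟩ := r
  constructor
  · rintro ⟨s, hs, χ, hχ⟩
    have hc : S.Coc (φ' ∘ₗ S.T _ hs - ι ∘ₗ χ) := by
      unfold Coc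
      rw [LinearMap.sub_comp, Td', ← h1, LinearMap.comp_assoc, hχ, LinearMap.comp_assoc, sub_self]
    refine ⟨_, G.cg E _ hc, ?_⟩
    rw [← G.ce _ hs _ hφ, h2]
    have := LinearMap.congr_fun h.comp (χ (G.e s))
    simp at this
    simp [this]
  · rintro ⟨g, hg, hgφ⟩
    obtain ⟨u, ψ0, c0, rfl⟩ := G.cs _ _ hg
    have hs := le_max_left t u
    have hu := le_max_right t u
    have cc : S.Coc (φ ∘ₗ S.T _ hs - (π ∘ₗ ψ0) ∘ₗ S.T _ hu) := (hφ.T hs).sub ((c0.left π).T hu)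
    obtain ⟨r, hr, hdead⟩ := G.cd _ _ cc (by
      have a1 := G.ce _ hs _ hφ
      have a2 := G.ce _ hu _ (c0.left π)
      rw [LinearMap.sub_apply, LinearMap.comp_apply, LinearMap.comp_apply, a1, a2, sub_eq_zero, ← hgφ]; rfl)
    change _ = _ at hdead
    rw [LinearMap.sub_comp, TT', TT', h2, LinearMap.comp_assoc, LinearMap.comp_assoc, ← LinearMap.comp_sub] at hdead
    obtain ⟨χ, hχ⟩ := h.lift _ hdead
    refine ⟨r, hs.trans hr, χ, h.canc ?_⟩
    have c0' : ψ0 ∘ₗ S.d u 0 = 0 := c0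
    rw [← LinearMap.comp_assoc _ χ ι, hχ, LinearMap.sub_comp, Td', Td', c0',
      LinearMap.zero_comp, sub_zero, ← h1, LinearMap.comp_assoc]

lemma nzd_step {I : Ideal A} (G : S.Good I) (a : A) (n : ℕ) : S.NZD M a (n + 2) ↔ S.NZD C a (n + 1) := by
  constructor
  · intro H t φ hφ hd
    obtain ⟨ψ, r⟩ := exists_rel_left h φ hφ
    rw [← r.dead_iff h G]
    apply H _ _ (r.coc_left h)
    rwa [(r.smul a).dead_iff h G]
  · intro H t ψ hψ hd
    obtain ⟨s, hs, φ, r⟩ := exists_rel_right h G ψ hψ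
    rw [← dead_T_iff hs, r.dead_iff h G]
    apply H _ _ (r.coc_right h)
    rw [← (r.smul a).dead_iff h G, ← LinearMap.smul_comp, dead_T_iff]
    exact hd

lemma nzd_one {I : Ideal A} (G : S.Good I) (a : A) : S.NZD M a 1 ↔
    ∀ c, Gam I C c → (∃ g, Gam I E g ∧ π g = a • c) → (∃ g, Gam I E g ∧ π g = c) := by
  constructor
  · intro H c hc hd
    obtain ⟨t, φ, hφ, rfl⟩ := G.cs _ _ hc
    obtain ⟨ψ, r⟩ := exists_rel_left h φ hφ
    rw [← r.dead_iff_zero h G]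
    apply H _ _ (r.coc_left h)
    rw [(r.smul a).dead_iff_zero h G]
    exact hd
  · intro H t ψ hψ hd
    obtain ⟨s, hs, φ, r⟩ := exists_rel_right h G ψ hψ
    rw [← dead_T_iff hs, r.dead_iff_zero h G]
    apply H _ (G.cg _ _ (r.coc_right h))
    rw [← dead_T_iff hs, LinearMap.smul_comp, (r.smul a).dead_iff_zero h G] at hd
    exact hd
end rel

lemma nzd_zero {I : Ideal A} (G : S.Good I) (a : A) : S.NZD M a 0 ↔
    ∀ c, Gam I M c → a • c = 0 → c = 0 := by
  constructor
  · intro H c hc hd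
    obtain ⟨t, φ, hφ, rfl⟩ := G.cs _ _ hc
    obtain ⟨s, hs, hh⟩ := H t φ hφ (G.cd _ _ (hφ.smul a) hd)
    rw [← G.ce _ hs _ hφ]
    exact LinearMap.congr_fun hh (G.e s)
  · intro H t φ hφ hd
    apply G.cd _ _ hφ
    apply H _ (G.cg _ _ hφ)
    obtain ⟨s, hs, hh⟩ := hd
    have := LinearMap.congr_fun hh (G.e s)
    simp at this
    rwa [← G.ce _ hs _ hφ]

lemma exists_ses (M : Type) [AddCommGroup M] [Module A M] : ∃ (E C : ModuleCat.{0} A) (ι : M →ₗ[A] E) (π : E →ₗ[A] C),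
    SES ι π := by
  obtain ⟨J, inj, f, mf⟩ := (EnoughInjectives.presentation (ModuleCat.of A M)).some
  refine ⟨J, ModuleCat.of A (J ⧸ LinearMap.range f.hom), f.hom, (LinearMap.range f.hom).mkQ, ?_, ?_, ?_, ?_⟩
  · exact (ModuleCat.mono_iff_injective f).1 inferInstance
  · exact Submodule.mkQ_surjective _
  · exact LinearMap.exact_map_mkQ_range _
  · have : CategoryTheory.Injective (ModuleCat.of A J) := inj
    exact Module.injective_module_of_injective_object A J

theorem nzd_compare {I : Ideal A} {S S' : PSys A} (G : S.Good I) (G' : S'.Good I) (a : A) (n : ℕ) :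
    ∀ (M : Type) [AddCommGroup M] [Module A M], S.NZD M a n ↔ S'.NZD M a n := by
  rcases n with _ | n
  · intro M _ _
    rw [nzd_zero G, nzd_zero G']
  · induction n with
    | zero =>
      intro M _ _
      obtain ⟨E, C, ι, π, h⟩ := exists_ses (A := A) M
      rw [nzd_one h G, nzd_one h G']
    | succ n ih =>
      intro M _ _
      obtain ⟨E, C, ι, π, h⟩ := exists_ses (A := A) M
      rw [nzd_step h G, nzd_step h G']
      exact ih C

end PSys
end part3

section part4
open CategoryTheory Opposite
section ext
variable {A : Type} [CommRing A] (I : Ideal A)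

noncomputable def epsE (t : ℕ) : (extSys I).P t 0 →ₗ[A] (A ⧸ I ^ t) :=
  ModuleCat.Hom.hom (show (qRes I t).complex.X 0 ⟶ ModuleCat.of A (A ⧸ I ^ t) from (qRes I t).π.f 0)

lemma epsE_surj (t : ℕ) : Function.Surjective (epsE I t) :=
  (ModuleCat.epi_iff_surjective ((qRes I t).π.f 0)).1 inferInstance

lemma epsE_T {t s : ℕ} (h : t ≤ s) (x : (extSys I).P s 0) (a : A) (hx : epsE I s x = Submodule.Quotient.mk a) :
    epsE I t ((extSys I).T 0 h x) = Submodule.Quotient.mk a := by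
  have := congrArg (fun f => ModuleCat.Hom.hom f x) (resF_comm I h)
  refine Eq.trans this ?_
  have h2 : Submodule.mapQ (I ^ s) (I ^ t) LinearMap.id (Ideal.pow_le_pow_right h) (epsE I s x) = Submodule.Quotient.mk a := by
    rw [hx]; rfl
  exact h2

lemma epsE_d (t : ℕ) : epsE I t ∘ₗ (extSys I).d t 0 = 0 := by
  have := (qRes I t).complex_d_comp_π_f_zero
  exact congrArg ModuleCat.Hom.hom this

lemma epsE_exact (t : ℕ) (x : (extSys I).P t 0) (hx : epsE I t x = 0) : ∃ y, (extSys I).d t 0 y = x :=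
  (ShortComplex.moduleCat_exact_iff _).1 (qRes I t).exact₀ x hx

lemma extSys_exact (t n : ℕ) (x : (extSys I).P t (n + 1)) (hx : (extSys I).d t n x = 0) :
    ∃ y, (extSys I).d t (n + 1) y = x :=
  (ShortComplex.moduleCat_exact_iff _).1 ((qRes I t).exact_succ n) x hx

lemma extSys_coc0 {M : Type} [AddCommGroup M] [Module A M] {t : ℕ} {ψ : (extSys I).P t 0 →ₗ[A] M}
    (h : (extSys I).Coc ψ) (x : (extSys I).P t 0) (hx : epsE I t x = 0) : ψ x = 0 := by
  obtain ⟨y, rfl⟩ := epsE_exact I t x hx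
  exact LinearMap.congr_fun h y

noncomputable def extGood : (extSys I).Good I where
  b E _ _ hE t n ψ hψ := by
    obtain ⟨k, hk⟩ := inj_ext hE ((extSys I).d t n) ψ (fun x hx => by
      obtain ⟨y, rfl⟩ := extSys_exact I t n x hx
      exact LinearMap.congr_fun hψ y)
    refine ⟨t, le_rfl, k, ?_⟩
    rw [(extSys I).T_refl, hk]; rfl
  e t := (epsE_surj I t (Submodule.Quotient.mk 1)).choose
  ce M _ _ t s h ψ hψ := by
    rw [← sub_eq_zero, ← map_sub]
    apply extSys_coc0 I hψ
    rw [map_sub, epsE_T I h _ 1 (epsE_surj I s (Submodule.Quotient.mk 1)).choose_spec,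
      (epsE_surj I t (Submodule.Quotient.mk 1)).choose_spec, sub_self]
  cg M _ _ t ψ hψ := by
    refine ⟨t, fun a ha => ?_⟩
    rw [← map_smul]
    apply extSys_coc0 I hψ
    rw [map_smul, (epsE_surj I t (Submodule.Quotient.mk 1)).choose_spec, ← Submodule.Quotient.mk_smul,
      Submodule.Quotient.mk_eq_zero]
    simpa using ha
  cs M _ _ m hm := by
    obtain ⟨N, hN⟩ := hm
    let l : (A ⧸ I ^ N) →ₗ[A] M := (I ^ N).liftQ (LinearMap.toSpanSingleton A M m) (fun a ha => by
      simpa using hN a ha)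
    refine ⟨N, l ∘ₗ epsE I N, ?_, ?_⟩
    · unfold PSys.Coc
      rw [LinearMap.comp_assoc, epsE_d, LinearMap.comp_zero]
    · rw [LinearMap.comp_apply, (epsE_surj I N (Submodule.Quotient.mk 1)).choose_spec]
      exact one_smul A m
  cd M _ _ t ψ hψ h0 := by
    refine ⟨t, le_rfl, ?_⟩
    rw [(extSys I).T_refl]
    refine LinearMap.ext fun x => ?_
    obtain ⟨a, ha⟩ := Submodule.Quotient.mk_surjective _ (epsE I t x)
    have : ψ (x - a • (epsE_surj I t (Submodule.Quotient.mk 1)).choose) = 0 := by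
      apply extSys_coc0 I hψ
      rw [map_sub, map_smul, (epsE_surj I t (Submodule.Quotient.mk 1)).choose_spec, ← ha,
        ← Submodule.Quotient.mk_smul, ← Submodule.Quotient.mk_sub]
      simp
    rw [map_sub, map_smul, h0, smul_zero, sub_zero] at this
    exact this
end ext
end part4

section part5
open CategoryTheory Opposite
section kos
variable {ι A M : Type} [CommRing A] [AddCommGroup M] [Module A M]

/-- The differential of the (non-alternating) Koszul cochain complex. -/
def kd (g : ι → A) : ∀ {n : ℕ} (_ : (Fin n → ι) → M), (Fin (n + 1) → ι) → M
  | 0, z => fun v => g (v 0) • z (Fin.tail v)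
  | _ + 1, z => fun v => g (v 0) • z (Fin.tail v) - kd g (fun w => z (Fin.cons (v 0) w)) (Fin.tail v)

/-- The transition maps. -/
def kt (f : ι → A) (k : ℕ) {n : ℕ} (z : (Fin n → ι) → M) : (Fin n → ι) → M :=
  fun v => (∏ j, f (v j) ^ k) • z v

lemma kd_cons_zero (g : ι → A) (z : (Fin 0 → ι) → M) (i : ι) (v : Fin 0 → ι) :
    kd g z (Fin.cons i v) = g i • z v := rfl

lemma kd_cons_succ (g : ι → A) {n : ℕ} (z : (Fin (n + 1) → ι) → M) (i : ι) (v : Fin (n + 1) → ι) :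
    kd g z (Fin.cons i v) = g i • z v - kd g (fun w => z (Fin.cons i w)) v := rfl

/-- General naturality of the differential. -/
lemma kd_nat {B A' M' : Type} [CommMonoid B] [CommRing A'] [AddCommGroup M'] [Module A' M']
    (g : ι → A) (g' : ι → A') (h : ι → B) (Ψ : B → M →+ M')
    (H : ∀ b i m, Ψ (b * h i) (g i • m) = g' i • Ψ b m) {n : ℕ} :
    ∀ (b : B) (z : (Fin n → ι) → M) (v : Fin (n + 1) → ι),
    Ψ (b * ∏ j, h (v j)) (kd g z v) = kd g' (fun w => Ψ (b * ∏ j, h (w j)) (z w)) v := by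
  induction n with
  | zero =>
    intro b z v
    refine Fin.consCases (fun i w => ?_) v
    rw [kd_cons_zero, kd_cons_zero]
    simp [H]
  | succ n ih =>
    intro b z v
    refine Fin.consCases (fun i w => ?_) v
    rw [kd_cons_succ, kd_cons_succ, map_sub]
    congr 1
    · rw [Fin.prod_univ_succ]
      simp only [Fin.cons_zero, Fin.cons_succ]
      rw [mul_comm (h i), ← mul_assoc, H]
    · rw [Fin.prod_univ_succ]
      simp only [Fin.cons_zero, Fin.cons_succ]
      rw [← mul_assoc, ih]
      congr 1
      funext u
      rw [Fin.prod_univ_succ]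
      simp only [Fin.cons_zero, Fin.cons_succ]
      rw [← mul_assoc]

/-- Naturality of the differential, untwisted. -/
lemma kd_nat' {A' M' : Type} [CommRing A'] [AddCommGroup M'] [Module A' M']
    (g : ι → A) (g' : ι → A') (Ψ : M →+ M')
    (H : ∀ i m, Ψ (g i • m) = g' i • Ψ m) {n : ℕ} (z : (Fin n → ι) → M) (v : Fin (n + 1) → ι) :
    Ψ (kd g z v) = kd g' (fun w => Ψ (z w)) v := by
  have := kd_nat (B := Unit) g g' (fun _ => ()) (fun _ => Ψ) (fun _ i m => H i m) () z v
  exact this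

lemma kd_lin {M' : Type} [AddCommGroup M'] [Module A M'] (g : ι → A) (Ψ : M →ₗ[A] M') {n : ℕ}
    (z : (Fin n → ι) → M) (v : Fin (n + 1) → ι) : Ψ (kd g z v) = kd g (fun w => Ψ (z w)) v :=
  kd_nat' g g Ψ.toAddMonoidHom (fun i m => by simp) z v

lemma kd_smul (g : ι → A) (a : A) {n : ℕ} (z : (Fin n → ι) → M) : kd g (a • z) = a • kd g z := by
  funext v
  exact (kd_lin g (LinearMap.lsmul A M a) z v).symm

lemma kd_add (g : ι → A) {n : ℕ} (z z' : (Fin n → ι) → M) : kd g (z + z') = kd g z + kd g z' := by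
  induction n with
  | zero =>
    funext v
    refine Fin.consCases (fun i w => ?_) v
    rw [Pi.add_apply, kd_cons_zero, kd_cons_zero, kd_cons_zero, Pi.add_apply, smul_add]
  | succ n ih =>
    funext v
    refine Fin.consCases (fun i w => ?_) v
    have := congrFun (ih (fun w => z (Fin.cons i w)) (fun w => z' (Fin.cons i w))) w
    rw [Pi.add_apply, kd_cons_succ, kd_cons_succ, kd_cons_succ, Pi.add_apply, smul_add]
    rw [Pi.add_apply] at this
    have e : (fun w => (z + z') (Fin.cons i w)) = (fun w => z (Fin.cons i w)) + (fun w => z' (Fin.cons i w)) := rfl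
    rw [e, this]
    abel

/-- The differential as a linear map. -/
def kdL (g : ι → A) (n : ℕ) : ((Fin n → ι) → M) →ₗ[A] ((Fin (n + 1) → ι) → M) where
  toFun := kd g
  map_add' := kd_add g
  map_smul' a z := kd_smul g a z

lemma kd_zero (g : ι → A) {n : ℕ} : kd g (0 : (Fin n → ι) → M) = 0 := (kdL (M := M) g n).map_zero
lemma kd_sub (g : ι → A) {n : ℕ} (z z' : (Fin n → ι) → M) : kd g (z - z') = kd g z - kd g z' :=
  (kdL (M := M) g n).map_sub z z'
lemma kd_neg (g : ι → A) {n : ℕ} (z : (Fin n → ι) → M) : kd g (-z) = -kd g z :=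
  (kdL (M := M) g n).map_neg z
lemma kd_sum (g : ι → A) {n : ℕ} {κ : Type} (s : Finset κ) (z : κ → (Fin n → ι) → M) :
    kd g (∑ a ∈ s, z a) = ∑ a ∈ s, kd g (z a) :=
  map_sum (kdL (M := M) g n) z s

lemma kd_kd (g : ι → A) {n : ℕ} (z : (Fin n → ι) → M) : kd g (kd g z) = 0 := by
  induction n with
  | zero =>
    funext v
    refine Fin.consCases (fun i w => ?_) v
    rw [kd_cons_succ]
    have : (fun w => kd g z (Fin.cons i w)) = g i • z := rfl
    rw [this, kd_smul]
    simp
  | succ n ih =>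
    funext v
    refine Fin.consCases (fun i w => ?_) v
    rw [kd_cons_succ]
    have : (fun w => kd g z (Fin.cons i w)) = g i • z - kd g (fun w => z (Fin.cons i w)) := rfl
    rw [this, kd_sub, kd_smul, ih]
    simp

lemma kd_kt (f : ι → A) (t k : ℕ) {n : ℕ} (z : (Fin n → ι) → M) :
    kd (f ^ (t + k)) (kt f k z) = kt f k (kd (f ^ t) z) := by
  funext v
  have := kd_nat (B := A) (M' := M) (f ^ t) (f ^ (t + k)) (fun i => f i ^ k)
    (fun b => (LinearMap.lsmul A M b).toAddMonoidHom) (fun b i m => by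
      simp only [LinearMap.toAddMonoidHom_coe, LinearMap.lsmul_apply, Pi.pow_apply, smul_smul]
      congr 1
      ring) 1 z v
  simp only [one_mul] at this
  exact this.symm

lemma kt_kt (f : ι → A) (k l : ℕ) {n : ℕ} (z : (Fin n → ι) → M) : kt f k (kt f l z) = kt f (l + k) z := by
  funext v
  simp only [kt, smul_smul, ← Finset.prod_mul_distrib, ← pow_add, add_comm]

@[simp] lemma kt_zero (f : ι → A) {n : ℕ} (z : (Fin n → ι) → M) : kt f 0 z = z := by
  funext v; simp [kt]

lemma kt_smul (f : ι → A) (k : ℕ) (a : A) {n : ℕ} (z : (Fin n → ι) → M) : kt f k (a • z) = a • kt f k z := by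
  funext v; simp only [kt, Pi.smul_apply]; rw [smul_comm]

lemma kt_add (f : ι → A) (k : ℕ) {n : ℕ} (z z' : (Fin n → ι) → M) : kt f k (z + z') = kt f k z + kt f k z' := by
  funext v; simp [kt]

lemma kt_sub (f : ι → A) (k : ℕ) {n : ℕ} (z z' : (Fin n → ι) → M) : kt f k (z - z') = kt f k z - kt f k z' := by
  funext v; simp [kt, smul_sub]

lemma kt_map_zero (f : ι → A) (k : ℕ) {n : ℕ} : kt f k (0 : (Fin n → ι) → M) = 0 := by
  funext v; simp [kt]

lemma kt_sum (f : ι → A) (k : ℕ) {n : ℕ} {κ : Type} (s : Finset κ) (z : κ → (Fin n → ι) → M) :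
    kt f k (∑ a ∈ s, z a) = ∑ a ∈ s, kt f k (z a) := by
  funext v; simp [kt, Finset.smul_sum]

/-- Coboundaries. -/
def KCob (g : ι → A) : ∀ {n : ℕ} (_ : (Fin n → ι) → M), Prop
  | 0, z => z = 0
  | _ + 1, z => ∃ w, z = kd g w

def KDead (f : ι → A) (t : ℕ) {n : ℕ} (z : (Fin n → ι) → M) : Prop := ∃ k, KCob (f ^ (t + k)) (kt f k z)

variable (M) in
def KNZD (f : ι → A) (a : A) (n : ℕ) : Prop :=
  ∀ (t : ℕ) (z : (Fin n → ι) → M), kd (f ^ t) z = 0 → KDead f t (a • z) → KDead f t z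

end kos

section sys
variable {ι A : Type} [CommRing A]

noncomputable def kosSys (f : ι → A) : PSys A where
  P _ n := ModuleCat.of A ((Fin n → ι) →₀ A)
  d t n := Finsupp.linearCombination A (kd (f ^ t) (fun w : Fin n → ι => Finsupp.single w (1 : A)))
  T {t s} n _ := Finsupp.linearCombination A (kt f (s - t) (fun w : Fin n → ι => Finsupp.single w (1 : A)))
  proj t n := inferInstanceAs (Module.Projective A ((Fin n → ι) →₀ A))
  dd t n := by
    refine Finsupp.lhom_ext' fun v => LinearMap.ext_ring ?_
    simp only [LinearMap.comp_apply, Finsupp.lsingle_apply, Finsupp.linearCombination_single, one_smul]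
    rw [kd_lin]
    simp only [Finsupp.linearCombination_single, one_smul]
    rw [kd_kd]; rfl
  Td {t s} n h := by
    refine Finsupp.lhom_ext' fun v => LinearMap.ext_ring ?_
    simp only [LinearMap.comp_apply, Finsupp.lsingle_apply, Finsupp.linearCombination_single, one_smul]
    rw [kd_lin]
    simp only [Finsupp.linearCombination_single, one_smul]
    have := kd_kt f t (s - t) (fun w : Fin n → ι => Finsupp.single w (1 : A))
    rw [Nat.add_sub_cancel' h] at this
    rw [this]
    simp [kt]
  T_refl t n := by
    refine Finsupp.lhom_ext' fun v => LinearMap.ext_ring ?_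
    simp
  T_trans {t s r} n h h' := by
    refine Finsupp.lhom_ext' fun v => LinearMap.ext_ring ?_
    have e : r - t = (s - t) + (r - s) := by omega
    simp only [LinearMap.comp_apply, Finsupp.lsingle_apply, Finsupp.linearCombination_single, one_smul]
    rw [e, ← kt_kt]
    simp [kt]

variable {M : Type} [AddCommGroup M] [Module A M] (f : ι → A)

/-- cochain to linear map -/
noncomputable def kLin {n : ℕ} (t : ℕ) (z : (Fin n → ι) → M) : (kosSys f).P t n →ₗ[A] M :=
  Finsupp.linearCombination A z

lemma kLin_bij {n : ℕ} (t : ℕ) (ψ : (kosSys f).P t n →ₗ[A] M) : ∃ z, ψ = kLin f t z := by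
  have pure (ψ : ((Fin n → ι) →₀ A) →ₗ[A] M) :
      ψ = Finsupp.linearCombination A (fun v => ψ (Finsupp.single v (1 : A))) := by
    refine Finsupp.lhom_ext' fun v => LinearMap.ext_ring ?_
    simp
  exact ⟨fun v => ψ (Finsupp.single v (1 : A)), pure ψ⟩

lemma kLin_inj {n : ℕ} (t : ℕ) (z z' : (Fin n → ι) → M) : kLin f t z = kLin f t z' ↔ z = z' := by
  refine ⟨fun h => funext fun v => ?_, fun h => h ▸ rfl⟩
  have h' : Finsupp.linearCombination A z = Finsupp.linearCombination A z' := h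
  have := LinearMap.congr_fun h' (Finsupp.single v (1 : A))
  simpa using this

lemma kLin_d {n : ℕ} (t : ℕ) (z : (Fin n → ι) → M) : kLin f t z ∘ₗ (kosSys f).d t n = kLin f t (kd (f ^ t) z) := by
  have pure : Finsupp.linearCombination A z ∘ₗ
      Finsupp.linearCombination A (kd (f ^ t) (fun w : Fin n → ι => Finsupp.single w (1 : A))) =
      Finsupp.linearCombination A (kd (f ^ t) z) := by
    refine Finsupp.lhom_ext' fun v => LinearMap.ext_ring ?_
    simp only [LinearMap.comp_apply, Finsupp.lsingle_apply, Finsupp.linearCombination_single, one_smul]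
    rw [kd_lin]
    simp only [Finsupp.linearCombination_single, one_smul]
  exact pure

lemma kLin_T {n : ℕ} {t s : ℕ} (h : t ≤ s) (z : (Fin n → ι) → M) :
    kLin f t z ∘ₗ (kosSys f).T n h = kLin f s (kt f (s - t) z) := by
  have pure : Finsupp.linearCombination A z ∘ₗ
      Finsupp.linearCombination A (kt f (s - t) (fun w : Fin n → ι => Finsupp.single w (1 : A))) =
      Finsupp.linearCombination A (kt f (s - t) z) := by
    refine Finsupp.lhom_ext' fun v => LinearMap.ext_ring ?_
    simp [kt]
  exact pure

lemma kLin_smul {n : ℕ} (t : ℕ) (a : A) (z : (Fin n → ι) → M) : a • kLin f t z = kLin f t (a • z) := by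
  have pure : a • Finsupp.linearCombination A z = Finsupp.linearCombination A (a • z) := by
    refine Finsupp.lhom_ext' fun v => LinearMap.ext_ring ?_
    simp
  exact pure

lemma kLin_zero {n : ℕ} (t : ℕ) : kLin f t (0 : (Fin n → ι) → M) = 0 := by
  have pure : Finsupp.linearCombination A (0 : (Fin n → ι) → M) = 0 := by
    refine Finsupp.lhom_ext' fun v => LinearMap.ext_ring ?_
    simp
  exact pure

lemma kLin_coc {n : ℕ} (t : ℕ) (z : (Fin n → ι) → M) : (kosSys f).Coc (kLin f t z) ↔ kd (f ^ t) z = 0 := by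
  unfold PSys.Coc
  rw [kLin_d, ← kLin_zero, kLin_inj]

lemma kLin_cob : ∀ {n : ℕ} (t : ℕ) (z : (Fin n → ι) → M), (kosSys f).Cob (kLin f t z) ↔ KCob (f ^ t) z
  | 0, t, z => by
    change kLin f t z = 0 ↔ z = 0
    rw [← kLin_zero, kLin_inj]
  | n + 1, t, z => by
    constructor
    · rintro ⟨χ, h⟩
      obtain ⟨w, rfl⟩ := kLin_bij f t χ
      rw [kLin_d, kLin_inj] at h
      exact ⟨w, h⟩
    · rintro ⟨w, rfl⟩
      exact ⟨kLin f t w, (kLin_d f t w).symm⟩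

lemma kLin_dead {n : ℕ} (t : ℕ) (z : (Fin n → ι) → M) : (kosSys f).Dead (kLin f t z) ↔ KDead f t z := by
  constructor
  · rintro ⟨s, h, hc⟩
    rw [kLin_T, kLin_cob] at hc
    refine ⟨s - t, ?_⟩
    rwa [Nat.add_sub_cancel' h]
  · rintro ⟨k, hc⟩
    refine ⟨t + k, Nat.le_add_right _ _, ?_⟩
    rwa [kLin_T, kLin_cob, Nat.add_sub_cancel_left]

lemma kosSys_nzd (a : A) (n : ℕ) : (kosSys f).NZD M a n ↔ KNZD M f a n := by
  constructor
  · intro H t z hz hd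
    rw [← kLin_dead]
    apply H _ _ ((kLin_coc f t z).2 hz)
    rwa [kLin_smul, kLin_dead]
  · intro H t ψ hψ hd
    obtain ⟨z, rfl⟩ := kLin_bij f t ψ
    rw [kLin_dead]
    apply H _ _ ((kLin_coc f t z).1 hψ)
    rwa [kLin_smul, kLin_dead] at hd
end sys
end part5

section part6
open CategoryTheory Opposite
section good
variable {ι A : Type} [CommRing A] [IsNoetherianRing A]

lemma exists_pow_ann {E : Type} [AddCommGroup E] [Module A E] (s : Set A) (e : E)
    (h : ∀ x ∈ s, ∃ N : ℕ, x ^ N • e = 0) : ∃ m : ℕ, ∀ a ∈ (Ideal.span s) ^ m, a • e = 0 := by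
  let K : Ideal A := LinearMap.ker (LinearMap.toSpanSingleton A E e)
  have hle : Ideal.span s ≤ K.radical := by
    rw [Ideal.span_le]
    intro x hx
    obtain ⟨N, hN⟩ := h x hx
    exact ⟨N, by simpa [K] using hN⟩
  obtain ⟨m, hm⟩ := Ideal.exists_pow_le_of_le_radical_of_fg hle (IsNoetherian.noetherian _)
  exact ⟨m, fun a ha => by simpa [K] using hm ha⟩

/-- elements torsion for all `f j`, `j ∈ s` -/
def tG (f : ι → A) (s : Finset ι) (E : Type) [AddCommGroup E] [Module A E] : Submodule A E where
  carrier := {e | ∀ j ∈ s, ∃ N : ℕ, f j ^ N • e = 0}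
  add_mem' := by
    intro a b ha hb j hj
    obtain ⟨N, hN⟩ := ha j hj
    obtain ⟨N', hN'⟩ := hb j hj
    refine ⟨N + N', ?_⟩
    rw [smul_add, pow_add, mul_smul, smul_comm, hN, smul_zero, mul_smul, hN', smul_zero, add_zero]
  zero_mem' := fun j _ => ⟨0, smul_zero _⟩
  smul_mem' := by
    intro c a ha j hj
    obtain ⟨N, hN⟩ := ha j hj
    exact ⟨N, by rw [smul_comm, hN, smul_zero]⟩

lemma tG_div {E : Type} [AddCommGroup E] [Module A E] (hE : Module.Injective A E) (f : ι → A) (s : Finset ι)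
    (j : ι) (t : ℕ) (e : E) (he : e ∈ tG f s E) :
    ∃ y ∈ tG f s E, ∃ N : ℕ, f j ^ N • (e - f j ^ t • y) = 0 := by
  set x := f j
  let J := Ideal.span (f '' s)
  obtain ⟨m, hm⟩ := exists_pow_ann (f '' s) e (by rintro _ ⟨j, hj, rfl⟩; exact he j hj)
  obtain ⟨N, hN⟩ := (monotone_stabilizes_iff_noetherian (R := A) (M := A)).2 inferInstance
    ⟨fun n => LinearMap.ker (LinearMap.mulRight A (x ^ n)), by
      intro a b hab y hy
      simp only [LinearMap.mem_ker, LinearMap.mulRight_apply] at hy ⊢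
      rw [← Nat.add_sub_cancel' hab, pow_add, ← mul_assoc, hy, zero_mul]⟩
  obtain ⟨k, hk⟩ := Ideal.exists_pow_inf_eq_pow_smul J (Ideal.span {x ^ (N + t)} : Submodule A A)
  let g : A →ₗ[A] A ⧸ J ^ (k + m) := (J ^ (k + m)).mkQ ∘ₗ LinearMap.mulRight A (x ^ (N + t))
  obtain ⟨h, hh⟩ := inj_ext hE g (LinearMap.toSpanSingleton A E (x ^ N • e)) (by
    intro a ha
    have ha' : a * x ^ (N + t) ∈ J ^ (k + m) := (Submodule.Quotient.mk_eq_zero _).1 ha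
    have h1 : a * x ^ (N + t) ∈ J ^ (k + m) • (⊤ : Submodule A A) ⊓ Ideal.span {x ^ (N + t)} :=
      ⟨by simpa using ha', Ideal.mem_span_singleton'.2 ⟨a, rfl⟩⟩
    rw [hk _ (Nat.le_add_right k m), Nat.add_sub_cancel_left] at h1
    have h2 : a * x ^ (N + t) ∈ J ^ m * Ideal.span {x ^ (N + t)} :=
      Submodule.smul_mono le_rfl inf_le_right h1
    obtain ⟨b, hb, hb'⟩ := Ideal.mem_mul_span_singleton.1 h2
    have h3 : a - b ∈ LinearMap.ker (LinearMap.mulRight A (x ^ (N + t))) := by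
      simp [sub_mul, hb']
    have h4 : a - b ∈ LinearMap.ker (LinearMap.mulRight A (x ^ N)) := by
      have := hN (N + t) (Nat.le_add_right _ _)
      change LinearMap.ker (LinearMap.mulRight A (x ^ N)) = LinearMap.ker (LinearMap.mulRight A (x ^ (N + t))) at this
      rw [this]; exact h3
    have h5 : a * x ^ N = b * x ^ N := by
      simpa [sub_mul, sub_eq_zero] using h4
    rw [LinearMap.toSpanSingleton_apply, smul_smul, h5, mul_comm, mul_smul, hm b hb, smul_zero])
  refine ⟨h (Submodule.Quotient.mk 1), ?_, N, ?_⟩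
  · intro i hi
    refine ⟨k + m, ?_⟩
    rw [← map_smul, ← Submodule.Quotient.mk_smul, (Submodule.Quotient.mk_eq_zero _).2, map_zero]
    rw [smul_eq_mul, mul_one]
    exact Ideal.pow_mem_pow (Ideal.subset_span (Set.mem_image_of_mem f hi)) _
  · have := LinearMap.congr_fun hh 1
    have e1 : g 1 = x ^ (N + t) • (Submodule.Quotient.mk 1) := by
      rw [← Submodule.Quotient.mk_smul]; simp [g]
    rw [LinearMap.comp_apply, e1, map_smul, LinearMap.toSpanSingleton_apply, one_smul] at this
    rw [smul_sub, smul_smul, ← pow_add, this, sub_self]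

omit [IsNoetherianRing A] in
lemma kd_mem {E : Type} [AddCommGroup E] [Module A E] (N : Submodule A E) (g : ι → A) {n : ℕ}
    (z : (Fin n → ι) → E) (h : ∀ v, z v ∈ N) (v) : kd g z v ∈ N := by
  have := kd_lin g N.subtype (fun v => (⟨z v, h v⟩ : N)) v
  have e : (fun w => N.subtype (⟨z w, h w⟩ : N)) = z := rfl
  rw [e] at this
  rw [← this]
  exact Subtype.property _

lemma kos_dead {E : Type} [AddCommGroup E] [Module A E] (hE : Module.Injective A E) [Fintype ι] (f : ι → A)
    (t n : ℕ) (z : (Fin (n + 1) → ι) → E) (hz : kd (f ^ t) z = 0) : KDead f t z := by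
  classical
  have key : ∀ s : Finset ι, ∃ w : (Fin n → ι) → E, ∀ v, (z - kd (f ^ t) w) v ∈ tG f s E := by
    intro s
    induction s using Finset.induction_on with
    | empty => exact ⟨0, fun v j hj => by simp at hj⟩
    | insert j s _ ih =>
      obtain ⟨w0, hw0⟩ := ih
      set z' := z - kd (f ^ t) w0 with hz'
      have hc : kd (f ^ t) z' = 0 := by rw [hz', kd_sub, hz, kd_kd, sub_zero]
      choose w hw1 N hN using fun v => tG_div hE f s j t _ (hw0 (Fin.cons j v))
      refine ⟨w0 + w, fun v => ?_⟩
      rw [kd_add, ← sub_sub, ← hz']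
      have m1 : (z' - kd (f ^ t) w) v ∈ tG f s E := sub_mem (hw0 v) (kd_mem _ _ _ hw1 v)
      have m2 : ∃ N : ℕ, f j ^ N • (z' - kd (f ^ t) w) v = 0 := by
        have e1 : (f ^ t) j • (z' - kd (f ^ t) w) v =
            kd (f ^ t) ((fun u => z' (Fin.cons j u)) - (f ^ t) j • w) v := by
          have := congrFun hc (Fin.cons j v)
          rw [kd_cons_succ, Pi.zero_apply, sub_eq_zero] at this
          rw [kd_sub, kd_smul, Pi.sub_apply, Pi.sub_apply, smul_sub, this]
          rfl
        have e2 := kd_mem (tG f {j} E) (f ^ t) ((fun u => z' (Fin.cons j u)) - (f ^ t) j • w) (fun u => by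
          intro i hi
          rw [Finset.mem_singleton] at hi
          subst hi
          exact ⟨N u, hN u⟩) v
        rw [← e1] at e2
        obtain ⟨N', hN'⟩ := e2 j (by simp)
        refine ⟨N' + t, ?_⟩
        rw [pow_add, mul_smul]
        exact hN'
      intro i hi
      rw [Finset.mem_insert] at hi
      rcases hi with rfl | hi
      · exact m2
      · exact m1 i hi
  obtain ⟨w, hw⟩ := key Finset.univ
  choose N hN using fun v : Fin (n + 1) → ι => hw v (v 0) (Finset.mem_univ _)
  have h0 : kt f (∑ v, N v) (z - kd (f ^ t) w) = 0 := by
    funext v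
    have hv : N v ≤ ∑ v, N v := Finset.single_le_sum (fun _ _ => Nat.zero_le _) (Finset.mem_univ v)
    rw [kt, Fin.prod_univ_succ, mul_comm, mul_smul, ← Nat.sub_add_cancel hv, pow_add, mul_smul, hN, smul_zero,
      smul_zero]; rfl
  refine ⟨∑ v, N v, kt f (∑ v, N v) w, ?_⟩
  rw [kt_sub, sub_eq_zero] at h0
  rw [h0, kd_kt]

noncomputable def kosGood [Fintype ι] (f : ι → A) : (kosSys f).Good (Ideal.span (Set.range f)) where
  b E _ _ hE t n ψ hψ := by
    obtain ⟨z, rfl⟩ := kLin_bij f t ψ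
    rw [kLin_dead]
    exact kos_dead hE f t n z ((kLin_coc f t z).1 hψ)
  e t := Finsupp.single Fin.elim0 (1 : A)
  ce M _ _ t s h ψ hψ := by
    obtain ⟨z, rfl⟩ := kLin_bij f t ψ
    have := LinearMap.congr_fun (kLin_T f h z) (Finsupp.single Fin.elim0 (1 : A))
    refine Eq.trans this ?_
    have p : Finsupp.linearCombination A (kt f (s - t) z) (Finsupp.single Fin.elim0 (1 : A)) =
        Finsupp.linearCombination A z (Finsupp.single Fin.elim0 (1 : A)) := by
      simp [kt]
    exact p
  cg M _ _ t ψ hψ := by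
    obtain ⟨z, rfl⟩ := kLin_bij f t ψ
    have hz := (kLin_coc f t z).1 hψ
    apply exists_pow_ann
    rintro _ ⟨i, rfl⟩
    have p : Finsupp.linearCombination A z (Finsupp.single Fin.elim0 (1 : A)) = z Fin.elim0 := by simp
    refine ⟨t, Eq.trans (congrArg (f i ^ t • ·) p) ?_⟩
    exact congrFun hz (Fin.cons i Fin.elim0)
  cs M _ _ m hm := by
    obtain ⟨N, hN⟩ := hm
    refine ⟨N, kLin f N (fun _ => m), ?_, ?_⟩
    · rw [kLin_coc]
      funext v
      exact hN _ (Ideal.pow_mem_pow (Ideal.subset_span (Set.mem_range_self (v 0))) _)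
    · have p : Finsupp.linearCombination A (fun _ => m) (Finsupp.single (Fin.elim0 : Fin 0 → ι) (1 : A)) = m := by simp
      exact p
  cd M _ _ t ψ hψ h0 := by
    obtain ⟨z, rfl⟩ := kLin_bij f t ψ
    have p : Finsupp.linearCombination A z (Finsupp.single Fin.elim0 (1 : A)) = z Fin.elim0 := by simp
    have hz : z = 0 := by
      funext v
      rw [Subsingleton.elim v Fin.elim0]
      exact p.symm.trans h0
    rw [kLin_dead]
    refine ⟨0, ?_⟩
    rw [kt_zero]
    exact hz

/-- Main comparison: local cohomology versus Koszul. -/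
theorem lc_iff_koszul [Fintype ι] (f : ι → A) (I : Ideal A) (hI : I = Ideal.span (Set.range f)) (a : A) (n : ℕ)
    (M : ModuleCat.{0} A) : IsSMulRegular ((localCohomology I n).obj M) a ↔ KNZD M f a n := by
  subst hI
  rw [isSMulRegular_iff_ext, PSys.nzd_compare (extGood _) (kosGood f), kosSys_nzd]
end good
end part6

section part7
open CategoryTheory Opposite
section smul
variable {ι A M : Type} [CommRing A] [AddCommGroup M] [Module A M]

lemma KCob.smul {g : ι → A} : ∀ {n : ℕ} {z : (Fin n → ι) → M} (_ : KCob g z) (a : A), KCob g (a • z)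
  | 0, z, h, a => by
    change z = 0 at h
    change a • z = 0
    rw [h, smul_zero]
  | n + 1, z, ⟨w, hw⟩, a => ⟨a • w, by rw [kd_smul, hw]⟩

lemma KDead.smul {f : ι → A} {t n : ℕ} {z : (Fin n → ι) → M} (h : KDead f t z) (a : A) : KDead f t (a • z) := by
  obtain ⟨k, hk⟩ := h
  exact ⟨k, by rw [kt_smul]; exact hk.smul a⟩

variable {B : Type} [CommRing B] 

lemma kd_ringHom (φ : A →+* B) (g : ι → A) (g' : ι → B) (hg : ∀ i, φ (g i) = g' i) {n : ℕ} (z : (Fin n → ι) → A) :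
    φ ∘ (kd g z) = kd g' (φ ∘ z) := by
  funext v
  exact kd_nat' g g' φ.toAddMonoidHom (fun i m => by simp [hg]) z v

lemma kt_ringHom (φ : A →+* B) (f : ι → A) (k : ℕ) {n : ℕ} (z : (Fin n → ι) → A) :
    φ ∘ (kt f k z) = kt (φ ∘ f) k (φ ∘ z) := by
  funext v
  simp [kt]

lemma KCob.map (φ : A →+* B) (g : ι → A) (g' : ι → B) (hg : ∀ i, φ (g i) = g' i) :
    ∀ {n : ℕ} {z : (Fin n → ι) → A} (_ : KCob g z), KCob g' (φ ∘ z)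
  | 0, z, h => by
    change z = 0 at h
    change _ = _
    rw [h]
    funext v
    simp
  | n + 1, z, ⟨w, hw⟩ => ⟨φ ∘ w, by rw [hw, kd_ringHom φ g g' hg]⟩

lemma KDead.map (φ : A →+* B) {f : ι → A} {t n : ℕ} {z : (Fin n → ι) → A} (h : KDead f t z) :
    KDead (φ ∘ f) t (φ ∘ z) := by
  obtain ⟨k, hk⟩ := h
  refine ⟨k, ?_⟩
  rw [← kt_ringHom]
  exact hk.map φ _ _ (by simp)
end smul

section loc
variable {ι A B : Type} [CommRing A] [CommRing B] [Algebra A B] (S : Submonoid A) [IsLocalization S B] [Fintype ι]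

lemma clear_den {n : ℕ} (z : (Fin n → ι) → B) : ∃ s ∈ S, ∃ z0 : (Fin n → ι) → A,
    algebraMap A B ∘ z0 = algebraMap A B s • z := by
  classical
  obtain ⟨s, hs⟩ := IsLocalization.exist_integer_multiples_of_finite S z
  choose z0 hz0 using hs
  refine ⟨s, s.2, z0, ?_⟩
  funext v
  have := hz0 v
  rw [Algebra.smul_def] at this
  exact this

include S in
lemma eq_den {n : ℕ} (z z' : (Fin n → ι) → A) (h : algebraMap A B ∘ z = algebraMap A B ∘ z') :
    ∃ s ∈ S, s • z = s • z' := by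
  classical
  have : ∀ v, ∃ s : S, s * z v = s * z' v := fun v => by
    obtain ⟨c, hc⟩ := (IsLocalization.eq_iff_exists S B).1 (congrFun h v)
    exact ⟨c, hc⟩
  choose s hs using this
  refine ⟨∏ v, (s v : A), Submonoid.prod_mem _ (fun v _ => (s v).2), ?_⟩
  funext v
  obtain ⟨c, hc⟩ := Finset.dvd_prod_of_mem (fun v => (s v : A)) (Finset.mem_univ v)
  simp only [Pi.smul_apply, smul_eq_mul]
  rw [hc]
  linear_combination c * hs v

include S in
lemma dead_den (f : ι → A) (t : ℕ) {n : ℕ} (z : (Fin n → ι) → A)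
    (h : KDead (algebraMap A B ∘ f) t (algebraMap A B ∘ z)) : ∃ c ∈ S, KDead f t (c • z) := by
  obtain ⟨k, hk⟩ := h
  rw [← kt_ringHom] at hk
  cases n with
  | zero =>
    change _ = _ at hk
    obtain ⟨c, hc, h⟩ := eq_den S (B := B) (kt f k z) 0 (by rw [hk]; funext v; simp)
    refine ⟨c, hc, k, ?_⟩
    change _ = _
    rw [kt_smul, h, smul_zero]
  | succ n =>
    obtain ⟨w, hw⟩ := hk
    obtain ⟨s1, hs1, w0, hw0⟩ := clear_den S w
    obtain ⟨s2, hs2, h2⟩ := eq_den S (B := B) (s1 • kt f k z) (kd (f ^ (t + k)) w0) (by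
      rw [kd_ringHom (algebraMap A B) _ ((algebraMap A B ∘ f) ^ (t + k)) (by simp), hw0, kd_smul, ← hw]
      funext v
      simp)
    refine ⟨s2 * s1, mul_mem hs2 hs1, k, s2 • w0, ?_⟩
    rw [kt_smul, mul_smul, h2, kd_smul]

include S in
theorem KNZD_loc (f : ι → A) (a : A) (n : ℕ) (H : KNZD A f a n) :
    KNZD B (algebraMap A B ∘ f) (algebraMap A B a) n := by
  intro t z hz hd
  obtain ⟨s, hs, z0, hz0⟩ := clear_den S z
  obtain ⟨s', hs', hc⟩ := eq_den S (B := B) (kd (f ^ t) z0) 0 (by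
      rw [kd_ringHom (algebraMap A B) _ ((algebraMap A B ∘ f) ^ t) (by simp), hz0, kd_smul, hz]
      funext v
      simp)
  obtain ⟨c, hcS, hcd⟩ := dead_den S (B := B) f t (a • s' • z0) (by
    have e : algebraMap A B ∘ (a • s' • z0) = (algebraMap A B s' * algebraMap A B s) • (algebraMap A B a • z) := by
      funext v
      have := congrFun hz0 v
      simp only [Function.comp_apply, Pi.smul_apply, smul_eq_mul, map_mul] at this ⊢
      rw [this]
      ring
    rw [e]
    exact hd.smul _)
  have h1 : KDead f t (c • s' • z0) := by
    apply H
    · rw [kd_smul, kd_smul, hc, smul_zero, smul_zero]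
    · rwa [smul_comm a c]
  have h2 := h1.map (algebraMap A B)
  have hu : IsUnit (algebraMap A B (c * s' * s)) := IsLocalization.map_units B ⟨_, mul_mem (mul_mem hcS hs') hs⟩
  have e : algebraMap A B ∘ (c • s' • z0) = (algebraMap A B (c * s' * s)) • z := by
      funext v
      have := congrFun hz0 v
      simp only [Function.comp_apply, Pi.smul_apply, smul_eq_mul, map_mul] at this ⊢
      rw [this]
      ring
  rw [e] at h2
  obtain ⟨b, hb⟩ := hu.exists_left_inv
  have := h2.smul b
  rwa [smul_smul, hb, one_smul] at this
end loc
end part7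

section part8
open CategoryTheory Opposite
lemma finite_bad {R N : Type} [CommRing R] [IsNoetherianRing R] [AddCommGroup N] [Module R N] [Module.Finite R N] :
    {p : ℕ | p.Prime ∧ ¬ IsSMulRegular N (p : R)}.Finite := by
  have hfin : (associatedPrimes R N).Finite := associatedPrimes.finite R N
  have hsub : {p : ℕ | p.Prime ∧ ¬ IsSMulRegular N (p : R)} ⊆
      ⋃ P ∈ associatedPrimes R N, {p : ℕ | p.Prime ∧ (p : R) ∈ P} := by
    rintro p ⟨hp, h⟩
    have : (p : R) ∈ ⋃ P ∈ associatedPrimes R N, (P : Set R) := by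
      rw [biUnion_associatedPrimes_eq_compl_regular]
      exact h
    simp only [Set.mem_iUnion] at this ⊢
    obtain ⟨P, hP, h⟩ := this
    exact ⟨P, hP, hp, h⟩
  refine Set.Finite.subset (hfin.biUnion fun P hP => ?_) hsub
  have hprime : P.IsPrime := hP.isPrime
  refine Set.Subsingleton.finite ?_
  rintro p ⟨hp, hpP⟩ q ⟨hq, hqP⟩
  by_contra hne
  have hco : IsCoprime (p : ℤ) (q : ℤ) := Nat.isCoprime_iff_coprime.2 ((Nat.coprime_primes hp hq).2 hne)
  obtain ⟨a, b, hab⟩ := hco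
  apply hprime.ne_top
  rw [Ideal.eq_top_iff_one]
  have h := congrArg (Int.cast : ℤ → R) hab
  push_cast at h
  rw [← h]
  exact P.add_mem (P.mul_mem_left _ hpP) (P.mul_mem_left _ hqP)

lemma exists_good {R N N' : Type} [CommRing R] [IsNoetherianRing R] [AddCommGroup N] [Module R N] [Module.Finite R N]
    [AddCommGroup N'] [Module R N'] [Module.Finite R N'] :
    ∃ p : ℕ, p.Prime ∧ IsSMulRegular N (p : R) ∧ IsSMulRegular N' (p : R) := by
  have h := Nat.infinite_setOfPred_prime.sdiff ((finite_bad (R := R) (N := N)).union (finite_bad (R := R) (N := N')))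
  obtain ⟨p, hp, h⟩ := h.nonempty
  simp only [Set.mem_union, Set.mem_ofPred_eq, not_or, not_and, not_not] at h
  exact ⟨p, hp, h.1 hp, h.2 hp⟩
end part8

section part9
open CategoryTheory Opposite
section lift
variable {ι R S : Type} [CommRing R] [CommRing S] (red : R →+* S) (f : ι → R)

lemma KCob.T {A M : Type} [CommRing A] [AddCommGroup M] [Module A M] (f : ι → A) (t k : ℕ) :
    ∀ {n : ℕ} {z : (Fin n → ι) → M} (_ : KCob (f ^ t) z), KCob (f ^ (t + k)) (kt f k z)
  | 0, z, h => by
    change z = 0 at h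
    change _ = _
    rw [h, kt_map_zero]
  | n + 1, z, ⟨w, hw⟩ => ⟨kt f k w, by rw [hw, kd_kt]⟩

lemma KCob.add {A M : Type} [CommRing A] [AddCommGroup M] [Module A M] {g : ι → A} :
    ∀ {n : ℕ} {z z' : (Fin n → ι) → M} (_ : KCob g z) (_ : KCob g z'), KCob g (z + z')
  | 0, z, z', h, h' => by
    change z = 0 at h
    change z' = 0 at h'
    change _ = _
    rw [h, h', add_zero]
  | n + 1, z, z', ⟨w, hw⟩, ⟨w', hw'⟩ => ⟨w + w', by rw [hw, hw', kd_add]⟩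

lemma KCob.zero {A M : Type} [CommRing A] [AddCommGroup M] [Module A M] {g : ι → A} :
    ∀ {n : ℕ}, KCob g (0 : (Fin n → ι) → M)
  | 0 => rfl
  | n + 1 => ⟨0, by rw [kd_zero]⟩

/-- `x` at level `t` lifts at level `u`. -/
def LiftAt (t : ℕ) {n : ℕ} (x : (Fin n → ι) → S) (u : ℕ) : Prop :=
  t ≤ u ∧ ∃ y : (Fin n → ι) → R, kd (f ^ u) y = 0 ∧ KCob ((red ∘ f) ^ u) (red ∘ y - kt (red ∘ f) (u - t) x)

def KLift (t : ℕ) {n : ℕ} (x : (Fin n → ι) → S) : Prop := ∃ u, LiftAt red f t x u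

variable {red f}

lemma LiftAt.mono {t n : ℕ} {x : (Fin n → ι) → S} {u u' : ℕ} (h : LiftAt red f t x u) (hu : u ≤ u') :
    LiftAt red f t x u' := by
  obtain ⟨htu, y, hy, hc⟩ := h
  refine ⟨htu.trans hu, kt f (u' - u) y, ?_, ?_⟩
  · have := kd_kt f u (u' - u) y
    rw [Nat.add_sub_cancel' hu] at this
    rw [this, hy, kt_map_zero]
  · have := hc.T (red ∘ f) u (u' - u)
    rw [Nat.add_sub_cancel' hu, kt_sub, kt_kt, ← kt_ringHom] at this
    have e : u - t + (u' - u) = u' - t := by omega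
    rwa [e] at this

lemma KLift.add {t n : ℕ} {x x' : (Fin n → ι) → S} (h : KLift red f t x) (h' : KLift red f t x') :
    KLift red f t (x + x') := by
  obtain ⟨u, h⟩ := h
  obtain ⟨u', h'⟩ := h'
  obtain ⟨hu, y, hy, hc⟩ := h.mono (le_max_left u u')
  obtain ⟨_, y', hy', hc'⟩ := h'.mono (le_max_right u u')
  refine ⟨_, hu, y + y', ?_, ?_⟩
  · rw [kd_add, hy, hy', add_zero]
  · have := hc.add hc'
    rw [kt_add]
    convert this using 1
    funext v
    simp
    ring

lemma KLift.zero {t n : ℕ} : KLift red f t (0 : (Fin n → ι) → S) := by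
  refine ⟨t, le_rfl, 0, kd_zero _, ?_⟩
  convert KCob.zero using 1
  funext v
  simp

lemma KLift.smul (hs : Function.Surjective red) {t n : ℕ} {x : (Fin n → ι) → S} (h : KLift red f t x) (s : S) :
    KLift red f t (s • x) := by
  obtain ⟨u, hu, y, hy, hc⟩ := h
  obtain ⟨r, rfl⟩ := hs s
  refine ⟨u, hu, r • y, by rw [kd_smul, hy, smul_zero], ?_⟩
  convert hc.smul (red r) using 1
  rw [kt_smul, smul_sub]
  congr 1
  funext v
  simp

lemma KLift.sum (hs : Function.Surjective red) {t n : ℕ} {κ : Type} (a : Finset κ) (s : κ → S)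
    (x : κ → (Fin n → ι) → S) (h : ∀ i ∈ a, KLift red f t (x i)) :
    KLift red f t (∑ i ∈ a, s i • x i) := by
  classical
  induction a using Finset.induction_on with
  | empty => exact KLift.zero
  | insert i a hi ih =>
    rw [Finset.sum_insert hi]
    exact ((h i (by simp)).smul hs _).add (ih fun j hj => h j (by simp [hj]))

lemma KLift.kt_iff {t s n : ℕ} (hts : t ≤ s) {x : (Fin n → ι) → S} :
    KLift red f s (kt (red ∘ f) (s - t) x) ↔ KLift red f t x := by
  constructor
  · rintro ⟨u, hu, y, hy, hc⟩
    refine ⟨u, hts.trans hu, y, hy, ?_⟩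
    rw [kt_kt] at hc
    have e : s - t + (u - s) = u - t := by omega
    rwa [e] at hc
  · rintro ⟨u, h⟩
    obtain ⟨hu, y, hy, hc⟩ := h.mono (le_max_left u s)
    refine ⟨max u s, le_max_right _ _, y, hy, ?_⟩
    rw [kt_kt]
    have e : s - t + (max u s - s) = max u s - t := by omega
    rwa [e]

lemma exists_lift_fun (hs : Function.Surjective red) {n : ℕ} (x : (Fin n → ι) → S) :
    ∃ y : (Fin n → ι) → R, red ∘ y = x := by
  choose y hy using fun v => hs (x v)
  exact ⟨y, funext hy⟩

lemma red_zero {p : R} (hk : ∀ r, red r = 0 → ∃ r', r = p * r') {n : ℕ} (y : (Fin n → ι) → R)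
    (h : red ∘ y = 0) : ∃ z : (Fin n → ι) → R, y = p • z := by
  choose z hz using fun v => hk (y v) (congrFun h v)
  exact ⟨z, funext hz⟩

lemma red_f (t : ℕ) (i : ι) : red ((f ^ t) i) = ((red ∘ f) ^ t) i := by simp

/-- Reduction to lifting of cocycles. -/
theorem KNZD_of_lift (hs : Function.Surjective red) {p : R} (hp : ∀ r : R, p * r = 0 → r = 0) (hp0 : red p = 0)
    (hk : ∀ r, red r = 0 → ∃ r', r = p * r') (n : ℕ)
    (H : ∀ (t : ℕ) (x : (Fin n → ι) → S), kd ((red ∘ f) ^ t) x = 0 → KLift red f t x) : KNZD R f p (n + 1) := by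
  intro t z hz ⟨k, w, hw⟩
  have hwc : kd ((red ∘ f) ^ (t + k)) (red ∘ w) = 0 := by
    rw [← kd_ringHom red _ _ (red_f (t + k)), ← hw, kt_smul]
    funext v
    simp [hp0]
  obtain ⟨u, hu, y, hy, hc⟩ := H _ _ hwc
  set l := u - (t + k) with hl
  have hul : u = t + k + l := by omega
  have key : ∃ v' : (Fin n → ι) → R, kd (f ^ u) v' = 0 ∧ red ∘ (y - kt f l w - v') = 0 := by
    have e : red ∘ (y - kt f l w) = red ∘ y - kt (red ∘ f) l (red ∘ w) := by
      rw [← kt_ringHom]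
      funext v
      simp
    cases n with
    | zero =>
      change _ = _ at hc
      refine ⟨0, kd_zero _, ?_⟩
      rw [sub_zero, e, hc]
    | succ n =>
      obtain ⟨vb, hvb⟩ := hc
      obtain ⟨v, rfl⟩ := exists_lift_fun hs vb
      refine ⟨kd (f ^ u) v, kd_kd _ _, ?_⟩
      have e2 : red ∘ (y - kt f l w - kd (f ^ u) v) = red ∘ (y - kt f l w) - red ∘ kd (f ^ u) v := by
        funext v
        simp
      rw [e2, kd_ringHom red _ _ (red_f u), e, hvb, sub_self]
  obtain ⟨v', hv', hr⟩ := key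
  obtain ⟨c, hc⟩ := red_zero hk _ hr
  have h1 := congrArg (kd (f ^ u)) hc
  rw [kd_sub, kd_sub, hy, hv', kd_smul, hul, kd_kt, ← hw, kt_kt, kt_smul, zero_sub, sub_zero] at h1
  refine ⟨k + l, -c, ?_⟩
  funext v
  have h2 := congrFun h1 v
  have h3 : p * (kt f (k + l) z v + kd (f ^ (t + k + l)) c v) = 0 := by
    simp only [Pi.neg_apply, Pi.smul_apply, smul_eq_mul] at h2
    rw [mul_add, ← h2]; ring
  have h4 := hp _ h3
  rw [kd_neg, ← add_assoc]
  exact eq_neg_of_add_eq_zero_left h4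

/-- Lifting of level one cocycles. -/
theorem lift_one (hs : Function.Surjective red) {p : R}  (hp0 : red p = 0)
    (hk : ∀ r, red r = 0 → ∃ r', r = p * r') (n : ℕ)
    (good : ∀ (z : (Fin (n + 1) → ι) → R) (w : (Fin n → ι) → R), p • z = kd f w → ∃ w', z = kd f w')
    (x : (Fin n → ι) → S) (hx : kd (red ∘ f) x = 0) : KLift red f 1 x := by
  obtain ⟨w, rfl⟩ := exists_lift_fun hs x
  rw [← kd_ringHom red f (red ∘ f) (fun i => rfl)] at hx
  obtain ⟨z, hz⟩ := red_zero hk _ hx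
  obtain ⟨w', hw'⟩ := good z w hz.symm
  refine ⟨1, le_rfl, w - p • w', ?_, ?_⟩
  · rw [pow_one, kd_sub, kd_smul, hz, hw', sub_self]
  · convert KCob.zero using 1
    funext v
    simp [hp0]
end lift
end part9

section part10
open CategoryTheory Opposite
section cop
open MvPolynomial
variable {d : ℕ} {k : Type} [CommRing k]

lemma cop_inj {q : ℕ} (hq : q ≠ 0) (a : Fin d →₀ ℕ) :
    Function.Injective (fun m : Fin d →₀ ℕ => q • m + a) := by
  intro m m' h
  simp only [add_left_inj] at h
  ext i
  have := DFunLike.congr_fun h i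
  simp only [Finsupp.smul_apply, smul_eq_mul] at this
  exact Nat.eq_of_mul_eq_mul_left (Nat.pos_of_ne_zero hq) this

/-- Extract the coefficients in the class of `a` mod `q`. -/
noncomputable def cop (q : ℕ) [NeZero q] (a : Fin d →₀ ℕ) : MvPolynomial (Fin d) k →+ MvPolynomial (Fin d) k where
  toFun s := AddMonoidAlgebra.ofCoeff
    (Finsupp.comapDomain (fun m : Fin d →₀ ℕ => q • m + a) (AddMonoidAlgebra.coeff s) (cop_inj (NeZero.ne q) a).injOn)
  map_zero' := by
    apply MvPolynomial.ext
    intro m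
    rfl
  map_add' s s' := by
    apply MvPolynomial.ext
    intro m
    rw [coeff_add]
    exact coeff_add (q • m + a) s s'

lemma coeff_cop (q : ℕ) [NeZero q] (a : Fin d →₀ ℕ) (s : MvPolynomial (Fin d) k) (m : Fin d →₀ ℕ) :
    coeff m (cop q a s) = coeff (q • m + a) s := rfl

lemma cop_le_iff {q : ℕ} [NeZero q] {a m n : Fin d →₀ ℕ} (ha : ∀ i, a i < q) :
    q • m ≤ q • n + a ↔ m ≤ n := by
  constructor
  · intro h i
    have h1 := h i
    simp only [Finsupp.smul_apply, smul_eq_mul, Finsupp.add_apply] at h1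
    have h2 : q * m i < q * (n i + 1) := by
      have := ha i
      rw [mul_add]; omega
    exact Nat.lt_succ_iff.mp (Nat.lt_of_mul_lt_mul_left h2)
  · intro h i
    simp only [Finsupp.smul_apply, smul_eq_mul, Finsupp.add_apply]
    exact (Nat.mul_le_mul_left q (h i)).trans (Nat.le_add_right _ _)

lemma cop_expand_mul (q : ℕ) [NeZero q] (a : Fin d →₀ ℕ) (ha : ∀ i, a i < q) (y s : MvPolynomial (Fin d) k) :
    cop q a (expand q y * s) = y * cop q a s := by
  induction y using MvPolynomial.induction_on' with
  | add y y' h h' => rw [map_add, add_mul, map_add, h, h', add_mul]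
  | monomial m r =>
    rw [expand_monomial]
    apply MvPolynomial.ext
    intro n
    rw [coeff_cop, coeff_monomial_mul', coeff_monomial_mul', coeff_cop]
    by_cases h : m ≤ n
    · rw [if_pos h, if_pos ((cop_le_iff ha).mpr h)]
      congr 2
      ext i
      have := h i
      simp only [Finsupp.tsub_apply, Finsupp.add_apply, Finsupp.smul_apply, smul_eq_mul, Nat.mul_sub]
      have := Nat.mul_le_mul_left q this
      omega
    · rw [if_neg h, if_neg (fun h' => h ((cop_le_iff ha).mp h'))]

lemma cop_monomial_mul (q : ℕ) [NeZero q] (a b : Fin d →₀ ℕ) (s : MvPolynomial (Fin d) k) :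
    cop q (b + a) (monomial b 1 * s) = cop q a s := by
  apply MvPolynomial.ext
  intro m
  rw [coeff_cop, coeff_cop]
  have : q • m + (b + a) = b + (q • m + a) := by abel
  rw [this, coeff_monomial_mul, one_mul]

/-- exponent vector -/
noncomputable def exv {q : ℕ} (a : Fin d → Fin q) : Fin d →₀ ℕ := Finsupp.equivFunOnFinite.symm (fun i => (a i : ℕ))

lemma exv_apply {q : ℕ} (a : Fin d → Fin q) (i : Fin d) : exv a i = a i := rfl

lemma exv_lt {q : ℕ} (a : Fin d → Fin q) (i : Fin d) : exv a i < q := (a i).2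

lemma exv_inj {q : ℕ} {a b : Fin d → Fin q} (h : exv a = exv b) : a = b := by
  funext i
  exact Fin.ext (DFunLike.congr_fun h i)

lemma cop_sum (q : ℕ) [NeZero q] (s : MvPolynomial (Fin d) k) :
    s = ∑ a : Fin d → Fin q, monomial (exv a) 1 * expand q (cop q (exv a) s) := by
  apply MvPolynomial.ext
  intro m
  rw [coeff_sum]
  have hq := Nat.pos_of_ne_zero (NeZero.ne q)
  let a0 : Fin d → Fin q := fun i => ⟨m i % q, Nat.mod_lt _ hq⟩
  let m0 : Fin d →₀ ℕ := Finsupp.equivFunOnFinite.symm (fun i => m i / q)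
  have hm : m = exv a0 + q • m0 := by
    ext i
    change m i = m i % q + q * (m i / q)
    rw [Nat.mod_add_div]
  rw [Finset.sum_eq_single a0]
  · nth_rewrite 2 [hm]
    rw [coeff_monomial_mul, one_mul, coeff_expand_smul q (NeZero.ne q), coeff_cop, add_comm, ← hm]
  · intro b _ hb
    rw [coeff_monomial_mul']
    split_ifs with h
    · rw [one_mul]
      obtain ⟨i, hi⟩ := Function.ne_iff.mp hb
      apply coeff_expand_of_not_dvd (i := i)
      rintro ⟨c, hc⟩
      apply hi
      have h1 := h i
      rw [Finsupp.tsub_apply] at hc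
      rw [exv_apply] at h1 hc
      apply Fin.ext
      change (b i : ℕ) = m i % q
      have : m i = b i + q * c := by omega
      rw [this, Nat.add_mul_mod_self_left, Nat.mod_eq_of_lt (b i).2]
    · rfl
  · intro h
    exact absurd (Finset.mem_univ _) h

lemma totalDegree_cop (q : ℕ) [NeZero q] (a : Fin d →₀ ℕ) (s : MvPolynomial (Fin d) k) {D : ℕ}
    (h : s.totalDegree ≤ q * D) : (cop q a s).totalDegree ≤ D := by
  rw [totalDegree, Finset.sup_le_iff]
  intro m hm
  have h1 : q • m + a ∈ s.support := by
    rw [mem_support_iff] at hm ⊢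
    exact hm
  have h2 := (le_totalDegree h1).trans h
  have h3 : (q • m + a).degree ≤ q * D := h2
  rw [map_add, map_nsmul, smul_eq_mul] at h3
  exact Nat.le_of_mul_le_mul_left ((Nat.le_add_right _ _).trans h3) (Nat.pos_of_ne_zero (NeZero.ne q))

lemma expand_zmod_pow (p : ℕ) [Fact p.Prime] (e : ℕ) (s : MvPolynomial (Fin d) (ZMod p)) :
    expand (p ^ e) s = s ^ (p ^ e) := by
  induction e generalizing s with
  | zero => simp
  | succ e ih => rw [pow_succ, expand_mul, expand_zmod, ih, ← pow_mul, mul_comm]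

end cop
end part10

section part11
open CategoryTheory Opposite
section tay
open MvPolynomial
variable {d : ℕ} {k : Type} [CommRing k]

/-- Taylor expansion homomorphism. -/
noncomputable def tay : MvPolynomial (Fin d) k →+* MvPolynomial (Fin d) (MvPolynomial (Fin d) k) :=
  eval₂Hom (C.comp C) (fun i => C (X i) + X i)

lemma tay_X (i : Fin d) : tay (X i : MvPolynomial (Fin d) k) = C (X i) + X i := by simp [tay]
lemma tay_C (r : k) : tay (C r : MvPolynomial (Fin d) k) = C (C r) := by simp [tay]

variable (d k) in
/-- The ideal of `q`-th powers of the Taylor variables. -/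
noncomputable def Jq (q : ℕ) : Ideal (MvPolynomial (Fin d) (MvPolynomial (Fin d) k)) :=
  Ideal.span (Set.range fun i => X i ^ q)

variable (d) in
/-- The top exponent. -/
noncomputable def tp (q : ℕ) : Fin d →₀ ℕ := Finsupp.equivFunOnFinite.symm (fun _ => q - 1)

lemma tp_apply (q : ℕ) (i : Fin d) : tp d q i = q - 1 := rfl

lemma coeff_Jq {q : ℕ} (hq : q ≠ 0) {g : MvPolynomial (Fin d) (MvPolynomial (Fin d) k)} (hg : g ∈ Jq d k q) :
    coeff (tp d q) g = 0 := by
  rw [Jq, Ideal.mem_span_range_iff_exists_fun] at hg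
  obtain ⟨c, rfl⟩ := hg
  rw [coeff_sum]
  apply Finset.sum_eq_zero
  intro i _
  rw [X_pow_eq_monomial, coeff_mul_monomial', if_neg]
  intro h
  have := h i
  rw [tp_apply, Finsupp.single_eq_same] at this
  omega

lemma coeff_mk {q : ℕ} (hq : q ≠ 0) {g g' : MvPolynomial (Fin d) (MvPolynomial (Fin d) k)}
    (h : Ideal.Quotient.mk (Jq d k q) g = Ideal.Quotient.mk (Jq d k q) g') : coeff (tp d q) g = coeff (tp d q) g' := by
  rw [Ideal.Quotient.eq] at h
  have := coeff_Jq hq h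
  rwa [coeff_sub, sub_eq_zero] at this

lemma tay_sub_mem (s : MvPolynomial (Fin d) k) :
    C s - tay s ∈ (Ideal.span (Set.range X) : Ideal (MvPolynomial (Fin d) (MvPolynomial (Fin d) k))) := by
  set Y := (Ideal.span (Set.range X) : Ideal (MvPolynomial (Fin d) (MvPolynomial (Fin d) k)))
  rw [← Ideal.Quotient.eq]
  have : (Ideal.Quotient.mk Y).comp C = (Ideal.Quotient.mk Y).comp tay := by
    apply MvPolynomial.ringHom_ext
    · intro r
      simp [tay_C]
    · intro i
      simp only [RingHom.comp_apply, tay_X, map_add]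
      have h0 : Ideal.Quotient.mk Y (X i) = 0 := Ideal.Quotient.eq_zero_iff_mem.mpr (Ideal.subset_span ⟨i, rfl⟩)
      rw [h0, add_zero]
  exact RingHom.congr_fun this s

variable (d k) in
lemma exists_pow_Jq (q : ℕ) : ∃ N : ℕ,
    (Ideal.span (Set.range X) : Ideal (MvPolynomial (Fin d) (MvPolynomial (Fin d) k))) ^ N ≤ Jq d k q := by
  apply Ideal.exists_pow_le_of_le_radical_of_fg
  · rw [Ideal.span_le]
    rintro _ ⟨i, rfl⟩
    exact ⟨q, Ideal.subset_span ⟨i, rfl⟩⟩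
  · exact Submodule.fg_span (Set.finite_range _)

lemma exists_h {q N : ℕ} (hN : (Ideal.span (Set.range X) :
      Ideal (MvPolynomial (Fin d) (MvPolynomial (Fin d) k))) ^ N ≤ Jq d k q) (u : ℕ) (f : MvPolynomial (Fin d) k) :
    ∃ h, Ideal.Quotient.mk (Jq d k q) (tay f ^ u * h) = Ideal.Quotient.mk (Jq d k q) (C (f ^ (u + N))) := by
  have h1 : (C f - tay f) ^ N ∈ Jq d k q := hN (Ideal.pow_mem_pow (tay_sub_mem f) N)
  have h2 : (tay f + (C f - tay f)) ^ (u + N) ∈ Ideal.span {tay f ^ u, (C f - tay f) ^ N} := by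
    apply Ideal.add_pow_mem_of_pow_mem_of_le (m := u) (n := N)
    · exact Ideal.subset_span (by simp)
    · exact Ideal.subset_span (by simp)
    · omega
  rw [add_sub_cancel, Ideal.mem_span_pair] at h2
  obtain ⟨a, b, hab⟩ := h2
  refine ⟨a, ?_⟩
  rw [map_pow C, ← hab, map_add, map_mul _ b, Ideal.Quotient.eq_zero_iff_mem.mpr h1, mul_zero, add_zero, mul_comm]

/-- Twisted differential operator. -/
noncomputable def tayPsi (q : ℕ) (b : MvPolynomial (Fin d) (MvPolynomial (Fin d) k)) :
    MvPolynomial (Fin d) k →+ MvPolynomial (Fin d) k :=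
  ((lcoeff (MvPolynomial (Fin d) k) (tp d q)).toAddMonoidHom.comp (AddMonoidHom.mulLeft b)).comp tay.toAddMonoidHom

lemma tayPsi_apply (q : ℕ) (b : MvPolynomial (Fin d) (MvPolynomial (Fin d) k)) (s) :
    tayPsi q b s = coeff (tp d q) (b * tay s) := rfl

/-- Chain map. -/
noncomputable def tayD {ι : Type} (q : ℕ) (h : ι → MvPolynomial (Fin d) (MvPolynomial (Fin d) k)) {n : ℕ}
    (z : (Fin n → ι) → MvPolynomial (Fin d) k) : (Fin n → ι) → MvPolynomial (Fin d) k :=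
  fun w => tayPsi q (∏ j, h (w j)) (z w)

lemma tayD_kd {ι : Type} {q : ℕ} (hq : q ≠ 0) {N u : ℕ} (f : ι → MvPolynomial (Fin d) k)
    (h : ι → MvPolynomial (Fin d) (MvPolynomial (Fin d) k))
    (hh : ∀ i, Ideal.Quotient.mk (Jq d k q) (tay (f i) ^ u * h i) = Ideal.Quotient.mk (Jq d k q) (C (f i ^ (u + N))))
    {n : ℕ} (z : (Fin n → ι) → MvPolynomial (Fin d) k) :
    tayD q h (kd (f ^ u) z) = kd (f ^ (u + N)) (tayD q h z) := by
  funext v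
  have := kd_nat (f ^ u) (f ^ (u + N)) h (fun b => tayPsi q b) (by
    intro b i m
    simp only [tayPsi_apply, smul_eq_mul, Pi.pow_apply]
    rw [← coeff_C_mul]
    apply coeff_mk hq
    rw [map_mul tay, map_mul, map_mul, map_mul, map_mul (Ideal.Quotient.mk _) (C _), ← hh, map_mul, map_mul, map_pow]
    ring) 1 z v
  simp only [one_mul] at this
  exact this

lemma tayD_sub {ι : Type} (q : ℕ) (h : ι → MvPolynomial (Fin d) (MvPolynomial (Fin d) k)) {n : ℕ}
    (z z' : (Fin n → ι) → MvPolynomial (Fin d) k) : tayD q h (z - z') = tayD q h z - tayD q h z' := by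
  funext w
  simp [tayD]

lemma tayD_KCob {ι : Type} {q : ℕ} (hq : q ≠ 0) {N u : ℕ} (f : ι → MvPolynomial (Fin d) k)
    (h : ι → MvPolynomial (Fin d) (MvPolynomial (Fin d) k))
    (hh : ∀ i, Ideal.Quotient.mk (Jq d k q) (tay (f i) ^ u * h i) = Ideal.Quotient.mk (Jq d k q) (C (f i ^ (u + N)))) :
    ∀ {n : ℕ} {z : (Fin n → ι) → MvPolynomial (Fin d) k}, KCob (f ^ u) z → KCob (f ^ (u + N)) (tayD q h z)
  | 0, z, hz => by
    change z = 0 at hz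
    change _ = _
    subst hz
    funext w
    simp [tayD]
  | n + 1, z, ⟨w, hw⟩ => ⟨tayD q h w, by rw [hw, tayD_kd hq f h hh]⟩

/-- Coefficients of Taylor expansion of a monomial in high degree. -/
lemma coeff_tay_monomial : ∀ (N : ℕ) (a b : Fin d →₀ ℕ), a.degree = N → N ≤ b.degree →
    coeff b (tay (monomial a (1 : k))) = if a = b then 1 else 0
  | 0, a, b, ha, _ => by
    rw [Finsupp.degree_eq_zero_iff] at ha
    subst ha
    have : (monomial 0 (1 : k) : MvPolynomial (Fin d) k) = 1 := rfl
    classical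
    rw [this, map_one, coeff_one]
  | N + 1, a, b, ha, hb => by
    classical
    have hne : a ≠ 0 := by
      rintro rfl
      simp at ha
    obtain ⟨i, hi⟩ := Finsupp.ne_iff.mp hne
    have hle : Finsupp.single i 1 ≤ a := by
      rw [Finsupp.single_le_iff]
      exact Nat.one_le_iff_ne_zero.mpr hi
    obtain ⟨a', rfl⟩ := exists_add_of_le hle
    have ha' : a'.degree = N := by
      rw [map_add, Finsupp.degree_single] at ha
      omega
    have e : (monomial (Finsupp.single i 1 + a') (1 : k) : MvPolynomial (Fin d) k) = X i * monomial a' 1 := by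
      rw [X, monomial_mul, one_mul]
    rw [e, map_mul, tay_X, add_mul, coeff_add, coeff_C_mul, coeff_tay_monomial N a' b ha' (by omega), coeff_X_mul']
    rw [if_neg (by rintro rfl; omega), mul_zero, zero_add]
    by_cases hib : i ∈ b.support
    · have hle : Finsupp.single i 1 ≤ b := by
        rw [Finsupp.single_le_iff]
        exact Nat.one_le_iff_ne_zero.mpr (Finsupp.mem_support_iff.mp hib)
      obtain ⟨b', rfl⟩ := exists_add_of_le hle
      have hb' : N ≤ b'.degree := by
        rw [map_add, Finsupp.degree_single] at hb
        omega
      rw [if_pos hib, add_tsub_cancel_left, coeff_tay_monomial N a' b' ha' hb']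
      simp
    · rw [if_neg hib, if_neg]
      rintro rfl
      simp at hib

lemma tay_expand (p : ℕ) [Fact p.Prime] (e : ℕ) (s : MvPolynomial (Fin d) (ZMod p)) :
    Ideal.Quotient.mk (Jq d (ZMod p) (p ^ e)) (tay (s ^ p ^ e)) = Ideal.Quotient.mk (Jq d (ZMod p) (p ^ e)) (C (s ^ p ^ e)) := by
  rw [← expand_zmod_pow]
  set π := Ideal.Quotient.mk (Jq d (ZMod p) (p ^ e))
  have : (π.comp tay).comp (expand (p ^ e)).toRingHom = (π.comp C).comp (expand (p ^ e)).toRingHom := by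
    apply MvPolynomial.ringHom_ext
    · intro r
      simp [tay_C]
    · intro i
      simp only [RingHom.comp_apply, AlgHom.toRingHom_eq_coe, RingHom.coe_coe, expand_X, map_pow tay, tay_X]
      have h0 : π (X i ^ p ^ e) = 0 := Ideal.Quotient.eq_zero_iff_mem.mpr (Ideal.subset_span ⟨i, rfl⟩)
      rw [add_pow_char_pow, map_add, h0, add_zero, map_pow C]
  exact RingHom.congr_fun this s

lemma theta_eq (p : ℕ) [Fact p.Prime] (e : ℕ) (s : MvPolynomial (Fin d) (ZMod p)) :
    coeff (tp d (p ^ e)) (tay s) = (cop (p ^ e) (tp d (p ^ e)) s) ^ p ^ e := by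
  have hq : p ^ e ≠ 0 := NeZero.ne _
  have hq1 : 0 < p ^ e := Nat.pos_of_ne_zero hq
  conv_lhs => rw [cop_sum (p ^ e) s]
  rw [map_sum, coeff_sum]
  have key : ∀ a : Fin d → Fin (p ^ e), coeff (tp d (p ^ e)) (tay (monomial (exv a) 1 * expand (p ^ e) (cop (p ^ e) (exv a) s)))
      = if exv a = tp d (p ^ e) then (cop (p ^ e) (tp d (p ^ e)) s) ^ p ^ e else 0 := by
    intro a
    rw [expand_zmod_pow]
    have : coeff (tp d (p ^ e)) (tay (monomial (exv a) 1 * (cop (p ^ e) (exv a) s) ^ p ^ e)) =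
        coeff (tp d (p ^ e)) (C ((cop (p ^ e) (exv a) s) ^ p ^ e) * tay (monomial (exv a) 1)) := by
      apply coeff_mk hq
      rw [map_mul tay, mul_comm (tay _), map_mul, tay_expand, map_mul]
    rw [this, coeff_C_mul, coeff_tay_monomial _ (exv a) _ rfl]
    · split_ifs with h
      · rw [h, mul_one]
      · rw [mul_zero]
    · apply Finsupp.degree_mono
      intro i
      rw [tp_apply]
      have := exv_lt a i
      omega
  simp only [key]
  let a0 : Fin d → Fin (p ^ e) := fun _ => ⟨p ^ e - 1, by omega⟩
  have h0 : exv a0 = tp d (p ^ e) := rfl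
  rw [Finset.sum_eq_single a0, if_pos h0]
  · intro b _ hb
    rw [if_neg]
    intro h
    exact hb (exv_inj (h.trans h0.symm))
  · intro h
    exact absurd (Finset.mem_univ _) h
end tay
end part11

section part12
open CategoryTheory Opposite
section dclos
open MvPolynomial
variable {d : ℕ}

/-- Reduction mod `p`. -/
noncomputable def redp (d p : ℕ) : MvPolynomial (Fin d) ℤ →+* MvPolynomial (Fin d) (ZMod p) :=
  MvPolynomial.map (Int.castRingHom (ZMod p))

lemma redp_tay (p : ℕ) (r : MvPolynomial (Fin d) ℤ) : MvPolynomial.map (redp d p) (tay r) = tay (redp d p r) := by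
  have : (MvPolynomial.map (redp d p)).comp tay = tay.comp (redp d p) := by
    apply MvPolynomial.ringHom_ext
    · intro r
      simp [tay_C, redp]
    · intro i
      simp [tay_X, redp]
  exact RingHom.congr_fun this r

lemma redp_Jq (p q : ℕ) {g g' : MvPolynomial (Fin d) (MvPolynomial (Fin d) ℤ)}
    (h : Ideal.Quotient.mk (Jq d ℤ q) g = Ideal.Quotient.mk (Jq d ℤ q) g') :
    Ideal.Quotient.mk (Jq d (ZMod p) q) (MvPolynomial.map (redp d p) g) =
      Ideal.Quotient.mk (Jq d (ZMod p) q) (MvPolynomial.map (redp d p) g') := by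
  rw [Ideal.Quotient.eq] at h ⊢
  rw [← map_sub]
  have h1 := Ideal.mem_map_of_mem (MvPolynomial.map (redp d p)) h
  have h2 : (Jq d ℤ q).map (MvPolynomial.map (redp d p)) ≤ Jq d (ZMod p) q := by
    rw [Jq, Ideal.map_span, Ideal.span_le]
    rintro _ ⟨_, ⟨i, rfl⟩, rfl⟩
    simp only [map_pow, map_X]
    exact Ideal.subset_span ⟨i, rfl⟩
  exact h2 h1

lemma redp_tayD {ι : Type} (p q : ℕ) (h : ι → MvPolynomial (Fin d) (MvPolynomial (Fin d) ℤ)) {n : ℕ}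
    (z : (Fin n → ι) → MvPolynomial (Fin d) ℤ) :
    redp d p ∘ tayD q h z = tayD q (fun i => MvPolynomial.map (redp d p) (h i)) (redp d p ∘ z) := by
  funext w
  simp only [Function.comp_apply, tayD, tayPsi_apply]
  rw [← redp_tay, ← map_prod, ← map_mul, coeff_map]

theorem Dclosure {ι : Type} (p : ℕ) [Fact p.Prime] (e : ℕ) (f : ι → MvPolynomial (Fin d) ℤ) {n : ℕ}
    (x : (Fin n → ι) → MvPolynomial (Fin d) (ZMod p)) (hx : KLift (redp d p) f (p ^ e) x) :
    KLift (redp d p) f (p ^ e) (fun v => (cop (p ^ e) (tp d (p ^ e)) (x v)) ^ p ^ e) := by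
  obtain ⟨u0, hu0⟩ := hx
  have hq : p ^ e ≠ 0 := NeZero.ne _
  obtain ⟨u, hul⟩ : ∃ u, u = p ^ e * (u0 + 1) := ⟨_, rfl⟩
  have hu0u : u0 ≤ u := by
    rw [hul]
    have := Nat.le_mul_of_pos_left (u0 + 1) (Nat.pos_of_ne_zero hq)
    omega
  obtain ⟨hqu, y, hy, hc⟩ := hu0.mono hu0u
  obtain ⟨N, hN⟩ := exists_pow_Jq d ℤ (p ^ e)
  choose h hh using fun i => exists_h hN u (f i)
  set fb := redp d p ∘ f with hfb
  set hb := fun i => MvPolynomial.map (redp d p) (h i) with hhb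
  have hhb' : ∀ i, Ideal.Quotient.mk (Jq d (ZMod p) (p ^ e)) (tay (fb i) ^ u * hb i) =
      Ideal.Quotient.mk (Jq d (ZMod p) (p ^ e)) (C (fb i ^ (u + N))) := by
    intro i
    have := redp_Jq p (p ^ e) (hh i)
    rw [map_mul, map_pow, redp_tay, map_C, map_pow] at this
    exact this
  have key : kt fb u (tayD (p ^ e) hb (kt fb (u - p ^ e) x)) =
      kt fb (u + N + u - p ^ e) (fun v => (cop (p ^ e) (tp d (p ^ e)) (x v)) ^ p ^ e) := by
    funext v
    simp only [kt, tayD, tayPsi_apply, smul_eq_mul, ← theta_eq]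
    rw [← coeff_C_mul, ← coeff_C_mul]
    apply coeff_mk hq
    set π := Ideal.Quotient.mk (Jq d (ZMod p) (p ^ e))
    have e1 : ∀ s : MvPolynomial (Fin d) (ZMod p), π (C (s ^ u)) = π (tay (s ^ u)) := by
      intro s
      rw [hul, mul_comm, pow_mul, tay_expand]
    have e2 : ∀ s : MvPolynomial (Fin d) (ZMod p), π (tay (s ^ (u - p ^ e))) = π (C (s ^ (u - p ^ e))) := by
      intro s
      have : u - p ^ e = u0 * p ^ e := by
        rw [hul, mul_add, mul_one, Nat.add_sub_cancel, mul_comm]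
      rw [this, pow_mul, tay_expand]
    calc π (C (∏ j, fb (v j) ^ u) * ((∏ j, hb (v j)) * tay ((∏ j, fb (v j) ^ (u - p ^ e)) * x v)))
        = (∏ j, (π (C (fb (v j) ^ u)) * π (hb (v j)) * π (tay (fb (v j) ^ (u - p ^ e))))) * π (tay (x v)) := by
          simp only [map_mul, map_prod, Finset.prod_mul_distrib]
          ring
      _ = (∏ j, π (C (fb (v j) ^ (u + N + u - p ^ e)))) * π (tay (x v)) := by
          congr 1
          apply Finset.prod_congr rfl
          intro j _
          rw [e1, e2, ← map_mul, map_pow tay, hhb', ← map_mul, ← map_mul, ← pow_add]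
          congr 4
          omega
      _ = _ := by
          simp only [map_mul, map_prod]
  refine ⟨u + N + u, by omega, kt f u (tayD (p ^ e) h y), ?_, ?_⟩
  · rw [kd_kt, ← tayD_kd hq f h hh, hy]
    have : tayD (p ^ e) h (0 : (Fin (n + 1) → ι) → MvPolynomial (Fin d) ℤ) = 0 := by
      funext w
      simp [tayD]
    rw [this, kt_map_zero]
  · have h1 := (tayD_KCob hq fb hb hhb' hc).T fb (u + N) u
    rw [tayD_sub, kt_sub, key, ← redp_tayD, hfb, ← kt_ringHom] at h1
    exact h1
end dclos
end part12

section part13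
open CategoryTheory Opposite
section pig
open MvPolynomial
variable {d : ℕ} {ι : Type} (p : ℕ) [Fact p.Prime]

lemma redp_surj (d p : ℕ) : Function.Surjective (redp d p) :=
  MvPolynomial.map_surjective _ (ZMod.ringHom_surjective _)

lemma cop_pow_mul (e : ℕ) (a : Fin d → Fin (p ^ e)) (y s : MvPolynomial (Fin d) (ZMod p)) :
    cop (p ^ e) (exv a) (y ^ p ^ e * s) = y * cop (p ^ e) (exv a) s := by
  rw [← expand_zmod_pow, cop_expand_mul _ _ (exv_lt a)]

lemma cop_sum_pow (e : ℕ) (s : MvPolynomial (Fin d) (ZMod p)) :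
    s = ∑ a : Fin d → Fin (p ^ e), monomial (exv a) 1 * (cop (p ^ e) (exv a) s) ^ p ^ e := by
  simp only [← expand_zmod_pow]
  exact cop_sum _ s

lemma cop_cocycle (e : ℕ) (g : ι → MvPolynomial (Fin d) (ZMod p)) {n : ℕ}
    (x : (Fin n → ι) → MvPolynomial (Fin d) (ZMod p)) (hx : kd (g ^ p ^ e) x = 0) (a : Fin d → Fin (p ^ e)) :
    kd g (fun v => cop (p ^ e) (exv a) (x v)) = 0 := by
  funext v
  rw [← kd_nat' (g ^ p ^ e) g (cop (p ^ e) (exv a)), hx]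
  · simp
  · intro i m
    exact cop_pow_mul p e a _ _

lemma finite_deg (D : ℕ) : {s : MvPolynomial (Fin d) (ZMod p) | s.totalDegree ≤ D}.Finite := by
  have : Finite (restrictTotalDegree (Fin d) (ZMod p) D) := Module.finite_of_finite (ZMod p)
  have h : {s : MvPolynomial (Fin d) (ZMod p) | s.totalDegree ≤ D} = (restrictTotalDegree (Fin d) (ZMod p) D : Set _) := by
    ext s
    exact (mem_restrictTotalDegree (Fin d) D s).symm
  rw [h]
  exact Set.toFinite _

/-- Frobenius components of a cocycle. -/
noncomputable def Cw (g : ι → MvPolynomial (Fin d) (ZMod p)) {n : ℕ} (e : ℕ) (a : Fin d → Fin (p ^ e))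
    (w : (Fin n → ι) → MvPolynomial (Fin d) (ZMod p)) : (Fin n → ι) → MvPolynomial (Fin d) (ZMod p) :=
  fun v => cop (p ^ e) (exv a) (kt g (p ^ e - 1) w v)

/-- Module generated by Frobenius components. -/
noncomputable def Me (g : ι → MvPolynomial (Fin d) (ZMod p)) {n : ℕ}
    (W : Finset ((Fin n → ι) → MvPolynomial (Fin d) (ZMod p))) (e : ℕ) :
    Submodule (MvPolynomial (Fin d) (ZMod p)) ((Fin n → ι) → MvPolynomial (Fin d) (ZMod p)) :=
  Submodule.span _ {x | ∃ w ∈ W, ∃ a, x = Cw p g e a w}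

lemma Cw_bound [Fintype ι] (g : ι → MvPolynomial (Fin d) (ZMod p)) {n : ℕ} (w : (Fin n → ι) → MvPolynomial (Fin d) (ZMod p)) :
    ∃ D, ∀ e a v, (Cw p g e a w v).totalDegree ≤ D := by
  refine ⟨n * (∑ i, (g i).totalDegree) + ∑ v, (w v).totalDegree, ?_⟩
  intro e a v
  apply totalDegree_cop
  have hq : 0 < p ^ e := Nat.pos_of_ne_zero (NeZero.ne _)
  simp only [kt, smul_eq_mul]
  refine (totalDegree_mul _ _).trans ?_
  rw [mul_add]
  apply add_le_add
  · refine (totalDegree_finsetProd _ _).trans ?_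
    calc ∑ j, (g (v j) ^ (p ^ e - 1)).totalDegree ≤ ∑ _j : Fin n, p ^ e * ∑ i, (g i).totalDegree := by
          apply Finset.sum_le_sum
          intro j _
          refine (totalDegree_pow _ _).trans ?_
          apply Nat.mul_le_mul (Nat.sub_le _ _)
          exact Finset.single_le_sum (f := fun i => (g i).totalDegree) (fun _ _ => Nat.zero_le _) (Finset.mem_univ (v j))
      _ = _ := by
          simp; ring
  · have h1 : (w v).totalDegree ≤ ∑ v, (w v).totalDegree :=
      Finset.single_le_sum (f := fun v => (w v).totalDegree) (fun _ _ => Nat.zero_le _) (Finset.mem_univ v)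
    exact h1.trans (Nat.le_mul_of_pos_left _ hq)

lemma Me_finite [Fintype ι] (g : ι → MvPolynomial (Fin d) (ZMod p)) {n : ℕ}
    (W : Finset ((Fin n → ι) → MvPolynomial (Fin d) (ZMod p))) : (Set.range (Me p g W)).Finite := by
  choose D hD using fun w : (Fin n → ι) → MvPolynomial (Fin d) (ZMod p) => Cw_bound p g w
  have hB : (Set.pi Set.univ (fun _ : Fin n → ι => {s : MvPolynomial (Fin d) (ZMod p) | s.totalDegree ≤ ∑ w ∈ W, D w})).Finite :=
    Set.Finite.pi' (fun _ => finite_deg p _)|>.subset (fun x hx v => hx v trivial)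
  refine (hB.powerset.image (fun s => Submodule.span (MvPolynomial (Fin d) (ZMod p)) s)).subset ?_
  rintro _ ⟨e, rfl⟩
  refine ⟨_, ?_, rfl⟩
  rintro _ ⟨w, hw, a, rfl⟩ v _
  exact (hD w e a v).trans (Finset.single_le_sum (f := D) (fun _ _ => Nat.zero_le _) hw)

lemma Cw_mem (g : ι → MvPolynomial (Fin d) (ZMod p)) {n : ℕ}
    (W : Finset ((Fin n → ι) → MvPolynomial (Fin d) (ZMod p))) (e : ℕ) (a : Fin d → Fin (p ^ e))
    (w : (Fin n → ι) → MvPolynomial (Fin d) (ZMod p))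
    (hw : w ∈ Submodule.span (MvPolynomial (Fin d) (ZMod p)) (W : Set ((Fin n → ι) → MvPolynomial (Fin d) (ZMod p)))) :
    Cw p g e a w ∈ Me p g W e := by
  have hCadd : ∀ a (x y : (Fin n → ι) → MvPolynomial (Fin d) (ZMod p)), Cw p g e a (x + y) = Cw p g e a x + Cw p g e a y := by
    intro a x y
    funext v
    simp [Cw, kt_add]
  have hCsmul : ∀ a (s : MvPolynomial (Fin d) (ZMod p)) (x : (Fin n → ι) → MvPolynomial (Fin d) (ZMod p)),
      Cw p g e a (s • x) = ∑ b, (cop (p ^ e) (exv a) (s * monomial (exv b) 1)) • Cw p g e b x := by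
    intro a s x
    funext v
    rw [Finset.sum_apply]
    simp only [Pi.smul_apply, smul_eq_mul]
    rw [Cw, kt_smul, Pi.smul_apply, smul_eq_mul]
    conv_lhs => rw [cop_sum_pow p e (kt g (p ^ e - 1) x v)]
    rw [Finset.mul_sum, map_sum]
    apply Finset.sum_congr rfl
    intro b _
    rw [← mul_assoc, mul_comm, cop_pow_mul, mul_comm]
    rfl
  have hall : ∀ a, Cw p g e a w ∈ Me p g W e := by
    induction hw using Submodule.span_induction with
    | mem x hx =>
      intro a
      exact Submodule.subset_span ⟨x, hx, a, rfl⟩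
    | zero =>
      intro a
      have : Cw p g e a (0 : (Fin n → ι) → MvPolynomial (Fin d) (ZMod p)) = 0 := by
        funext v
        simp [Cw, kt_map_zero]
      rw [this]
      exact zero_mem _
    | add x y _ _ hx hy =>
      intro a
      rw [hCadd]
      exact add_mem (hx a) (hy a)
    | smul s x _ hx =>
      intro a
      rw [hCsmul]
      exact Submodule.sum_mem _ fun b _ => Submodule.smul_mem _ _ (hx b)
  exact hall a

variable {p} in
lemma KLift_pow_Me (f : ι → MvPolynomial (Fin d) ℤ) {n : ℕ}
    (H1 : ∀ x : (Fin n → ι) → MvPolynomial (Fin d) (ZMod p), kd (redp d p ∘ f) x = 0 → KLift (redp d p) f 1 x)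
    (W : Finset ((Fin n → ι) → MvPolynomial (Fin d) (ZMod p))) (hW : ∀ w ∈ W, kd (redp d p ∘ f) w = 0)
    (e : ℕ) (y : (Fin n → ι) → MvPolynomial (Fin d) (ZMod p)) (hy : y ∈ Me p (redp d p ∘ f) W e) :
    KLift (redp d p) f (p ^ e) (y ^ p ^ e) := by
  have hq : 0 < p ^ e := Nat.pos_of_ne_zero (NeZero.ne _)
  induction hy using Submodule.span_induction with
  | mem x hx =>
    obtain ⟨w, hw, a, rfl⟩ := hx
    have h1 : KLift (redp d p) f (p ^ e) (kt (redp d p ∘ f) (p ^ e - 1) w) :=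
      (KLift.kt_iff hq).mpr (H1 w (hW w hw))
    have h2 := Dclosure p e f _ (h1.smul (redp_surj d p) (monomial (tp d (p ^ e) - exv a) 1))
    convert h2 using 1
    funext v
    simp only [Pi.pow_apply, Cw, Pi.smul_apply, smul_eq_mul]
    congr 1
    have h3 : tp d (p ^ e) = (tp d (p ^ e) - exv a) + exv a := by
      rw [tsub_add_cancel_of_le]
      intro i
      rw [tp_apply]
      have := exv_lt a i
      omega
    rw [← cop_monomial_mul (p ^ e) (exv a) (tp d (p ^ e) - exv a), ← h3]
  | zero =>
    rw [zero_pow (NeZero.ne _)]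
    exact KLift.zero
  | add x y _ _ hx hy =>
    have : (x + y) ^ p ^ e = x ^ p ^ e + y ^ p ^ e := by
      funext v
      simp only [Pi.pow_apply, Pi.add_apply]
      rw [add_pow_char_pow]
    rw [this]
    exact hx.add hy
  | smul s x _ hx =>
    rw [smul_pow]
    exact hx.smul (redp_surj d p) _

variable {p} in
theorem lift_all [Fintype ι] (f : ι → MvPolynomial (Fin d) ℤ) {n : ℕ}
    (H1 : ∀ x : (Fin n → ι) → MvPolynomial (Fin d) (ZMod p), kd (redp d p ∘ f) x = 0 → KLift (redp d p) f 1 x)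
    (t : ℕ) (x : (Fin n → ι) → MvPolynomial (Fin d) (ZMod p)) (hx : kd ((redp d p ∘ f) ^ t) x = 0) :
    KLift (redp d p) f t x := by
  set fb := redp d p ∘ f with hfb
  obtain ⟨W, hW⟩ : (LinearMap.ker (kdL (M := MvPolynomial (Fin d) (ZMod p)) fb n)).FG := IsNoetherian.noetherian _
  have hker : ∀ w : (Fin n → ι) → MvPolynomial (Fin d) (ZMod p), w ∈ LinearMap.ker (kdL fb n) ↔ kd fb w = 0 := fun w => Iff.rfl
  have hWk : ∀ w ∈ W, kd fb w = 0 := by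
    intro w hw
    rw [← hker, ← hW]
    exact Submodule.subset_span hw
  -- pigeonhole
  obtain ⟨e0, c, hc, hM⟩ : ∃ e0 c, t ≤ c ∧ Me p fb W e0 = Me p fb W (e0 + c) := by
    have hfin := Me_finite p fb W
    have : Finite (Set.range (Me p fb W)) := hfin
    obtain ⟨⟨y, hy⟩, hinf⟩ := Finite.exists_infinite_fiber (Set.rangeFactorization (Me p fb W))
    have hinf' : (Set.rangeFactorization (Me p fb W) ⁻¹' {⟨y, hy⟩}).Infinite := Set.infinite_coe_iff.mp hinf
    obtain ⟨e0, he0⟩ := hinf'.nonempty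
    obtain ⟨e1, he1, hlt⟩ := hinf'.exists_gt (e0 + t)
    refine ⟨e0, e1 - e0, by omega, ?_⟩
    have h3 : e0 + (e1 - e0) = e1 := by omega
    rw [h3]
    exact congrArg Subtype.val ((he0 : _ = _).trans (he1 : _ = _).symm)
  have hpc : t ≤ p ^ c := hc.trans (Nat.lt_pow_self (Fact.out : p.Prime).one_lt).le
  -- Frobenius powers of level one cocycles lift
  have hF : ∀ w : (Fin n → ι) → MvPolynomial (Fin d) (ZMod p), kd fb w = 0 → KLift (redp d p) f (p ^ c) (w ^ p ^ c) := by
    intro w hw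
    have hwW : w ∈ Submodule.span (MvPolynomial (Fin d) (ZMod p)) (W : Set ((Fin n → ι) → MvPolynomial (Fin d) (ZMod p))) := by
      rw [hW]
      exact hw
    have hle : p ^ c ≤ p ^ (e0 + c) := Nat.pow_le_pow_right (Fact.out : p.Prime).pos (by omega)
    rw [← KLift.kt_iff hle]
    have h1 : kt fb (p ^ (e0 + c) - p ^ c) (w ^ p ^ c) =
        ∑ a : Fin d → Fin (p ^ e0), (monomial (exv a) 1 : MvPolynomial (Fin d) (ZMod p)) ^ p ^ c • (Cw p fb e0 a w) ^ p ^ (e0 + c) := by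
      funext v
      rw [Finset.sum_apply]
      simp only [Pi.smul_apply, smul_eq_mul, Pi.pow_apply]
      have h2 : kt fb (p ^ (e0 + c) - p ^ c) (w ^ p ^ c) v = (kt fb (p ^ e0 - 1) w v) ^ p ^ c := by
        simp only [kt, smul_eq_mul, Pi.pow_apply, mul_pow, ← Finset.prod_pow, ← pow_mul]
        congr 3
        rw [Nat.sub_mul, one_mul, pow_add]
      rw [h2]
      conv_lhs => rw [cop_sum_pow p e0 (kt fb (p ^ e0 - 1) w v)]
      rw [sum_pow_char_pow]
      apply Finset.sum_congr rfl
      intro a _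
      rw [mul_pow, ← pow_mul, ← pow_add]
      rfl
    rw [h1]
    apply KLift.sum (redp_surj d p)
    intro a _
    apply KLift_pow_Me f H1 W hWk
    rw [← hfb, ← hM]
    exact Cw_mem p fb W e0 a w hwW
  rw [← KLift.kt_iff hpc]
  set x' := kt fb (p ^ c - t) x with hx'
  have hx'c : kd (fb ^ p ^ c) x' = 0 := by
    have := kd_kt fb t (p ^ c - t) x
    rw [Nat.add_sub_cancel' hpc, hx, kt_map_zero] at this
    exact this
  have h4 : x' = ∑ a : Fin d → Fin (p ^ c), (monomial (exv a) 1 : MvPolynomial (Fin d) (ZMod p)) •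
      (fun v => cop (p ^ c) (exv a) (x' v)) ^ p ^ c := by
    funext v
    rw [Finset.sum_apply]
    exact cop_sum_pow p c (x' v)
  rw [h4]
  apply KLift.sum (redp_surj d p)
  intro a _
  exact hF _ (cop_cocycle p c fb x' hx'c a)
end pig
end part13

section part14
open CategoryTheory Opposite
section final

/-- cokernel module controlling good primes in each degree -/
abbrev GoodMod {ι : Type} {d : ℕ} (f : ι → MvPolynomial (Fin d) ℤ) (m : ℕ) : Type :=
  ((Fin (m + 1) → ι) → MvPolynomial (Fin d) ℤ) ⧸ LinearMap.range (kdL (M := MvPolynomial (Fin d) ℤ) f m)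

lemma redp_ker {d p : ℕ} (r : MvPolynomial (Fin d) ℤ) (h : redp d p r = 0) :
    ∃ r', r = (p : MvPolynomial (Fin d) ℤ) * r' := by
  have h1 := (MvPolynomial.C_dvd_iff_zmod p r).mpr h
  obtain ⟨r', hr⟩ := h1
  exact ⟨r', by simpa using hr⟩

lemma p_inj {d p : ℕ} (hp : p.Prime) (r : MvPolynomial (Fin d) ℤ) (h : (p : MvPolynomial (Fin d) ℤ) * r = 0) : r = 0 := by
  rcases mul_eq_zero.mp h with h | h
  · exact absurd (Nat.cast_eq_zero.mp h) hp.ne_zero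
  · exact h

lemma KNZD_zero {ι : Type} {d p : ℕ} (hp : p.Prime) (f : ι → MvPolynomial (Fin d) ℤ) :
    KNZD (MvPolynomial (Fin d) ℤ) f (p : MvPolynomial (Fin d) ℤ) 0 := by
  rintro t z _ ⟨k, hk⟩
  refine ⟨k, ?_⟩
  change _ = _ at hk
  change _ = _
  rw [kt_smul] at hk
  funext v
  exact p_inj hp _ (congrFun hk v)

theorem KNZD_succ {ι : Type} [Fintype ι] {d p : ℕ} (hp : p.Prime) (f : ι → MvPolynomial (Fin d) ℤ) (m : ℕ)
    (h : IsSMulRegular (GoodMod f m) (p : MvPolynomial (Fin d) ℤ)) :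
    KNZD (MvPolynomial (Fin d) ℤ) f (p : MvPolynomial (Fin d) ℤ) (m + 1) := by
  haveI : Fact p.Prime := ⟨hp⟩
  have hp0 : redp d p (p : MvPolynomial (Fin d) ℤ) = 0 := by
    rw [map_natCast, CharP.cast_eq_zero]
  refine KNZD_of_lift (red := redp d p) (redp_surj d p) (p_inj hp) hp0 redp_ker m ?_
  apply lift_all
  apply lift_one (redp_surj d p) hp0 redp_ker m
  intro z w hzw
  have h1 : (Submodule.Quotient.mk z : GoodMod f m) = 0 := by
    apply h
    change (p : MvPolynomial (Fin d) ℤ) • (Submodule.Quotient.mk z : GoodMod f m) = (p : MvPolynomial (Fin d) ℤ) • 0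
    rw [smul_zero, ← Submodule.Quotient.mk_smul, Submodule.Quotient.mk_eq_zero]
    exact ⟨w, hzw.symm⟩
  rw [Submodule.Quotient.mk_eq_zero] at h1
  obtain ⟨w', hw'⟩ := h1
  exact ⟨w', hw'.symm⟩

end final
end part14

/-- Let `R = ℤ[X₁,…,Xₙ]`, let `I` be an ideal of `R`, and fix an integer
`i ≥ 0`. Then there exists a prime number `p` such that `p` is a nonzerodivisor on `H^i_I(R)`
and on `H^{i+1}_I(R)`; moreover, for such `p`, `p` is a nonzerodivisor on `H^i_{IR_m}(R_m)`
and on `H^{i+1}_{IR_m}(R_m)`, where `R_m` is the localization of `R` at the maximal ideal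
`m = (p, X₁,…,Xₙ)`. -/
theorem stmt_15 (n : ℕ) (I : Ideal (Rn n)) (i : ℕ) :
    ∃ p : ℕ, p.Prime ∧
      IsSMulRegular ((localCohomology I i).obj (ModuleCat.of (Rn n) (Rn n))) (p : Rn n) ∧
      IsSMulRegular ((localCohomology I (i + 1)).obj (ModuleCat.of (Rn n) (Rn n)))
        (p : Rn n) ∧
      ∀ hm : (mIdeal n p).IsPrime,
        IsSMulRegular
          ((localCohomology (I.map (algebraMap (Rn n) (RmLoc n p hm))) i).obj
            (ModuleCat.of (RmLoc n p hm) (RmLoc n p hm))) (p : RmLoc n p hm) ∧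
        IsSMulRegular
          ((localCohomology (I.map (algebraMap (Rn n) (RmLoc n p hm))) (i + 1)).obj
            (ModuleCat.of (RmLoc n p hm) (RmLoc n p hm))) (p : RmLoc n p hm) := by
  obtain ⟨r, f, hf⟩ := Submodule.fg_iff_exists_fin_generating_family.mp (IsNoetherian.noetherian I)
  have hI : I = Ideal.span (Set.range f) := hf.symm
  obtain ⟨p, hp, h1, h2⟩ := exists_good (R := Rn n) (N := GoodMod f (i - 1)) (N' := GoodMod f i)
  have hk2 : KNZD (Rn n) f (p : Rn n) (i + 1) := KNZD_succ hp f i h2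
  have hk1 : KNZD (Rn n) f (p : Rn n) i := by
    cases i with
    | zero => exact KNZD_zero hp f
    | succ j => exact KNZD_succ hp f j h1
  refine ⟨p, hp, (lc_iff_koszul f I hI _ _ _).mpr hk1, (lc_iff_koszul f I hI _ _ _).mpr hk2, ?_⟩
  intro hm
  haveI := hm
  haveI : IsNoetherianRing (RmLoc n p hm) := IsLocalization.isNoetherianRing (mIdeal n p).primeCompl _ inferInstance
  have hI' : I.map (algebraMap (Rn n) (RmLoc n p hm)) = Ideal.span (Set.range (algebraMap (Rn n) (RmLoc n p hm) ∘ f)) := by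
    rw [hI, Ideal.map_span, Set.range_comp]
  have hpp : algebraMap (Rn n) (RmLoc n p hm) (p : Rn n) = (p : RmLoc n p hm) := map_natCast _ _
  have l1 := KNZD_loc (B := RmLoc n p hm) (mIdeal n p).primeCompl f (p : Rn n) i hk1
  have l2 := KNZD_loc (B := RmLoc n p hm) (mIdeal n p).primeCompl f (p : Rn n) (i + 1) hk2
  rw [hpp] at l1 l2
  exact ⟨(lc_iff_koszul _ _ hI' _ _ _).mpr l1, (lc_iff_koszul _ _ hI' _ _ _).mpr l2⟩
end
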